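/- Let g be a Riemannian metric on T² such that no geodesic c: ℝ → ℝ² on the universal covering intersects any of its translates τc transversally (τ a nontrivial translation element). Then g is flat. -/

import Mathlib

open Filter Topology Set
open scoped ENNReal

noncomputable section

/-- The Euclidean norm of a point of `ℝ × ℝ` (the universal covering of `T²`). -/
def norm2 (p : ℝ × ℝ) : ℝ := Real.sqrt (p.1 ^ 2 + p.2 ^ 2)

/-- The translation vector of the covering transformation `τ_{(m,n)}` of `T² = ℝ²/ℤ²`. -/
def lat (k : ℤ × ℤ) : ℝ × ℝ := ((k.1 : ℝ), (k.2 : ℝ))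

/-- The transl of a curve in `ℝ²` by the covering transformation `τ_k`. -/
def transl (k : ℤ × ℤ) (c : ℝ → ℝ × ℝ) : ℝ → ℝ × ℝ := fun t => c t + lat k

/-- The asymptotic direction `δ(τ_k)` of the axes of the translation element `τ_k`. -/
def latDir (k : ℤ × ℤ) : ℝ × ℝ := (norm2 (lat k))⁻¹ • lat k

/-- A smooth Riemannian metric on the torus `T² = ℝ²/ℤ²`, described through its lift to the
universal covering `ℝ²`: a smooth family of positive definite symmetric bilinear forms on the
tangent spaces of `ℝ²`, invariant under the deck transformation group `ℤ²`. -/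
structure TorusMetric where
  g : (ℝ × ℝ) → (ℝ × ℝ) → (ℝ × ℝ) → ℝ
  smooth : ContDiff ℝ (⊤ : ℕ∞) fun p : (ℝ × ℝ) × (ℝ × ℝ) × (ℝ × ℝ) => g p.1 p.2.1 p.2.2
  symm : ∀ x v w, g x v w = g x w v
  linear : ∀ x w, IsLinearMap ℝ fun v => g x v w
  posdef : ∀ x v, v ≠ 0 → 0 < g x v v
  periodic : ∀ (k : ℤ × ℤ) (x v w : ℝ × ℝ), g (x + lat k) v w = g x v w

namespace TorusMetric

/-- The Riemannian length of the curve `c` between the parameters `a` and `b`. -/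
def length (M : TorusMetric) (c : ℝ → ℝ × ℝ) (a b : ℝ) : ℝ :=
  ∫ t in a..b, Real.sqrt (M.g (c t) (deriv c t) (deriv c t))

/-- The Riemannian distance on the universal covering `ℝ²` (hence also on `T²`). -/
def dist (M : TorusMetric) (x y : ℝ × ℝ) : ℝ :=
  sInf {L | ∃ c : ℝ → ℝ × ℝ, ContDiff ℝ 1 c ∧ c 0 = x ∧ c 1 = y ∧ L = M.length c 0 1}

/-- A (complete, unit speed) geodesic of the lifted metric on the universal covering `ℝ²`:
a smooth curve with constant unit speed which is locally length minimizing. -/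
def IsGeodesic (M : TorusMetric) (c : ℝ → ℝ × ℝ) : Prop :=
  ContDiff ℝ (⊤ : ℕ∞) c ∧ (∀ t, M.g (c t) (deriv c t) (deriv c t) = 1) ∧
    ∀ t : ℝ, ∃ ε > 0, ∀ s₁ s₂, t - ε ≤ s₁ → s₁ ≤ s₂ → s₂ ≤ t + ε →
      M.dist (c s₁) (c s₂) = M.length c s₁ s₂

end TorusMetric

/-- The distance between two points of the unit tangent bundle `ST²` of the torus; points of
`ST²` are represented by points of the tangent bundle `ℝ² × ℝ²` of the universal covering
(the deck transformations act trivially on the vector component). -/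
def phaseDist (p q : (ℝ × ℝ) × (ℝ × ℝ)) : ℝ :=
  sInf {r : ℝ | ∃ k : ℤ × ℤ, r = norm2 (p.1 - (q.1 + lat k)) + norm2 (p.2 - q.2)}

/-- A `(φ,ε)`-separated set with respect to time `T` for the geodesic flow `φ` of `M` on
`ST²`: a finite family of geodesics (each geodesic `c` representing the phase point
`(c 0, ċ 0) ∈ ST²`, of which `t ↦ (c t, ċ t)` is the flow orbit) such that any two distinct
members satisfy `max_{0 ≤ t ≤ T} d(φᵗ v, φᵗ w) > ε`. -/
def IsSeparated (M : TorusMetric) (ε T : ℝ) (F : Finset (ℝ → ℝ × ℝ)) : Prop :=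
  (∀ c ∈ F, M.IsGeodesic c) ∧
    ∀ c₁ ∈ F, ∀ c₂ ∈ F, c₁ ≠ c₂ →
      ∃ t ∈ Set.Icc (0 : ℝ) T, ε < phaseDist (c₁ t, deriv c₁ t) (c₂ t, deriv c₂ t)

/-- `r_T(φ, ε)`: the maximal cardinality of `(φ,ε)`-separated sets with respect to `T`. -/
def sepCount (M : TorusMetric) (ε T : ℝ) : ℝ≥0∞ :=
  ⨆ (F : Finset (ℝ → ℝ × ℝ)) (_ : IsSeparated M ε T F), (F.card : ℝ≥0∞)

/-- Extended real logarithm of an extended nonnegative real. -/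
def elog (x : ℝ≥0∞) : EReal :=
  if x = 0 then ⊥ else if x = ⊤ then ⊤ else ((Real.log x.toReal : ℝ) : EReal)

/-- Bowen's topological entropy `h_top(g)` of the geodesic flow of `g` on `ST²`:
`lim_{ε → 0} limsup_{T → ∞} (1/T) log r_T(φ,ε)`; since `r_T(φ,ε)` is monotone in `ε`,
the limit `ε → 0` is realized as the supremum over `ε > 0`. -/
def topEnt (M : TorusMetric) : EReal :=
  ⨆ (ε : ℝ) (_ : 0 < ε),
    Filter.limsup (fun T : ℝ => ((T⁻¹ : ℝ) : EReal) * elog (sepCount M ε T)) Filter.atTop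

/-- The forward ray `c⁺` of `c` is escaping: `‖c(t)‖ → ∞` as `t → ∞`. -/
def EscapesForward (c : ℝ → ℝ × ℝ) : Prop :=
  Filter.Tendsto (fun t => norm2 (c t)) Filter.atTop Filter.atTop

/-- The backward ray `c⁻` of `c` is escaping: `‖c(-t)‖ → ∞` as `t → ∞`. -/
def EscapesBackward (c : ℝ → ℝ × ℝ) : Prop :=
  Filter.Tendsto (fun t => norm2 (c (-t))) Filter.atTop Filter.atTop

/-- `z ∈ S¹` is the asymptotic direction `δ(c⁺) = lim_{t → ∞} c(t)/‖c(t)‖` of the forward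
ray of `c`. -/
def HasDirection (c : ℝ → ℝ × ℝ) (z : ℝ × ℝ) : Prop :=
  norm2 z = 1 ∧ Filter.Tendsto (fun t => (norm2 (c t))⁻¹ • c t) Filter.atTop (nhds z)

/-- The canonical projection `π : S¹ → P¹(ℝ) ≅ ℝ ∪ {∞}`, sending `(x, y)` to `y/x` if
`x ≠ 0` and to `∞` otherwise; `ℝ ∪ {∞}` is the one-point compactification of `ℝ`. -/
def projPt (z : ℝ × ℝ) : OnePoint ℝ :=
  if z.1 = 0 then OnePoint.infty else ((z.2 / z.1 : ℝ) : OnePoint ℝ)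

/-- `crossDet v w ≠ 0` expresses transversality of two directions in `ℝ²`. -/
def crossDet (v w : ℝ × ℝ) : ℝ := v.1 * w.2 - v.2 * w.1

/-- The set of points at which the curve `c₁` (restricted to parameters in `D₁`) and the
curve `c₂` (restricted to parameters in `D₂`) intersect transversally. -/
def transInter (c₁ c₂ : ℝ → ℝ × ℝ) (D₁ D₂ : Set ℝ) : Set (ℝ × ℝ) :=
  {x | ∃ s ∈ D₁, ∃ t ∈ D₂, c₁ s = x ∧ c₂ t = x ∧ crossDet (deriv c₁ s) (deriv c₂ t) ≠ 0}

/-- The geodesic `c` is an axis of the (nontrivial) translation element `τ_k`: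
`τ_k c(t) = c(t + ℓ)` for some `ℓ` and all `t`. -/
def IsAxisOf (M : TorusMetric) (c : ℝ → ℝ × ℝ) (k : ℤ × ℤ) : Prop :=
  M.IsGeodesic c ∧ k ≠ 0 ∧ ∃ ℓ : ℝ, ∀ t, c (t + ℓ) = c t + lat k

/-- The geodesic `c` is an axis of some nontrivial translation element. -/
def IsAxis (M : TorusMetric) (c : ℝ → ℝ × ℝ) : Prop := ∃ k : ℤ × ℤ, IsAxisOf M c k

/-- The curve `c` is minimal: each of its segments minimizes the Riemannian length between
its endpoints. -/
def IsMinimal (M : TorusMetric) (c : ℝ → ℝ × ℝ) : Prop :=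
  ∀ s t : ℝ, s ≤ t → M.dist (c s) (c t) = M.length c s t

/-- Equivalence of translation elements: `τ₁^a = τ₂^b` for some nonzero integers `a, b`. -/
def TransEquiv (k₁ k₂ : ℤ × ℤ) : Prop := ∃ a b : ℤ, a ≠ 0 ∧ b ≠ 0 ∧ a • k₁ = b • k₂

/-- A translation element is primitive if it is not a nontrivial power of another
translation element. -/
def IsPrimitive (k : ℤ × ℤ) : Prop := k ≠ 0 ∧ ∀ (j : ℤ × ℤ) (n : ℤ), k = n • j → IsUnit n

/-- The metric `g` on `T²` is flat, i.e. its Gaussian curvature vanishes identically;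
equivalently (by the theorems of Myers–Steenrod and Cartan–Hadamard), the universal covering
`ℝ²` with the induced Riemannian distance is isometric to the Euclidean plane. -/
def IsFlat (M : TorusMetric) : Prop :=
  ∃ F : (ℝ × ℝ) ≃ (ℝ × ℝ), ∀ x y, M.dist x y = norm2 (F x - F y)

namespace FlatTorus

open scoped NNReal

section Flow

variable {E : Type*} [NormedAddCommGroup E] [NormedSpace ℝ E]

theorem solution_unique {Y : E → E} {K : ℝ≥0} (hK : LipschitzWith K Y) {f g : ℝ → E}
    (hf : ∀ t, HasDerivAt f (Y (f t)) t) (hg : ∀ t, HasDerivAt g (Y (g t)) t) {t₀ : ℝ}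
    (h : f t₀ = g t₀) : f = g :=
  ODE_solution_unique_univ (v := fun _ => Y) (s := fun _ => univ) (K := K)
    (fun _ => hK.lipschitzOnWith) (fun t => ⟨hf t, mem_univ _⟩) (fun t => ⟨hg t, mem_univ _⟩) h

theorem exists_global_flow [CompleteSpace E] {Y : E → E} {K L : ℝ≥0} (hK : LipschitzWith K Y)
    (hL : ∀ z, ‖Y z‖ ≤ L) :
    ∃ Φ : ℝ → E → E, (∀ z, Φ 0 z = z) ∧ ∀ z t, HasDerivAt (fun s => Φ s z) (Y (Φ t z)) t := by
  have key : ∀ (n : ℕ) (z : E), ∃ α : ℝ → E, α 0 = z ∧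
      ∀ t ∈ Ioo (-(n + 1 : ℝ)) (n + 1), HasDerivAt α (Y (α t)) t := by
    intro n z
    have h0 : (0 : ℝ) ∈ Icc (-(n + 1 : ℝ)) (n + 1) := by constructor <;> linarith [n.cast_nonneg (α := ℝ)]
    have hp : IsPicardLindelof (fun _ => Y) (⟨0, h0⟩ : Icc (-(n + 1 : ℝ)) (n + 1)) z
        (L * (n + 1)) 0 L K := by
      apply IsPicardLindelof.of_time_independent (fun x _ => hL x) hK.lipschitzOnWith
      simp
    obtain ⟨α, h1, h2⟩ := hp.exists_eq_forall_mem_Icc_hasDerivWithinAt₀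
    exact ⟨α, h1, fun t ht => (h2 t (Ioo_subset_Icc_self ht)).hasDerivAt (Icc_mem_nhds ht.1 ht.2)⟩
  choose α h0 hα using key
  have agree : ∀ (m n : ℕ), m ≤ n → ∀ z, ∀ t ∈ Ioo (-(m + 1 : ℝ)) (m + 1), α m z t = α n z t := by
    intro m n hmn z
    have hmn' : (m : ℝ) ≤ n := by exact_mod_cast hmn
    apply ODE_solution_unique_of_mem_Ioo (v := fun _ => Y) (s := fun _ => univ) (K := K)
      (t₀ := 0) (fun _ _ => hK.lipschitzOnWith)
    · constructor <;> linarith [m.cast_nonneg (α := ℝ)]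
    · exact fun t ht => ⟨hα m z t ht, mem_univ _⟩
    · exact fun t ht => ⟨hα n z t ⟨by linarith [ht.1], by linarith [ht.2]⟩, mem_univ _⟩
    · rw [h0, h0]
  have floor : ∀ t : ℝ, t ∈ Ioo (-((⌊|t|⌋₊ : ℕ) + 1 : ℝ)) ((⌊|t|⌋₊ : ℕ) + 1) := fun t =>
    abs_lt.1 (Nat.lt_floor_add_one |t|)
  refine ⟨fun t z => α ⌊|t|⌋₊ z t, fun z => by simp [h0], fun z t => ?_⟩
  have ev : (fun s => α ⌊|s|⌋₊ z s) =ᶠ[𝓝 t] α ⌊|t|⌋₊ z := by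
    filter_upwards [isOpen_Ioo.mem_nhds (floor t)] with s hs
    rcases le_total ⌊|t|⌋₊ ⌊|s|⌋₊ with h | h
    · exact (agree _ _ h z s hs).symm
    · exact agree _ _ h z s (floor s)
  exact (hα _ z t (floor t)).congr_of_eventuallyEq ev

variable {Y : E → E} {K L : ℝ≥0} {Φ : ℝ → E → E}

theorem flow_add (hK : LipschitzWith K Y) (h0 : ∀ z, Φ 0 z = z)
    (hd : ∀ z t, HasDerivAt (fun s => Φ s z) (Y (Φ t z)) t) (s t : ℝ) (z : E) :
    Φ (s + t) z = Φ s (Φ t z) := by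
  have := solution_unique hK (f := fun s => Φ (s + t) z) (g := fun s => Φ s (Φ t z)) (t₀ := 0)
    (fun u => by simpa using (hd z (u + t)).comp_add_const u t) (fun u => hd _ u) (by simp [h0])
  exact congrFun this s

theorem flow_dist_le_of_nonneg (hK : LipschitzWith K Y) (h0 : ∀ z, Φ 0 z = z)
    (hd : ∀ z t, HasDerivAt (fun s => Φ s z) (Y (Φ t z)) t) {t : ℝ} (ht : 0 ≤ t) (z w : E) :
    dist (Φ t z) (Φ t w) ≤ dist z w * Real.exp (K * t) := by
  have := dist_le_of_trajectories_ODE (v := fun _ => Y) (K := K) (f := fun s => Φ s z)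
    (g := fun s => Φ s w) (a := 0) (b := t) (δ := dist z w) (fun _ => hK)
    (fun s _ => (hd z s).continuousAt.continuousWithinAt) (fun s _ => (hd z s).hasDerivWithinAt)
    (fun s _ => (hd w s).continuousAt.continuousWithinAt) (fun s _ => (hd w s).hasDerivWithinAt)
    (by simp [h0]) t ⟨ht, le_rfl⟩
  simpa using this

theorem flow_dist_le (hK : LipschitzWith K Y) (h0 : ∀ z, Φ 0 z = z)
    (hd : ∀ z t, HasDerivAt (fun s => Φ s z) (Y (Φ t z)) t) (t : ℝ) (z w : E) :
    dist (Φ t z) (Φ t w) ≤ dist z w * Real.exp (K * |t|) := by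
  rcases le_total 0 t with ht | ht
  · rw [abs_of_nonneg ht]; exact flow_dist_le_of_nonneg hK h0 hd ht z w
  · have := flow_dist_le_of_nonneg (Y := fun z => - Y z) (Φ := fun s z => Φ (-s) z) (K := K)
      hK.neg (by simpa using h0) (fun z s => by
        simpa [Function.comp_def] using (hd z (-s)).scomp s (hasDerivAt_neg s))
      (t := -t) (by linarith) z w
    rw [abs_of_nonpos ht]; simpa using this

theorem flow_time_le (hL : ∀ z, ‖Y z‖ ≤ L)
    (hd : ∀ z t, HasDerivAt (fun s => Φ s z) (Y (Φ t z)) t) (s t : ℝ) (z : E) :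
    dist (Φ s z) (Φ t z) ≤ L * |s - t| := by
  have := convex_univ.norm_image_sub_le_of_norm_hasDerivWithin_le (f := fun s => Φ s z) (C := L)
    (fun u _ => (hd z u).hasDerivWithinAt) (fun u _ => hL _) (mem_univ t) (mem_univ s)
  simpa [dist_eq_norm] using this

theorem flow_continuous (hK : LipschitzWith K Y) (hL : ∀ z, ‖Y z‖ ≤ L) (h0 : ∀ z, Φ 0 z = z)
    (hd : ∀ z t, HasDerivAt (fun s => Φ s z) (Y (Φ t z)) t) :
    Continuous fun q : ℝ × E => Φ q.1 q.2 := by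
  rw [continuous_iff_continuousAt]
  rintro ⟨t, z⟩
  rw [ContinuousAt, tendsto_iff_dist_tendsto_zero]
  have hlim : Tendsto (fun q : ℝ × E => L * |q.1 - t| + dist q.2 z * Real.exp (K * |t|))
      (𝓝 (t, z)) (𝓝 0) := by
    have : Continuous (fun q : ℝ × E => L * |q.1 - t| + dist q.2 z * Real.exp (K * |t|)) := by
      fun_prop
    simpa using this.tendsto (t, z)
  refine squeeze_zero (fun _ => dist_nonneg) (fun q => ?_) hlim
  calc dist (Φ q.1 q.2) (Φ t z) ≤ dist (Φ q.1 q.2) (Φ t q.2) + dist (Φ t q.2) (Φ t z) :=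
        dist_triangle _ _ _
    _ ≤ _ := add_le_add (flow_time_le hL hd _ _ _) (flow_dist_le hK h0 hd _ _ _)

/-- If `F` vanishes at `0` and `‖F'‖ ≤ C` on `[-1, 1]` then `‖F h‖ ≤ C |h|`. -/
theorem norm_le_of_deriv_le {F F' : ℝ → E} {C : ℝ} (hF : ∀ t, HasDerivAt F (F' t) t)
    (h0 : F 0 = 0) {h : ℝ} (hC : ∀ t ∈ uIcc 0 h, ‖F' t‖ ≤ C) : ‖F h‖ ≤ C * |h| := by
  have := (convex_uIcc (0 : ℝ) h).norm_image_sub_le_of_norm_hasDerivWithin_le (f := F) (C := C)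
    (fun u _ => (hF u).hasDerivWithinAt) hC left_mem_uIcc right_mem_uIcc
  simpa [h0] using this

theorem flow_taylor_lipschitz {Z : E → E} {K₂ : ℝ≥0} (hK : LipschitzWith K Y)
    (h0 : ∀ z, Φ 0 z = z) (hd : ∀ z t, HasDerivAt (fun s => Φ s z) (Y (Φ t z)) t)
    (hZ : ∀ z t, HasDerivAt (fun s => Y (Φ s z)) (Z (Φ t z)) t) (hZL : LipschitzWith K₂ Z)
    {h : ℝ} (hh : |h| ≤ 1) (z w : E) :
    ‖(Φ h z - z - h • Y z) - (Φ h w - w - h • Y w)‖ ≤ K₂ * Real.exp K * h ^ 2 * ‖z - w‖ := by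
  set C := K₂ * Real.exp K * ‖z - w‖ with hC
  have hCn : 0 ≤ C := by positivity
  have abs_le : ∀ {a t : ℝ}, t ∈ uIcc 0 a → |t| ≤ |a| := by
    intro a t ht
    simpa using abs_sub_left_of_mem_uIcc ht
  have h1 : ∀ t, |t| ≤ 1 → ‖(Y (Φ t z) - Y z) - (Y (Φ t w) - Y w)‖ ≤ C * |t| := by
    intro t ht
    apply norm_le_of_deriv_le (F := fun t => (Y (Φ t z) - Y z) - (Y (Φ t w) - Y w))
      (F' := fun t => Z (Φ t z) - Z (Φ t w))
    · exact fun t => ((hZ z t).sub_const _).sub ((hZ w t).sub_const _)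
    · simp [h0]
    · intro s hs
      have hs1 := (abs_le hs).trans ht
      rw [← dist_eq_norm]
      refine (hZL.dist_le_mul _ _).trans ?_
      have := flow_dist_le hK h0 hd s z w
      have h2 : Real.exp (K * |s|) ≤ Real.exp K := Real.exp_le_exp.2 (by nlinarith [K.coe_nonneg])
      rw [hC, ← dist_eq_norm, mul_assoc]
      gcongr
      rw [mul_comm]
      exact this.trans (by gcongr)
  have h2 := norm_le_of_deriv_le (F := fun t => (Φ t z - z - t • Y z) - (Φ t w - w - t • Y w))
      (F' := fun t => (Y (Φ t z) - Y z) - (Y (Φ t w) - Y w)) (h := h) (C := C * |h|) ?_ ?_ ?_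
  · calc _ ≤ _ := h2
      _ = _ := by rw [mul_assoc, abs_mul_abs_self, hC]; ring
  · intro t
    have e : ∀ z, HasDerivAt (fun t => Φ t z - z - t • Y z) (Y (Φ t z) - Y z) t := fun z => by
      simpa using! ((hd z t).sub_const z).sub ((hasDerivAt_id' t).smul_const (Y z))
    exact (e z).sub (e w)
  · simp [h0]
  · intro t ht
    exact (h1 t ((abs_le ht).trans hh)).trans (mul_le_mul_of_nonneg_left (abs_le ht) (by positivity))

theorem flow_taylor {Z : E → E} {L₂ : ℝ≥0}
    (h0 : ∀ z, Φ 0 z = z) (hd : ∀ z t, HasDerivAt (fun s => Φ s z) (Y (Φ t z)) t)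
    (hZ : ∀ z t, HasDerivAt (fun s => Y (Φ s z)) (Z (Φ t z)) t) (hZL : ∀ z, ‖Z z‖ ≤ L₂)
    (h : ℝ) (z : E) :
    ‖Φ h z - z - h • Y z‖ ≤ L₂ * h ^ 2 := by
  have abs_le : ∀ {a t : ℝ}, t ∈ uIcc 0 a → |t| ≤ |a| := by
    intro a t ht
    simpa using abs_sub_left_of_mem_uIcc ht
  have h1 : ∀ t, ‖Y (Φ t z) - Y z‖ ≤ L₂ * |t| := by
    intro t
    apply norm_le_of_deriv_le (F := fun t => Y (Φ t z) - Y z) (F' := fun t => Z (Φ t z))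
    · exact fun t => (hZ z t).sub_const _
    · simp [h0]
    · exact fun s _ => hZL _
  have h2 := norm_le_of_deriv_le (F := fun t => Φ t z - z - t • Y z)
      (F' := fun t => Y (Φ t z) - Y z) (h := h) (C := L₂ * |h|) ?_ ?_ ?_
  · calc _ ≤ _ := h2
      _ = _ := by rw [mul_assoc, abs_mul_abs_self]; ring
  · intro t
    simpa using! ((hd z t).sub_const z).sub ((hasDerivAt_id' t).smul_const (Y z))
  · simp [h0]
  · intro t ht
    exact (h1 t).trans (mul_le_mul_of_nonneg_left (abs_le ht) (by positivity))

end Flow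

end FlatTorus

namespace FlatTorus

open scoped NNReal

abbrev V := ℝ × ℝ

theorem lat_add (k l : ℤ × ℤ) : lat (k + l) = lat k + lat l := by simp [lat]
theorem lat_neg (k : ℤ × ℤ) : lat (-k) = -lat k := by simp [lat]
theorem lat_sub (k l : ℤ × ℤ) : lat (k - l) = lat k - lat l := by simp [lat]
theorem lat_zero : lat 0 = 0 := by simp [lat]
theorem lat_ne_zero {k : ℤ × ℤ} (hk : k ≠ 0) : lat k ≠ 0 := by
  intro h
  apply hk
  simpa [lat, Prod.ext_iff] using h

theorem one_le_norm_lat {k : ℤ × ℤ} (hk : k ≠ 0) : 1 ≤ ‖lat k‖ := by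
  by_contra! h
  apply hk
  have h1 := (norm_fst_le (lat k)).trans_lt h
  have h2 := (norm_snd_le (lat k)).trans_lt h
  simp only [lat, Real.norm_eq_abs] at h1 h2
  have h1' : |k.1| < 1 := by exact_mod_cast h1
  have h2' : |k.2| < 1 := by exact_mod_cast h2
  exact Prod.ext (Int.abs_lt_one_iff.1 h1') (Int.abs_lt_one_iff.1 h2')

theorem exists_lat_mem (x : V) : ∃ k : ℤ × ℤ, x + lat k ∈ Icc (0 : V) 1 := by
  refine ⟨(-⌊x.1⌋, -⌊x.2⌋), ?_⟩
  have h1 := Int.floor_le x.1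
  have h2 := Int.lt_floor_add_one x.1
  have h3 := Int.floor_le x.2
  have h4 := Int.lt_floor_add_one x.2
  simp only [lat, mem_Icc, Prod.le_def]
  simp
  refine ⟨⟨h1, h3⟩, by linarith, by linarith⟩

theorem isCompact_cell : IsCompact (Icc (0 : V) 1) := isCompact_Icc

theorem periodic_bounded {F : Type*} [SeminormedAddCommGroup F] {f : V → F} (hf : Continuous f)
    (hp : ∀ k x, f (x + lat k) = f x) : ∃ C : ℝ, 0 < C ∧ ∀ x, ‖f x‖ ≤ C := by
  obtain ⟨C, hC⟩ := isCompact_cell.exists_bound_of_continuousOn hf.continuousOn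
  refine ⟨max C 1, by positivity, fun x => ?_⟩
  obtain ⟨k, hk⟩ := exists_lat_mem x
  rw [← hp k x]
  exact (hC _ hk).trans (le_max_left _ _)

theorem fderiv_periodic {F : Type*} [NormedAddCommGroup F] [NormedSpace ℝ F] {f : V → F}
    (hp : ∀ k x, f (x + lat k) = f x) (k : ℤ × ℤ) (x : V) :
    fderiv ℝ f (x + lat k) = fderiv ℝ f x := by
  have : (fun x => f (x + lat k)) = f := funext (hp k)
  conv_rhs => rw [← this]
  rw [fderiv_comp_add_right]

/-- Uniform first and second order Taylor bounds. -/
structure TaylorBound (f : V → ℝ) (C : ℝ) : Prop where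
  pos : 0 < C
  bound : ∀ x, |f x| ≤ C
  dbound : ∀ x v, |fderiv ℝ f x v| ≤ C * ‖v‖
  lip : ∀ x v, |f (x + v) - f x| ≤ C * ‖v‖
  quad : ∀ x v, |f (x + v) - f x - fderiv ℝ f x v| ≤ C * ‖v‖ ^ 2

theorem norm_sub_le_of_fderiv_le {E F : Type*} [NormedAddCommGroup E] [NormedSpace ℝ E]
    [NormedAddCommGroup F] [NormedSpace ℝ F] {f : E → F} (hf : Differentiable ℝ f) {C : ℝ}
    (hC : ∀ x, ‖fderiv ℝ f x‖ ≤ C) (x y : E) : ‖f y - f x‖ ≤ C * ‖y - x‖ :=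
  convex_univ.norm_image_sub_le_of_norm_fderiv_le (fun x _ => hf x) (fun x _ => hC x)
    (mem_univ x) (mem_univ y)

theorem exists_taylorBound {f : V → ℝ} (hf : ContDiff ℝ 2 f)
    (hp : ∀ k x, f (x + lat k) = f x) : ∃ C, TaylorBound f C := by
  obtain ⟨C0, h0, hC0⟩ := periodic_bounded hf.continuous hp
  have hf1 : ContDiff ℝ 1 (fderiv ℝ f) := hf.fderiv_right (by norm_num)
  obtain ⟨C1, h1, hC1⟩ := periodic_bounded hf1.continuous (fderiv_periodic hp)
  obtain ⟨C2, h2, hC2⟩ := periodic_bounded (hf1.continuous_fderiv (by norm_num))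
    (fderiv_periodic (fderiv_periodic hp))
  have hd : Differentiable ℝ f := hf.differentiable (by norm_num)
  have hd1 : Differentiable ℝ (fderiv ℝ f) := hf1.differentiable (by norm_num)
  set C := max C0 (max C1 C2)
  have e0 : C0 ≤ C := le_max_left _ _
  have e1 : C1 ≤ C := (le_max_left _ _).trans (le_max_right _ _)
  have e2 : C2 ≤ C := (le_max_right _ _).trans (le_max_right _ _)
  refine ⟨C, ⟨h0.trans_le e0, fun x => (hC0 x).trans e0, fun x v => ?_, fun x v => ?_,
    fun x v => ?_⟩⟩
  · exact ((fderiv ℝ f x).le_opNorm v).trans (by gcongr; exact (hC1 x).trans e1)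
  · simpa using norm_sub_le_of_fderiv_le hd (fun x => (hC1 x).trans e1) x (x + v)
  · have := (convex_segment x (x + v)).norm_image_sub_le_of_norm_fderiv_le' (f := f)
      (C := C * ‖v‖) (φ := fderiv ℝ f x) (fun y _ => hd y) (fun y hy => ?_)
      (left_mem_segment ℝ _ _) (right_mem_segment ℝ _ _)
    · simpa [pow_two, mul_assoc] using this
    · refine (norm_sub_le_of_fderiv_le hd1 (fun x => (hC2 x).trans e2) x y).trans ?_
      gcongr
      have := norm_sub_le_of_mem_segment hy
      simpa using this

theorem quadratic_bounds {q : V → V → ℝ} (hq : Continuous fun z : V × V => q z.1 z.2)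
    (hp : ∀ k x v, q (x + lat k) v = q x v) (hs : ∀ x v (r : ℝ), q x (r • v) = r ^ 2 * q x v)
    (hpos : ∀ x v, v ≠ 0 → 0 < q x v) :
    ∃ c C : ℝ, 0 < c ∧ 0 < C ∧ ∀ x v, c * ‖v‖ ^ 2 ≤ q x v ∧ q x v ≤ C * ‖v‖ ^ 2 := by
  have hK : IsCompact (Icc (0 : V) 1 ×ˢ Metric.sphere (0 : V) 1) :=
    isCompact_cell.prod (isCompact_sphere _ _)
  have hne : (Icc (0 : V) 1 ×ˢ Metric.sphere (0 : V) 1).Nonempty :=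
    ⟨(0, (1, 0)), by simp, by simp [Prod.norm_def]⟩
  obtain ⟨z, hz, hmin⟩ := hK.exists_isMinOn hne hq.continuousOn
  obtain ⟨w, hw, hmax⟩ := hK.exists_isMaxOn hne hq.continuousOn
  have ne : ∀ z ∈ (Icc (0 : V) 1 ×ˢ Metric.sphere (0 : V) 1), z.2 ≠ 0 := by
    rintro z ⟨-, hz⟩ h
    simp [h] at hz
  refine ⟨q z.1 z.2, q w.1 w.2, hpos _ _ (ne z hz), hpos _ _ (ne w hw), fun x v => ?_⟩
  rcases eq_or_ne v 0 with rfl | hv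
  · have := hs x 0 0
    simp at this
    simp [this]
  obtain ⟨k, hk⟩ := exists_lat_mem x
  have hn : 0 < ‖v‖ := norm_pos_iff.2 hv
  have hmem : (x + lat k, ‖v‖⁻¹ • v) ∈ (Icc (0 : V) 1 ×ˢ Metric.sphere (0 : V) 1) := by
    refine ⟨hk, ?_⟩
    simp [norm_smul, hn.ne']
  have e : q x v = ‖v‖ ^ 2 * q (x + lat k) (‖v‖⁻¹ • v) := by
    rw [hp, hs]; field_simp
  have h1 := hmin hmem
  have h2 := hmax hmem
  simp only [mem_ofPred_eq] at h1 h2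
  rw [e]
  constructor <;> nlinarith [sq_nonneg ‖v‖]

variable (M : TorusMetric)

def cE (x : V) : ℝ := M.g x (1, 0) (1, 0)
def cF (x : V) : ℝ := M.g x (1, 0) (0, 1)
def cG (x : V) : ℝ := M.g x (0, 1) (0, 1)
def cD (x : V) : ℝ := cE M x * cG M x - cF M x ^ 2
def al (x : V) : ℝ := cG M x / cD M x
def be (x : V) : ℝ := -cF M x / cD M x
def ga (x : V) : ℝ := cE M x / cD M x

theorem g_eq (x v w : V) : M.g x v w =
    cE M x * (v.1 * w.1) + cF M x * (v.1 * w.2 + v.2 * w.1) + cG M x * (v.2 * w.2) := by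
  have dec : ∀ v : V, v = v.1 • ((1, 0) : V) + v.2 • ((0, 1) : V) := fun v => by ext <;> simp
  have hl : ∀ v w : V, M.g x v w = v.1 * M.g x (1, 0) w + v.2 * M.g x (0, 1) w := by
    intro v w
    conv_lhs => rw [dec v]
    rw [(M.linear x w).map_add, (M.linear x w).map_smul, (M.linear x w).map_smul]; rfl
  rw [hl, M.symm x (1, 0) w, M.symm x (0, 1) w, hl w, hl w, M.symm x (0, 1) (1, 0)]
  simp only [cE, cF, cG]
  ring

theorem cE_pos (x : V) : 0 < cE M x := M.posdef _ _ (by simp)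

theorem cD_pos (x : V) : 0 < cD M x := by
  have h := M.posdef x (-cF M x, cE M x) (by simp [(cE_pos M x).ne'])
  rw [g_eq] at h
  have h' : 0 < cE M x * cD M x := by
    simp only [cD]; nlinarith
  exact (mul_pos_iff_of_pos_left (cE_pos M x)).1 h'

theorem contDiff_g (v w : V) : ContDiff ℝ (⊤ : ℕ∞) fun x => M.g x v w :=
  M.smooth.comp (contDiff_id.prodMk (contDiff_const (c := (v, w))))

theorem contDiff_cE : ContDiff ℝ (⊤ : ℕ∞) (cE M) := contDiff_g M _ _
theorem contDiff_cF : ContDiff ℝ (⊤ : ℕ∞) (cF M) := contDiff_g M _ _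
theorem contDiff_cG : ContDiff ℝ (⊤ : ℕ∞) (cG M) := contDiff_g M _ _
theorem contDiff_cD : ContDiff ℝ (⊤ : ℕ∞) (cD M) :=
  ((contDiff_cE M).mul (contDiff_cG M)).sub ((contDiff_cF M).pow 2)
theorem contDiff_al : ContDiff ℝ (⊤ : ℕ∞) (al M) :=
  (contDiff_cG M).div (contDiff_cD M) fun x => (cD_pos M x).ne'
theorem contDiff_be : ContDiff ℝ (⊤ : ℕ∞) (be M) :=
  (contDiff_cF M).neg.div (contDiff_cD M) fun x => (cD_pos M x).ne'
theorem contDiff_ga : ContDiff ℝ (⊤ : ℕ∞) (ga M) :=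
  (contDiff_cE M).div (contDiff_cD M) fun x => (cD_pos M x).ne'

theorem cE_per (k : ℤ × ℤ) (x : V) : cE M (x + lat k) = cE M x := M.periodic _ _ _ _
theorem cF_per (k : ℤ × ℤ) (x : V) : cF M (x + lat k) = cF M x := M.periodic _ _ _ _
theorem cG_per (k : ℤ × ℤ) (x : V) : cG M (x + lat k) = cG M x := M.periodic _ _ _ _
theorem al_per (k : ℤ × ℤ) (x : V) : al M (x + lat k) = al M x := by
  simp only [al, cD, cE_per, cF_per, cG_per]
theorem be_per (k : ℤ × ℤ) (x : V) : be M (x + lat k) = be M x := by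
  simp only [be, cD, cE_per, cF_per, cG_per]
theorem ga_per (k : ℤ × ℤ) (x : V) : ga M (x + lat k) = ga M x := by
  simp only [ga, cD, cE_per, cF_per, cG_per]

/-- The pairing of covectors with vectors. -/
def dot (p v : V) : ℝ := p.1 * v.1 + p.2 * v.2

/-- The bilinear form dual to the metric. -/
def bf (x p q : V) : ℝ :=
  al M x * (p.1 * q.1) + be M x * (p.1 * q.2 + p.2 * q.1) + ga M x * (p.2 * q.2)

/-- The vector dual to a covector. -/
def sharp (x p : V) : V := (al M x * p.1 + be M x * p.2, be M x * p.1 + ga M x * p.2)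

/-- The covector dual to a vector. -/
def flat (x v : V) : V := (cE M x * v.1 + cF M x * v.2, cF M x * v.1 + cG M x * v.2)

theorem dot_sharp (x p q : V) : dot p (sharp M x q) = bf M x p q := by
  simp only [dot, sharp, bf]; ring

theorem dot_flat (x v w : V) : dot (flat M x v) w = M.g x v w := by
  rw [g_eq]; simp only [dot, flat]; ring

theorem coeff_inverse (x : V) : cE M x * al M x + cF M x * be M x = 1 ∧
    cE M x * be M x + cF M x * ga M x = 0 ∧ cF M x * al M x + cG M x * be M x = 0 ∧
    cF M x * be M x + cG M x * ga M x = 1 := by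
  have h := (cD_pos M x).ne'
  simp only [al, be, ga]
  refine ⟨?_, ?_, ?_, ?_⟩ <;> field_simp <;> simp only [cD] <;> ring

theorem flat_sharp (x p : V) : flat M x (sharp M x p) = p := by
  obtain ⟨h1, h2, h3, h4⟩ := coeff_inverse M x
  ext <;> simp only [flat, sharp]
  · linear_combination p.1 * h1 + p.2 * h2
  · linear_combination p.1 * h3 + p.2 * h4

theorem sharp_flat (x p : V) : sharp M x (flat M x p) = p := by
  obtain ⟨h1, h2, h3, h4⟩ := coeff_inverse M x
  ext <;> simp only [flat, sharp]
  · linear_combination p.1 * h1 + p.2 * h3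
  · linear_combination p.1 * h2 + p.2 * h4

theorem g_sharp (x p w : V) : M.g x (sharp M x p) w = dot p w := by
  rw [← dot_flat, flat_sharp]

theorem g_sharp_sharp (x p : V) : M.g x (sharp M x p) (sharp M x p) = bf M x p p := by
  rw [g_sharp, dot_sharp]

theorem bf_flat (x v : V) : bf M x (flat M x v) (flat M x v) = M.g x v v := by
  rw [← g_sharp_sharp, sharp_flat]

theorem g_nonneg (x v : V) : 0 ≤ M.g x v v := by
  rcases eq_or_ne v 0 with rfl | h
  · rw [g_eq]; simp
  · exact (M.posdef x v h).le

theorem bf_nonneg (x p : V) : 0 ≤ bf M x p p := by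
  rw [← g_sharp_sharp]; exact g_nonneg M _ _

theorem bf_pos (x : V) {p : V} (hp : p ≠ 0) : 0 < bf M x p p := by
  rw [← g_sharp_sharp]
  apply M.posdef
  intro h
  apply hp
  rw [← flat_sharp M x p, h]
  simp [flat]

theorem fenchel (x p v : V) {r : ℝ} (hr : 0 < r) :
    dot p v ≤ r / 2 * bf M x p p + M.g x v v / (2 * r) := by
  have h := g_nonneg M x (v - r • sharp M x p)
  have e : M.g x (v - r • sharp M x p) (v - r • sharp M x p) =
      M.g x v v - 2 * r * dot p v + r ^ 2 * bf M x p p := by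
    rw [← g_sharp_sharp, ← g_sharp M x p v]
    simp only [g_eq]
    simp
    ring
  rw [e] at h
  have : r / 2 * bf M x p p + M.g x v v / (2 * r) - dot p v =
    (M.g x v v - 2 * r * dot p v + r ^ 2 * bf M x p p) / (2 * r) := by field_simp; ring
  have : 0 ≤ (M.g x v v - 2 * r * dot p v + r ^ 2 * bf M x p p) / (2 * r) := by positivity
  linarith

theorem continuous_bf : Continuous fun z : V × V × V => bf M z.1 z.2.1 z.2.2 := by
  have h1 := (contDiff_al M).continuous
  have h2 := (contDiff_be M).continuous
  have h3 := (contDiff_ga M).continuous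
  unfold bf
  fun_prop

theorem continuous_sharp : Continuous fun z : V × V => sharp M z.1 z.2 := by
  have h1 := (contDiff_al M).continuous
  have h2 := (contDiff_be M).continuous
  have h3 := (contDiff_ga M).continuous
  unfold sharp
  fun_prop

theorem continuous_g : Continuous fun z : V × V × V => M.g z.1 z.2.1 z.2.2 := M.smooth.continuous

theorem g_bounds : ∃ c C : ℝ, 0 < c ∧ 0 < C ∧
    ∀ x v, c * ‖v‖ ^ 2 ≤ M.g x v v ∧ M.g x v v ≤ C * ‖v‖ ^ 2 := by
  refine quadratic_bounds (q := fun x v => M.g x v v)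
    ((continuous_g M).comp (f := fun z : V × V => (z.1, z.2, z.2)) (by fun_prop))
    (fun k x v => M.periodic k x v v) (fun x v r => ?_) M.posdef
  simp only [g_eq]; simp; ring

theorem bf_bounds : ∃ c C : ℝ, 0 < c ∧ 0 < C ∧
    ∀ x p, c * ‖p‖ ^ 2 ≤ bf M x p p ∧ bf M x p p ≤ C * ‖p‖ ^ 2 := by
  refine quadratic_bounds (q := fun x v => bf M x v v)
    ((continuous_bf M).comp (f := fun z : V × V => (z.1, z.2, z.2)) (by fun_prop))
    (fun k x v => ?_) (fun x v r => ?_) (fun x p hp => bf_pos M x hp)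
  · simp only [bf, al_per, be_per, ga_per]
  · simp only [bf]; simp; ring

end FlatTorus

namespace FlatTorus

open scoped NNReal

theorem phase_bounded {F : Type*} [SeminormedAddCommGroup F] {f : V × V → F} (hf : Continuous f)
    (hp : ∀ k z, f (z + (lat k, 0)) = f z) {R : ℝ} (hR : ∀ z : V × V, R < ‖z.2‖ → f z = 0) :
    ∃ C : ℝ≥0, ∀ z, ‖f z‖ ≤ C := by
  have hK : IsCompact (Icc (0 : V) 1 ×ˢ Metric.closedBall (0 : V) R) :=
    isCompact_cell.prod (isCompact_closedBall _ _)
  obtain ⟨C, hC⟩ := hK.exists_bound_of_continuousOn hf.continuousOn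
  refine ⟨C.toNNReal, fun z => ?_⟩
  rcases lt_or_ge R ‖z.2‖ with h | h
  · rw [hR z h]; simp
  · obtain ⟨k, hk⟩ := exists_lat_mem z.1
    rw [← hp k z]
    refine (hC _ ⟨hk, ?_⟩).trans (Real.le_coe_toNNReal C)
    simpa using h

theorem fderiv_phase_periodic {F : Type*} [NormedAddCommGroup F] [NormedSpace ℝ F] {f : V × V → F}
    (hp : ∀ k z, f (z + (lat k, 0)) = f z) (k : ℤ × ℤ) (z : V × V) :
    fderiv ℝ f (z + (lat k, 0)) = fderiv ℝ f z := by
  have : (fun x => f (x + (lat k, 0))) = f := funext (hp k)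
  conv_rhs => rw [← this]
  rw [fderiv_comp_add_right]

theorem fderiv_eq_zero_of_far {F : Type*} [NormedAddCommGroup F] [NormedSpace ℝ F] {f : V × V → F}
    {R : ℝ} (hR : ∀ z : V × V, R < ‖z.2‖ → f z = 0) (z : V × V) (hz : R < ‖z.2‖) :
    fderiv ℝ f z = 0 := by
  have : f =ᶠ[𝓝 z] fun _ => 0 := by
    filter_upwards [(isOpen_lt continuous_const continuous_snd.norm).mem_nhds hz] with w hw
    exact hR w hw
  rw [this.fderiv_eq]; simp

variable (M : TorusMetric)

def ham (z : V × V) : ℝ := bf M z.1 z.2 z.2 / 2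

def cutoff (s : ℝ) : ℝ := s * Real.smoothTransition (2 - s)

def hamCut (z : V × V) : ℝ := cutoff (ham M z)

/-- The truncated Hamiltonian vector field. -/
def hamField (z : V × V) : V × V :=
  ((fderiv ℝ (hamCut M) z (0, (1, 0)), fderiv ℝ (hamCut M) z (0, (0, 1))),
    (-fderiv ℝ (hamCut M) z ((1, 0), 0), -fderiv ℝ (hamCut M) z ((0, 1), 0)))

theorem contDiff_ham : ContDiff ℝ (⊤ : ℕ∞) (ham M) := by
  have h1 := (contDiff_al M)
  have h2 := (contDiff_be M)
  have h3 := (contDiff_ga M)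
  unfold ham bf
  fun_prop

theorem contDiff_cutoff : ContDiff ℝ (⊤ : ℕ∞) cutoff :=
  contDiff_id.mul (Real.smoothTransition.contDiff.comp (contDiff_const.sub contDiff_id))

theorem contDiff_hamCut : ContDiff ℝ (⊤ : ℕ∞) (hamCut M) := contDiff_cutoff.comp (contDiff_ham M)

theorem contDiff_hamField : ContDiff ℝ (⊤ : ℕ∞) (hamField M) := by
  have h : ContDiff ℝ (⊤ : ℕ∞) (fderiv ℝ (hamCut M)) :=
    (contDiff_hamCut M).fderiv_right (by simp)
  unfold hamField
  fun_prop

def hamAccel (z : V × V) : V × V := fderiv ℝ (hamField M) z (hamField M z)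

theorem contDiff_hamAccel : ContDiff ℝ (⊤ : ℕ∞) (hamAccel M) := by
  have h : ContDiff ℝ (⊤ : ℕ∞) (fderiv ℝ (hamField M)) :=
    (contDiff_hamField M).fderiv_right (by simp)
  exact h.clm_apply (contDiff_hamField M)

theorem ham_per (k : ℤ × ℤ) (z : V × V) : ham M (z + (lat k, 0)) = ham M z := by
  simp [ham, bf, al_per, be_per, ga_per]

theorem hamCut_per (k : ℤ × ℤ) (z : V × V) : hamCut M (z + (lat k, 0)) = hamCut M z := by
  simp only [hamCut, ham_per]

theorem hamField_per (k : ℤ × ℤ) (z : V × V) : hamField M (z + (lat k, 0)) = hamField M z := by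
  simp only [hamField, fderiv_phase_periodic (hamCut_per M)]

theorem hamAccel_per (k : ℤ × ℤ) (z : V × V) : hamAccel M (z + (lat k, 0)) = hamAccel M z := by
  simp only [hamAccel, fderiv_phase_periodic (hamField_per M), hamField_per]

theorem exists_hamCut_far : ∃ R : ℝ, ∀ z : V × V, R < ‖z.2‖ → hamCut M z = 0 := by
  obtain ⟨c, C, hc, hC, h⟩ := bf_bounds M
  refine ⟨4 / c + 1, fun z hz => ?_⟩
  have h1 := (h z.1 z.2).1
  have h4 : 0 < 4 / c := by positivity
  have h2 : 4 / c < ‖z.2‖ ^ 2 := by nlinarith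
  have h3 : 4 < c * ‖z.2‖ ^ 2 := by
    rw [div_lt_iff₀ hc] at h2; linarith
  have : 2 ≤ ham M z := by unfold ham; linarith
  rw [hamCut, cutoff, Real.smoothTransition.zero_of_nonpos (by linarith), mul_zero]

theorem hamField_bounds : ∃ L K L₂ K₂ : ℝ≥0, (∀ z, ‖hamField M z‖ ≤ L) ∧
    LipschitzWith K (hamField M) ∧ (∀ z, ‖hamAccel M z‖ ≤ L₂) ∧ LipschitzWith K₂ (hamAccel M) ∧
    (∀ z, ‖fderiv ℝ (hamField M) z‖ ≤ K) := by
  obtain ⟨R, hR⟩ := exists_hamCut_far M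
  have hY : ∀ z : V × V, R < ‖z.2‖ → hamField M z = 0 := fun z hz => by
    simp [hamField, fderiv_eq_zero_of_far hR z hz]
  have hZ : ∀ z : V × V, R < ‖z.2‖ → hamAccel M z = 0 := fun z hz => by
    simp [hamAccel, hY z hz]
  obtain ⟨L, hL⟩ := phase_bounded (contDiff_hamField M).continuous (hamField_per M) hY
  obtain ⟨K, hK⟩ := phase_bounded ((contDiff_hamField M).continuous_fderiv (by simp))
    (fderiv_phase_periodic (hamField_per M)) (fderiv_eq_zero_of_far hY)
  obtain ⟨L₂, hL₂⟩ := phase_bounded (contDiff_hamAccel M).continuous (hamAccel_per M) hZ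
  obtain ⟨K₂, hK₂⟩ := phase_bounded ((contDiff_hamAccel M).continuous_fderiv (by simp))
    (fderiv_phase_periodic (hamAccel_per M)) (fderiv_eq_zero_of_far hZ)
  exact ⟨L, K, L₂, K₂, hL,
    lipschitzWith_of_nnnorm_fderiv_le ((contDiff_hamField M).differentiable (by simp)) hK, hL₂,
    lipschitzWith_of_nnnorm_fderiv_le ((contDiff_hamAccel M).differentiable (by simp)) hK₂, hK⟩

theorem exists_hamFlow : ∃ Φ : ℝ → V × V → V × V, (∀ z, Φ 0 z = z) ∧
    ∀ z t, HasDerivAt (fun s => Φ s z) (hamField M (Φ t z)) t := by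
  obtain ⟨L, K, -, -, hL, hK, -⟩ := hamField_bounds M
  exact exists_global_flow hK hL

def hamFlow : ℝ → V × V → V × V := (exists_hamFlow M).choose

theorem hamFlow_zero (z : V × V) : hamFlow M 0 z = z := (exists_hamFlow M).choose_spec.1 z

theorem hamFlow_hasDerivAt (z : V × V) (t : ℝ) :
    HasDerivAt (fun s => hamFlow M s z) (hamField M (hamFlow M t z)) t :=
  (exists_hamFlow M).choose_spec.2 z t

theorem hamFlow_unique {f : ℝ → V × V} (hf : ∀ t, HasDerivAt f (hamField M (f t)) t) (t : ℝ) :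
    f t = hamFlow M t (f 0) := by
  obtain ⟨L, K, -, -, hL, hK, -⟩ := hamField_bounds M
  exact congrFun (solution_unique hK hf (hamFlow_hasDerivAt M (f 0)) (t₀ := 0)
    (by rw [hamFlow_zero])) t

theorem hamFlow_add (s t : ℝ) (z : V × V) : hamFlow M (s + t) z = hamFlow M s (hamFlow M t z) := by
  obtain ⟨L, K, -, -, hL, hK, -⟩ := hamField_bounds M
  exact flow_add hK (hamFlow_zero M) (hamFlow_hasDerivAt M) s t z

theorem hamFlow_neg_cancel (s : ℝ) (z : V × V) : hamFlow M (-s) (hamFlow M s z) = z := by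
  rw [← hamFlow_add, neg_add_cancel, hamFlow_zero]

theorem hamFlow_per (k : ℤ × ℤ) (t : ℝ) (z : V × V) :
    hamFlow M t (z + (lat k, 0)) = hamFlow M t z + (lat k, 0) := by
  have := hamFlow_unique M (f := fun t => hamFlow M t z + (lat k, 0)) (fun t => by
    rw [hamField_per]; exact (hamFlow_hasDerivAt M z t).add_const _) t
  simpa [hamFlow_zero] using this.symm

theorem hamFlow_continuous : Continuous fun q : ℝ × (V × V) => hamFlow M q.1 q.2 := by
  obtain ⟨L, K, -, -, hL, hK, -⟩ := hamField_bounds M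
  exact flow_continuous hK hL (hamFlow_zero M) (hamFlow_hasDerivAt M)

theorem contDiff_hamFlow (z : V × V) : ContDiff ℝ (⊤ : ℕ∞) fun t => hamFlow M t z := by
  rw [contDiff_infty]
  intro n
  induction n with
  | zero =>
    exact contDiff_zero.2 (continuous_iff_continuousAt.2 fun t =>
      (hamFlow_hasDerivAt M z t).continuousAt)
  | succ n ih =>
    push_cast
    rw [contDiff_succ_iff_deriv]
    refine ⟨fun t => (hamFlow_hasDerivAt M z t).differentiableAt, by simp, ?_⟩
    have : deriv (fun t => hamFlow M t z) = fun t => hamField M (hamFlow M t z) :=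
      funext fun t => (hamFlow_hasDerivAt M z t).deriv
    rw [this]
    exact ((contDiff_hamField M).of_le (by exact_mod_cast le_top)).comp ih

/-- The derivative of the Hamiltonian in the base direction. -/
def hamX (x p : V) (v : V) : ℝ :=
  (fderiv ℝ (al M) x v * (p.1 * p.1) + fderiv ℝ (be M) x v * (2 * (p.1 * p.2)) +
    fderiv ℝ (ga M) x v * (p.2 * p.2)) / 2

theorem hasFDerivAt_ham (z w : V × V) :
    fderiv ℝ (ham M) z w = hamX M z.1 z.2 w.1 + dot (sharp M z.1 z.2) w.2 := by
  have ha : HasFDerivAt (fun z : V × V => al M z.1) _ z :=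
    (((contDiff_al M).differentiable (by simp)).differentiableAt.hasFDerivAt).comp z hasFDerivAt_fst
  have hb : HasFDerivAt (fun z : V × V => be M z.1) _ z :=
    (((contDiff_be M).differentiable (by simp)).differentiableAt.hasFDerivAt).comp z hasFDerivAt_fst
  have hc : HasFDerivAt (fun z : V × V => ga M z.1) _ z :=
    (((contDiff_ga M).differentiable (by simp)).differentiableAt.hasFDerivAt).comp z hasFDerivAt_fst
  have h1 : HasFDerivAt (fun z : V × V => z.2.1) _ z :=
    (hasFDerivAt_fst (𝕜 := ℝ) (p := z.2)).comp z hasFDerivAt_snd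
  have h2 : HasFDerivAt (fun z : V × V => z.2.2) _ z :=
    (hasFDerivAt_snd (𝕜 := ℝ) (p := z.2)).comp z hasFDerivAt_snd
  have := (((ha.mul (h1.mul h1)).add (hb.mul ((h1.mul h2).add (h2.mul h1)))).add
    (hc.mul (h2.mul h2))).mul_const (1 / 2 : ℝ)
  have e : ham M = fun z : V × V => (al M z.1 * (z.2.1 * z.2.1) +
      be M z.1 * (z.2.1 * z.2.2 + z.2.2 * z.2.1) + ga M z.1 * (z.2.2 * z.2.2)) * (1 / 2) := by
    ext z; simp only [ham, bf]; ring
  rw [e]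
  refine (DFunLike.congr_fun (HasFDerivAt.fderiv this) w).trans ?_
  simp [hamX, dot, sharp]
  ring

theorem fderiv_hamCut (z : V × V) :
    fderiv ℝ (hamCut M) z = deriv cutoff (ham M z) • fderiv ℝ (ham M) z := by
  have h1 := ((contDiff_cutoff.differentiable (by simp)).differentiableAt (x := ham M z)).hasDerivAt
  have h2 := (((contDiff_ham M).differentiable (by simp)).differentiableAt (x := z)).hasFDerivAt
  exact (h1.comp_hasFDerivAt z h2).fderiv

theorem phase_decomp (w : V × V) : w = w.1.1 • (((1, 0), 0) : V × V) +
    w.1.2 • (((0, 1), 0) : V × V) + w.2.1 • ((0, (1, 0)) : V × V) + w.2.2 • ((0, (0, 1)) : V × V) := by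
  ext <;> simp

theorem ham_hamFlow (t : ℝ) (z : V × V) : ham M (hamFlow M t z) = ham M z := by
  have hd : ∀ t, HasDerivAt (fun t => ham M (hamFlow M t z)) 0 t := by
    intro t
    have h2 := (((contDiff_ham M).differentiable (by simp)).differentiableAt
      (x := hamFlow M t z)).hasFDerivAt
    have h3 := h2.comp_hasDerivAt t (hamFlow_hasDerivAt M z t)
    refine h3.congr_deriv ?_
    rw [phase_decomp (hamField M (hamFlow M t z))]
    simp only [map_add, map_smul, hamField, fderiv_hamCut, smul_apply,
      smul_eq_mul]
    ring
  have := is_const_of_deriv_eq_zero (fun t => (hd t).differentiableAt) (fun t => (hd t).deriv) t 0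
  simpa [hamFlow_zero] using this

theorem cutoff_eventuallyEq {s : ℝ} (hs : s < 1) : cutoff =ᶠ[𝓝 s] id := by
  filter_upwards [isOpen_Iio.mem_nhds hs] with r hr
  have : r < 1 := hr
  simp [cutoff, Real.smoothTransition.one_of_one_le (show 1 ≤ 2 - r by linarith)]

theorem deriv_cutoff {s : ℝ} (hs : s < 1) : deriv cutoff s = 1 := by
  rw [(cutoff_eventuallyEq hs).deriv_eq]; simp

def hamXvec (x p : V) : V := (hamX M x p (1, 0), hamX M x p (0, 1))

theorem dot_hamXvec (x p v : V) : dot (hamXvec M x p) v = hamX M x p v := by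
  have : v = v.1 • ((1, 0) : V) + v.2 • ((0, 1) : V) := by ext <;> simp
  conv_rhs => rw [this]
  simp only [hamX, hamXvec, dot, map_add, map_smul, smul_eq_mul]
  ring

theorem hamField_eq {z : V × V} (hz : ham M z < 1) :
    hamField M z = (sharp M z.1 z.2, -hamXvec M z.1 z.2) := by
  simp only [hamField, fderiv_hamCut, deriv_cutoff hz, one_smul, hasFDerivAt_ham]
  simp [hamX, dot, hamXvec]

/-- Scaling of momenta. -/
def scale (r : ℝ) (z : V × V) : V × V := (z.1, r • z.2)

theorem ham_scale (r : ℝ) (z : V × V) : ham M (scale r z) = r ^ 2 * ham M z := by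
  simp [ham, bf, scale]; ring

theorem hamFlow_scale {z : V × V} (hz : ham M z ≤ 1 / 2) {r : ℝ} (hr : |r| ≤ 1) (t : ℝ) :
    hamFlow M t (scale r z) = scale r (hamFlow M (r * t) z) := by
  have hr2 : r ^ 2 ≤ 1 := by rw [← sq_abs]; nlinarith [abs_nonneg r]
  have := hamFlow_unique M (f := fun t => scale r (hamFlow M (r * t) z)) (fun t => ?_) t
  · simpa [hamFlow_zero] using this.symm
  · have hz1 : ham M (hamFlow M (r * t) z) < 1 := by rw [ham_hamFlow]; linarith
    have hz2 : ham M (scale r (hamFlow M (r * t) z)) < 1 := by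
      rw [ham_scale, ham_hamFlow]
      have : 0 ≤ ham M z := by have := bf_nonneg M z.1 z.2; unfold ham; linarith
      nlinarith
    have h := (hamFlow_hasDerivAt M z (r * t)).scomp t ((hasDerivAt_id t).const_mul r)
    have hL : HasDerivAt (fun t => scale r (hamFlow M (r * t) z))
      (scale r (r • hamField M (hamFlow M (r * t) z))) t := by
      have h' : HasDerivAt (fun t => hamFlow M (r * t) z) (r • hamField M (hamFlow M (r * t) z)) t := by
        simpa [Function.comp_def] using h
      have h1 := h'.fst
      have h2 : HasDerivAt (fun t => (hamFlow M (r * t) z).2) _ t := h'.snd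
      exact HasDerivAt.prodMk h1 (HasDerivAt.const_smul r h2)
    refine hL.congr_deriv ?_
    rw [hamField_eq M hz1, hamField_eq M hz2]
    ext <;> simp [scale, sharp, hamXvec, hamX] <;> ring

theorem hamFlow_fst_hasDerivAt {z : V × V} (hz : ham M z ≤ 1 / 2) (t : ℝ) :
    HasDerivAt (fun s => (hamFlow M s z).1) (sharp M (hamFlow M t z).1 (hamFlow M t z).2) t := by
  have := (hamFlow_hasDerivAt M z t).fst
  rwa [hamField_eq M (by rw [ham_hamFlow]; linarith)] at this

theorem hamFlow_snd_hasDerivAt {z : V × V} (hz : ham M z ≤ 1 / 2) (t : ℝ) :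
    HasDerivAt (fun s => (hamFlow M s z).2) (-hamXvec M (hamFlow M t z).1 (hamFlow M t z).2) t := by
  have := (hamFlow_hasDerivAt M z t).snd
  rwa [hamField_eq M (by rw [ham_hamFlow]; linarith)] at this

end FlatTorus

namespace FlatTorus

open scoped NNReal

variable (M : TorusMetric)

def speed (c : ℝ → V) (t : ℝ) : ℝ := Real.sqrt (M.g (c t) (deriv c t) (deriv c t))

theorem length_eq (c : ℝ → V) (a b : ℝ) : M.length c a b = ∫ t in a..b, speed M c t := rfl

theorem speed_nonneg (c : ℝ → V) (t : ℝ) : 0 ≤ speed M c t := Real.sqrt_nonneg _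

theorem speed_sq (c : ℝ → V) (t : ℝ) :
    speed M c t ^ 2 = M.g (c t) (deriv c t) (deriv c t) := Real.sq_sqrt (g_nonneg M _ _)

theorem speed_continuous {c : ℝ → V} (hc : ContDiff ℝ 1 c) : Continuous (speed M c) := by
  have h1 := hc.continuous
  have h2 := hc.continuous_deriv le_rfl
  exact Real.continuous_sqrt.comp ((continuous_g M).comp (h1.prodMk (h2.prodMk h2)))

theorem length_nonneg (c : ℝ → V) {a b : ℝ} (hab : a ≤ b) : 0 ≤ M.length c a b :=
  intervalIntegral.integral_nonneg hab fun t _ => speed_nonneg M c t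

theorem g_smul (x v : V) (r : ℝ) : M.g x (r • v) (r • v) = r ^ 2 * M.g x v v := by
  simp only [g_eq]; simp; ring

theorem sqrt_g_smul (x v : V) {r : ℝ} (hr : 0 ≤ r) :
    Real.sqrt (M.g x (r • v) (r • v)) = r * Real.sqrt (M.g x v v) := by
  rw [g_smul, Real.sqrt_mul (sq_nonneg r), Real.sqrt_sq hr]

theorem length_comp {c : ℝ → V} (hc : ContDiff ℝ 1 c) {φ : ℝ → ℝ} (hφ : ContDiff ℝ 1 φ) {a b : ℝ}
    (hm : ∀ t ∈ uIcc a b, 0 ≤ deriv φ t) :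
    M.length (c ∘ φ) a b = M.length c (φ a) (φ b) := by
  rw [length_eq, length_eq, ← intervalIntegral.integral_comp_mul_deriv (f := φ) (f' := deriv φ)
    (g := speed M c)
    (fun t _ => (hφ.differentiable (by norm_num)).differentiableAt.hasDerivAt)
    (hφ.continuous_deriv le_rfl).continuousOn (speed_continuous M hc)]
  apply intervalIntegral.integral_congr
  intro t ht
  have h1 := ((hc.differentiable (by norm_num)) (φ t)).hasDerivAt
  have h2 := ((hφ.differentiable (by norm_num)) t).hasDerivAt
  have h3 : deriv (c ∘ φ) t = deriv φ t • deriv c (φ t) := (h1.scomp t h2).deriv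
  simp only [speed, h3, Function.comp]
  rw [sqrt_g_smul M _ _ (hm t ht), mul_comm]

theorem dist_set_bddBelow (x y : V) : BddBelow {L | ∃ c : ℝ → ℝ × ℝ, ContDiff ℝ 1 c ∧ c 0 = x ∧
    c 1 = y ∧ L = M.length c 0 1} :=
  ⟨0, by rintro _ ⟨c, -, -, -, rfl⟩; exact length_nonneg M c zero_le_one⟩

def seg (x y : V) (t : ℝ) : V := x + t • (y - x)

theorem seg_contDiff (x y : V) : ContDiff ℝ 1 (seg x y) := by unfold seg; fun_prop

theorem deriv_seg (x y : V) (t : ℝ) : deriv (seg x y) t = y - x := by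
  have : HasDerivAt (seg x y) ((1 : ℝ) • (y - x)) t :=
    ((hasDerivAt_id t).smul_const (y - x)).const_add x
  simpa using this.deriv

theorem dist_set_nonempty (x y : V) : {L | ∃ c : ℝ → ℝ × ℝ, ContDiff ℝ 1 c ∧ c 0 = x ∧
    c 1 = y ∧ L = M.length c 0 1}.Nonempty :=
  ⟨_, seg x y, seg_contDiff x y, by simp [seg], by simp [seg], rfl⟩

theorem dist_le_length {c : ℝ → V} (hc : ContDiff ℝ 1 c) {a b : ℝ} (hab : a ≤ b) :
    M.dist (c a) (c b) ≤ M.length c a b := by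
  have hφ : ContDiff ℝ 1 fun t : ℝ => a + t * (b - a) := by fun_prop
  have h := length_comp M hc hφ (a := 0) (b := 1) (fun t _ => by
    have : deriv (fun t : ℝ => a + t * (b - a)) t = b - a := by
      simp
    rw [this]; linarith)
  refine csInf_le (dist_set_bddBelow M _ _)
    ⟨c ∘ fun t : ℝ => a + t * (b - a), hc.comp hφ, by simp, by simp, ?_⟩
  rw [h]; simp

theorem le_dist {x y : V} {T : ℝ} (h : ∀ c : ℝ → V, ContDiff ℝ 1 c → c 0 = x → c 1 = y →
    T ≤ M.length c 0 1) : T ≤ M.dist x y := by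
  refine le_csInf (dist_set_nonempty M x y) ?_
  rintro _ ⟨c, h1, h2, h3, rfl⟩
  exact h c h1 h2 h3

theorem exists_curve (x y : V) {ε : ℝ} (hε : 0 < ε) : ∃ c : ℝ → V, ContDiff ℝ 1 c ∧ c 0 = x ∧
    c 1 = y ∧ M.length c 0 1 < M.dist x y + ε := by
  obtain ⟨_, ⟨c, h1, h2, h3, rfl⟩, h⟩ := Real.lt_sInf_add_pos (dist_set_nonempty M x y) hε
  exact ⟨c, h1, h2, h3, h⟩

theorem mdist_nonneg (x y : V) : 0 ≤ M.dist x y :=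
  le_dist M fun c _ _ _ => length_nonneg M c zero_le_one

theorem mdist_comm_le (x y : V) : M.dist x y ≤ M.dist y x := by
  refine le_dist M fun c hc h0 h1 => ?_
  have hφ : ContDiff ℝ 1 fun t : ℝ => 1 - t := by fun_prop
  have := dist_le_length M (hc.comp hφ) (zero_le_one' ℝ)
  simp only [Function.comp, sub_zero, sub_self, h0, h1] at this
  refine this.trans (le_of_eq ?_)
  have e : M.length (fun x => c (1 - x)) 0 1 = ∫ t in (0 : ℝ)..1, speed M c (1 - t) := by
    apply intervalIntegral.integral_congr
    intro t _
    have h3 : deriv (fun x => c (1 - x)) t = - deriv c (1 - t) := by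
      rw [deriv_comp_const_sub]
    simp only [speed, h3]
    have := g_smul M (c (1 - t)) (deriv c (1 - t)) (-1)
    simp only [neg_smul, one_smul] at this
    rw [this]; norm_num
  refine Eq.trans e ?_
  rw [intervalIntegral.integral_comp_sub_left (fun t => speed M c t)]
  simp [length_eq]

theorem mdist_comm (x y : V) : M.dist x y = M.dist y x :=
  le_antisymm (mdist_comm_le M x y) (mdist_comm_le M y x)

theorem length_congr {c γ : ℝ → V} {a b : ℝ} (hab : a ≤ b) (h : EqOn c γ (Ioo a b)) :
    M.length c a b = M.length γ a b := by
  rw [length_eq, length_eq, intervalIntegral.integral_of_le hab, intervalIntegral.integral_of_le hab,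
    MeasureTheory.integral_Ioc_eq_integral_Ioo, MeasureTheory.integral_Ioc_eq_integral_Ioo]
  apply MeasureTheory.setIntegral_congr_fun measurableSet_Ioo
  intro t ht
  have : c =ᶠ[𝓝 t] γ := by
    filter_upwards [isOpen_Ioo.mem_nhds ht] with s hs using h hs
  simp only [speed, this.deriv_eq, this.eq_of_nhds]

theorem smoothTransition_deriv_nonneg (t : ℝ) : 0 ≤ deriv Real.smoothTransition t := by
  exact Real.smoothTransition.monotone.deriv_nonneg

theorem mdist_triangle (x y z : V) : M.dist x z ≤ M.dist x y + M.dist y z := by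
  apply le_of_forall_pos_le_add
  intro ε hε
  obtain ⟨c₁, h1, h10, h11, hl1⟩ := exists_curve M x y (half_pos hε)
  obtain ⟨c₂, h2, h20, h21, hl2⟩ := exists_curve M y z (half_pos hε)
  have hσ : ContDiff ℝ 1 Real.smoothTransition := Real.smoothTransition.contDiff
  have hφ₁ : ContDiff ℝ 1 fun t : ℝ => Real.smoothTransition (2 * t) := by fun_prop
  have hφ₂ : ContDiff ℝ 1 fun t : ℝ => Real.smoothTransition (2 * t - 1) := by fun_prop
  have hd := fun t => ((hσ.differentiable (by norm_num)) t).hasDerivAt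
  have d1 : ∀ t : ℝ, 0 ≤ deriv (fun t : ℝ => Real.smoothTransition (2 * t)) t := by
    intro t
    have := ((hd (2 * t)).comp t ((hasDerivAt_id t).const_mul 2)).deriv
    simp only [Function.comp_def] at this
    rw [this]
    have := smoothTransition_deriv_nonneg (2 * t)
    linarith
  have d2 : ∀ t : ℝ, 0 ≤ deriv (fun t : ℝ => Real.smoothTransition (2 * t - 1)) t := by
    intro t
    have := ((hd (2 * t - 1)).comp t (((hasDerivAt_id t).const_mul 2).sub_const 1)).deriv
    simp only [Function.comp_def, id] at this
    rw [this]
    have := smoothTransition_deriv_nonneg (2 * t - 1)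
    linarith
  set γ : ℝ → V := fun t => c₁ (Real.smoothTransition (2 * t)) +
    c₂ (Real.smoothTransition (2 * t - 1)) - y with hγ
  have hγc : ContDiff ℝ 1 γ := ((h1.comp hφ₁).add (h2.comp hφ₂)).sub contDiff_const
  have e1 : EqOn γ (c₁ ∘ fun t : ℝ => Real.smoothTransition (2 * t)) (Ioo 0 (1 / 2)) := by
    intro t ht
    simp [hγ, Real.smoothTransition.zero_of_nonpos (show 2 * t - 1 ≤ 0 by linarith [ht.2]), h20]
  have e2 : EqOn γ (c₂ ∘ fun t : ℝ => Real.smoothTransition (2 * t - 1)) (Ioo (1 / 2) 1) := by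
    intro t ht
    simp [hγ, Real.smoothTransition.one_of_one_le (show 1 ≤ 2 * t by linarith [ht.1]), h11]
  have g0 : γ 0 = x := by
    simp [hγ, Real.smoothTransition.zero_of_nonpos, h10, h20]
  have g1 : γ 1 = z := by
    simp [hγ, Real.smoothTransition.one_of_one_le (show (1 : ℝ) ≤ 2 by norm_num),
      show (2 : ℝ) - 1 = 1 by norm_num, h11, h21]
  have l1 : M.length γ 0 (1 / 2) = M.length c₁ 0 1 := by
    rw [length_congr M (by norm_num) e1, length_comp M h1 hφ₁ (fun t _ => d1 t)]
    simp
  have l2 : M.length γ (1 / 2) 1 = M.length c₂ 0 1 := by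
    rw [length_congr M (by norm_num) e2, length_comp M h2 hφ₂ (fun t _ => d2 t)]
    simp [show (2 : ℝ) - 1 = 1 by norm_num]
  have ls : M.length γ 0 1 = M.length γ 0 (1 / 2) + M.length γ (1 / 2) 1 :=
    (intervalIntegral.integral_add_adjacent_intervals
      ((speed_continuous M hγc).intervalIntegrable _ _)
      ((speed_continuous M hγc).intervalIntegrable _ _)).symm
  have := dist_le_length M hγc zero_le_one
  rw [g0, g1] at this
  linarith

theorem mdist_add_lat_le (k : ℤ × ℤ) (x y : V) : M.dist (x + lat k) (y + lat k) ≤ M.dist x y := by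
  refine le_dist M fun c hc h0 h1 => ?_
  have := dist_le_length M (c := fun t => c t + lat k) (hc.add contDiff_const) (zero_le_one' ℝ)
  simp only [h0, h1] at this
  refine this.trans (le_of_eq ?_)
  apply intervalIntegral.integral_congr
  intro t _
  simp only [deriv_add_const, M.periodic]

theorem mdist_add_lat (k : ℤ × ℤ) (x y : V) : M.dist (x + lat k) (y + lat k) = M.dist x y := by
  refine le_antisymm (mdist_add_lat_le M k x y) ?_
  have := mdist_add_lat_le M (-k) (x + lat k) (y + lat k)
  simpa [lat_neg] using this

theorem exists_mdist_bounds : ∃ c C : ℝ, 0 < c ∧ 0 < C ∧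
    ∀ x y, c * ‖y - x‖ ≤ M.dist x y ∧ M.dist x y ≤ C * ‖y - x‖ := by
  obtain ⟨c, C, hc, hC, h⟩ := g_bounds M
  refine ⟨Real.sqrt c, Real.sqrt C, Real.sqrt_pos.2 hc, Real.sqrt_pos.2 hC, fun x y => ⟨?_, ?_⟩⟩
  · refine le_dist M fun γ hγ h0 h1 => ?_
    have hd := hγ.continuous_deriv le_rfl
    have e : ∫ t in (0 : ℝ)..1, deriv γ t = y - x := by
      rw [intervalIntegral.integral_deriv_eq_sub
        (fun t _ => (hγ.differentiable (by norm_num)).differentiableAt)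
        (hd.intervalIntegrable _ _), h0, h1]
    rw [← e]
    calc Real.sqrt c * ‖∫ t in (0 : ℝ)..1, deriv γ t‖
        ≤ Real.sqrt c * ∫ t in (0 : ℝ)..1, ‖deriv γ t‖ := by
          gcongr
          exact intervalIntegral.norm_integral_le_integral_norm zero_le_one
      _ = ∫ t in (0 : ℝ)..1, Real.sqrt c * ‖deriv γ t‖ := by
          rw [intervalIntegral.integral_const_mul]
      _ ≤ M.length γ 0 1 := by
          apply intervalIntegral.integral_mono_on zero_le_one
          · exact (continuous_const.mul hd.norm).intervalIntegrable _ _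
          · exact (speed_continuous M hγ).intervalIntegrable _ _
          · intro t _
            apply Real.le_sqrt_of_sq_le
            rw [mul_pow, Real.sq_sqrt hc.le]
            exact (h _ _).1
  · have := dist_le_length M (seg_contDiff x y) (zero_le_one' ℝ)
    simp only [seg, zero_smul, add_zero, one_smul, add_sub_cancel] at this
    refine this.trans ?_
    have e : M.length (fun t => x + t • (y - x)) 0 1 ≤
        ∫ t in (0 : ℝ)..1, Real.sqrt C * ‖y - x‖ := by
      apply intervalIntegral.integral_mono_on zero_le_one
      · exact (speed_continuous M (seg_contDiff x y)).intervalIntegrable _ _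
      · simp
      · intro t _
        have e2 : deriv (fun t : ℝ => x + t • (y - x)) t = y - x := deriv_seg x y t
        rw [e2]
        apply Real.sqrt_le_iff.2 ⟨by positivity, ?_⟩
        rw [mul_pow, Real.sq_sqrt hC.le]
        exact (h _ _).2
    exact e.trans (by simp)

theorem mdist_self (x : V) : M.dist x x = 0 := by
  obtain ⟨c, C, hc, hC, h⟩ := exists_mdist_bounds M
  have := h x x
  simp at this
  linarith

theorem mdist_eq_zero {x y : V} (hxy : M.dist x y = 0) : x = y := by
  obtain ⟨c, C, hc, hC, h⟩ := exists_mdist_bounds M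
  have := (h x y).1
  rw [hxy] at this
  have : ‖y - x‖ ≤ 0 := by
    by_contra! hn
    nlinarith [mul_pos hc hn]
  exact (sub_eq_zero.1 (norm_le_zero_iff.1 this)).symm

theorem mdist_pos {x y : V} (hxy : x ≠ y) : 0 < M.dist x y :=
  lt_of_le_of_ne (mdist_nonneg M x y) fun h => hxy (mdist_eq_zero M h.symm)

theorem abs_mdist_sub_le (x y z : V) : |M.dist x z - M.dist y z| ≤ M.dist x y := by
  rw [abs_le]
  have h1 := mdist_triangle M x y z
  have h2 := mdist_triangle M y x z
  rw [mdist_comm M y x] at h2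
  constructor <;> linarith

theorem continuous_mdist : Continuous fun q : V × V => M.dist q.1 q.2 := by
  obtain ⟨c, C, hc, hC, h⟩ := exists_mdist_bounds M
  rw [continuous_iff_continuousAt]
  rintro ⟨x, y⟩
  rw [ContinuousAt, tendsto_iff_dist_tendsto_zero]
  have hlim : Tendsto (fun q : V × V => C * ‖x - q.1‖ + C * ‖y - q.2‖) (𝓝 (x, y)) (𝓝 0) := by
    have : Continuous (fun q : V × V => C * ‖x - q.1‖ + C * ‖y - q.2‖) := by fun_prop
    simpa using this.tendsto (x, y)
  refine squeeze_zero (fun _ => dist_nonneg) (fun q => ?_) hlim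
  have h1 := abs_mdist_sub_le M q.1 x q.2
  have h2 := abs_mdist_sub_le M q.2 y x
  rw [mdist_comm M q.2 x, mdist_comm M y x] at h2
  rw [Real.dist_eq]
  calc |M.dist q.1 q.2 - M.dist x y| ≤ |M.dist q.1 q.2 - M.dist x q.2| + |M.dist x q.2 - M.dist x y| :=
        abs_sub_le _ _ _
    _ ≤ _ := add_le_add (h1.trans (h _ _).2) (h2.trans (h _ _).2)

end FlatTorus

namespace FlatTorus

open scoped NNReal

variable (M : TorusMetric)

theorem two_le_top : (2 : WithTop ℕ∞) ≤ ((⊤ : ℕ∞) : WithTop ℕ∞) := by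
  exact WithTop.coe_le_coe.2 (le_top : (2 : ℕ∞) ≤ ⊤)

theorem taylor_coeff {a : V → ℝ} {C : ℝ} (ha : TaylorBound a C) {P n p q v w : ℝ} {x ξ : V}
    (hp : |p| ≤ P) (hq : |q| ≤ P) (hξ : ‖ξ‖ ≤ n) (hv : |v| ≤ n) (hw : |w| ≤ n) :
    |a (x + ξ) * ((p + v) * (q + w)) -
      (a x * (p * q) + fderiv ℝ a x ξ * (p * q) + a x * (p * w + q * v))| ≤
      C * (P + 1) ^ 2 * n ^ 2 := by
  have hn : 0 ≤ n := (norm_nonneg _).trans hξ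
  have hP : 0 ≤ P := (abs_nonneg _).trans hp
  have hC := ha.pos
  have e : a (x + ξ) * ((p + v) * (q + w)) -
      (a x * (p * q) + fderiv ℝ a x ξ * (p * q) + a x * (p * w + q * v)) =
      (a (x + ξ) - a x - fderiv ℝ a x ξ) * (p * q) + (a (x + ξ) - a x) * (p * w + q * v) +
        a (x + ξ) * (v * w) := by ring
  have h1 : |(a (x + ξ) - a x - fderiv ℝ a x ξ) * (p * q)| ≤ (C * n ^ 2) * (P * P) := by
    rw [abs_mul, abs_mul]
    have := (ha.quad x ξ).trans (show C * ‖ξ‖ ^ 2 ≤ C * n ^ 2 by gcongr)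
    gcongr
  have h2 : |(a (x + ξ) - a x) * (p * w + q * v)| ≤ (C * n) * (P * n + P * n) := by
    rw [abs_mul]
    have := (ha.lip x ξ).trans (show C * ‖ξ‖ ≤ C * n by gcongr)
    have h3 : |p * w + q * v| ≤ P * n + P * n := by
      refine (abs_add_le _ _).trans ?_
      rw [abs_mul, abs_mul]
      gcongr
    gcongr
  have h3 : |a (x + ξ) * (v * w)| ≤ C * (n * n) := by
    rw [abs_mul, abs_mul]
    have := ha.bound (x + ξ)
    gcongr
  rw [e]
  refine (abs_add_le _ _).trans ((add_le_add_left (abs_add_le _ _) _).trans ?_)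
  nlinarith

theorem exists_ham_taylor : ∃ C : ℝ, 0 < C ∧ ∀ (x p ξ w : V) (n : ℝ), bf M x p p = 1 → ‖ξ‖ ≤ n →
    ‖w‖ ≤ n → |ham M (x + ξ, p + w) - (ham M (x, p) + hamX M x p ξ + dot w (sharp M x p))| ≤
      C * n ^ 2 := by
  obtain ⟨Ca, ha⟩ := exists_taylorBound ((contDiff_al M).of_le two_le_top) (al_per M)
  obtain ⟨Cb, hb⟩ := exists_taylorBound ((contDiff_be M).of_le two_le_top) (be_per M)
  obtain ⟨Cc, hc⟩ := exists_taylorBound ((contDiff_ga M).of_le two_le_top) (ga_per M)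
  obtain ⟨c, C', hc0, _, hbf⟩ := bf_bounds M
  set P := Real.sqrt (1 / c) with hP
  have hPp : 0 ≤ P := Real.sqrt_nonneg _
  refine ⟨(Ca + 2 * Cb + Cc) * (P + 1) ^ 2, by have := ha.pos; have := hb.pos; have := hc.pos; positivity,
    fun x p ξ w n h1 hξ hw => ?_⟩
  have hp : ‖p‖ ≤ P := by
    apply Real.le_sqrt_of_sq_le
    rw [le_div_iff₀ hc0]
    have := (hbf x p).1
    linarith
  have hp1 : |p.1| ≤ P := (norm_fst_le p).trans hp
  have hp2 : |p.2| ≤ P := (norm_snd_le p).trans hp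
  have hw1 : |w.1| ≤ n := (norm_fst_le w).trans hw
  have hw2 : |w.2| ≤ n := (norm_snd_le w).trans hw
  have e1 := taylor_coeff ha (x := x) hp1 hp1 hξ hw1 hw1
  have e2 := taylor_coeff hb (x := x) hp1 hp2 hξ hw1 hw2
  have e3 := taylor_coeff hc (x := x) hp2 hp2 hξ hw2 hw2
  have e : ham M (x + ξ, p + w) - (ham M (x, p) + hamX M x p ξ + dot w (sharp M x p)) =
      ((al M (x + ξ) * ((p.1 + w.1) * (p.1 + w.1)) - (al M x * (p.1 * p.1) +
        fderiv ℝ (al M) x ξ * (p.1 * p.1) + al M x * (p.1 * w.1 + p.1 * w.1))) +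
      2 * (be M (x + ξ) * ((p.1 + w.1) * (p.2 + w.2)) - (be M x * (p.1 * p.2) +
        fderiv ℝ (be M) x ξ * (p.1 * p.2) + be M x * (p.1 * w.2 + p.2 * w.1))) +
      (ga M (x + ξ) * ((p.2 + w.2) * (p.2 + w.2)) - (ga M x * (p.2 * p.2) +
        fderiv ℝ (ga M) x ξ * (p.2 * p.2) + ga M x * (p.2 * w.2 + p.2 * w.2)))) / 2 := by
    simp only [ham, bf, hamX, dot, sharp, Prod.fst_add, Prod.snd_add]
    ring
  rw [e, abs_le]
  rw [abs_le] at e1 e2 e3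
  have hA : 0 ≤ (P + 1) ^ 2 * n ^ 2 := by positivity
  have q1 := mul_nonneg ha.pos.le hA
  have q2 := mul_nonneg hb.pos.le hA
  have q3 := mul_nonneg hc.pos.le hA
  rw [mul_assoc] at e1 e2 e3
  have e4 : (Ca + 2 * Cb + Cc) * (P + 1) ^ 2 * n ^ 2 = Ca * ((P + 1) ^ 2 * n ^ 2) +
    2 * (Cb * ((P + 1) ^ 2 * n ^ 2)) + Cc * ((P + 1) ^ 2 * n ^ 2) := by ring
  rw [e4]
  constructor <;> linarith [e1.1, e1.2, e2.1, e2.2, e3.1, e3.2]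

/-- The base curve of the phase point `z`. -/
def gx (z : V × V) (t : ℝ) : V := (hamFlow M t z).1

/-- The momentum along the base curve of `z`. -/
def gp (z : V × V) (t : ℝ) : V := (hamFlow M t z).2

variable {M}

theorem gx_zero (z : V × V) : gx M z 0 = z.1 := by rw [gx, hamFlow_zero]
theorem gp_zero (z : V × V) : gp M z 0 = z.2 := by rw [gp, hamFlow_zero]

theorem gx_contDiff (z : V × V) : ContDiff ℝ (⊤ : ℕ∞) (gx M z) :=
  contDiff_fst.comp (contDiff_hamFlow M z)

theorem gp_contDiff (z : V × V) : ContDiff ℝ (⊤ : ℕ∞) (gp M z) :=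
  contDiff_snd.comp (contDiff_hamFlow M z)

theorem gx_hasDerivAt {z : V × V} (hz : ham M z ≤ 1 / 2) (t : ℝ) :
    HasDerivAt (gx M z) (sharp M (gx M z t) (gp M z t)) t := hamFlow_fst_hasDerivAt M hz t

theorem gp_hasDerivAt {z : V × V} (hz : ham M z ≤ 1 / 2) (t : ℝ) :
    HasDerivAt (gp M z) (-hamXvec M (gx M z t) (gp M z t)) t := hamFlow_snd_hasDerivAt M hz t

theorem bf_g (z : V × V) (t : ℝ) : bf M (gx M z t) (gp M z t) (gp M z t) = 2 * ham M z := by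
  have := ham_hamFlow M t z
  rw [← this]
  simp [ham, gx, gp]; ring

theorem bf_unit {z : V × V} (hz : ham M z = 1 / 2) (t : ℝ) :
    bf M (gx M z t) (gp M z t) (gp M z t) = 1 := by rw [bf_g, hz]; norm_num

theorem g_deriv_unit {z : V × V} (hz : ham M z = 1 / 2) (t : ℝ) :
    M.g (gx M z t) (deriv (gx M z) t) (deriv (gx M z) t) = 1 := by
  rw [(gx_hasDerivAt hz.le t).deriv, g_sharp_sharp, bf_unit hz]

theorem length_unit {z : V × V} (hz : ham M z = 1 / 2) (a b : ℝ) :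
    M.length (gx M z) a b = b - a := by
  have : ∀ t, speed M (gx M z) t = 1 := fun t => by rw [speed, g_deriv_unit hz, Real.sqrt_one]
  simp [length_eq, this]

theorem mdist_gx_le {z : V × V} (hz : ham M z = 1 / 2) {a b : ℝ} (hab : a ≤ b) :
    M.dist (gx M z a) (gx M z b) ≤ b - a := by
  rw [← length_unit hz]
  exact dist_le_length M ((gx_contDiff z).of_le (by exact_mod_cast le_top)) hab

theorem continuous_dot : Continuous fun q : V × V => dot q.1 q.2 := by
  unfold dot; fun_prop

theorem sq_norm_le_dot (v : V) : ‖v‖ ^ 2 ≤ dot v v := by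
  rw [Prod.norm_def]
  rcases max_cases ‖v.1‖ ‖v.2‖ with ⟨h, -⟩ | ⟨h, -⟩ <;>
  · rw [h, Real.norm_eq_abs, sq_abs]; simp only [dot]; nlinarith [sq_nonneg v.1, sq_nonneg v.2]

theorem HasDerivAt.dot {f g : ℝ → V} {f' g' : V} {t : ℝ} (hf : HasDerivAt f f' t)
    (hg : HasDerivAt g g' t) :
    HasDerivAt (fun t => dot (f t) (g t)) (dot f' (g t) + dot (f t) g') t := by
  have hf1 : HasDerivAt (fun t => (f t).1) f'.1 t := hf.fst
  have hf2 : HasDerivAt (fun t => (f t).2) f'.2 t := hf.snd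
  have hg1 : HasDerivAt (fun t => (g t).1) g'.1 t := hg.fst
  have hg2 : HasDerivAt (fun t => (g t).2) g'.2 t := hg.snd
  refine ((hf1.mul hg1).add (hf2.mul hg2)).congr_deriv ?_
  simp only [FlatTorus.dot]; ring

theorem calibration_step {r X v y k n t A R G C : ℝ} (hr : 0 ≤ r)
    (hF : v - 2 * C * t * y ≤ r / 2 * (2 * A) + G) (hG : G ≤ R)
    (hT : A - 1 / 2 - X + 2 * C * t * k - C * n ≤ 0) :
    r / 2 + (-(r * X) + (v - r)) - C * (r * n + t * ((y - r * k) + (y - r * k))) ≤ R := by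
  have := mul_nonpos_of_nonneg_of_nonpos hr hT
  linarith [show r / 2 + (-(r * X) + (v - r)) - C * (r * n + t * ((y - r * k) + (y - r * k))) =
    v - 2 * C * t * y - r * A + r * (A - 1 / 2 - X + 2 * C * t * k - C * n) by ring]

set_option maxHeartbeats 1000000 in
/-- Short unit speed solutions are minimizing, by a calibration argument. -/
theorem exists_minimality_radius (M : TorusMetric) : ∃ ρ : ℝ, 0 < ρ ∧ ∀ z : V × V, ham M z = 1 / 2 →
    ∀ T, 0 < T → T ≤ ρ → T ≤ M.dist z.1 (gx M z T) := by
  obtain ⟨C₀, hC₀, hT⟩ := exists_ham_taylor M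
  set C := max C₀ 1 with hC
  have hCC : C₀ ≤ C := le_max_left _ _
  have hC1 : 1 ≤ C := le_max_right _ _
  set Λ := 2 * C with hΛ
  have hΛ1 : 0 < Λ := by positivity
  refine ⟨1 / Λ, by positivity, fun z hz T hT0 hTρ => le_dist M fun γ hγ hγ0 hγ1 => ?_⟩
  have hTΛ : Λ * T ≤ 1 := by rw [le_div_iff₀ hΛ1] at hTρ; linarith
  set ℓ := M.length γ 0 1 with hℓ
  have hℓ0 : 0 ≤ ℓ := length_nonneg M γ zero_le_one
  have hsp := speed_continuous M hγ
  have key : ∀ ε : ℝ, 0 < ε → T ^ 2 ≤ ℓ * (ℓ + ε) := by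
    intro ε hε
    have hℓε : 0 < ℓ + ε := by linarith
    set σ : ℝ → ℝ := fun u => ∫ s in (0 : ℝ)..u, (speed M γ s + ε) with hσ
    have hσd : ∀ u, HasDerivAt σ (speed M γ u + ε) u := fun u =>
      intervalIntegral.integral_hasDerivAt_right ((hsp.add continuous_const).intervalIntegrable _ _)
        ((hsp.add continuous_const).stronglyMeasurableAtFilter _ _) (hsp.add continuous_const).continuousAt
    have hσ0 : σ 0 = 0 := by simp [hσ]
    have hσ1 : σ 1 = ℓ + ε := by
      simp only [hσ]
      rw [intervalIntegral.integral_add (hsp.intervalIntegrable _ _)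
        (continuous_const.intervalIntegrable _ _)]
      simp [hℓ, length_eq]
    have hσm : Monotone σ := monotone_of_deriv_nonneg (fun u => (hσd u).differentiableAt) fun u => by
      rw [(hσd u).deriv]; have := speed_nonneg M γ u; linarith
    set τ : ℝ → ℝ := fun u => T / (ℓ + ε) * σ u with hτ
    set τ' : ℝ → ℝ := fun u => T / (ℓ + ε) * (speed M γ u + ε) with hτ'
    have hτd : ∀ u, HasDerivAt τ (τ' u) u := fun u => (hσd u).const_mul _
    have hτ'p : ∀ u, 0 < τ' u := fun u => by have := speed_nonneg M γ u; positivity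
    have hτ0 : τ 0 = 0 := by simp [hτ, hσ0]
    have hτ1 : τ 1 = T := by simp only [hτ, hσ1]; field_simp
    have hτr : ∀ u ∈ Icc (0 : ℝ) 1, 0 ≤ τ u ∧ τ u ≤ T := by
      intro u hu
      have hm : Monotone τ := hσm.const_mul (by positivity)
      rw [← hτ0, ← hτ1]
      exact ⟨hm hu.1, hm hu.2⟩
    set X : ℝ → V := fun u => gx M z (τ u) with hX
    set P : ℝ → V := fun u => gp M z (τ u) with hP
    have hXd : ∀ u, HasDerivAt X (τ' u • sharp M (X u) (P u)) u := fun u =>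
      (gx_hasDerivAt hz.le (τ u)).scomp u (hτd u)
    have hPd : ∀ u, HasDerivAt P (τ' u • -hamXvec M (X u) (P u)) u := fun u =>
      (gp_hasDerivAt hz.le (τ u)).scomp u (hτd u)
    have hγd : ∀ u, HasDerivAt γ (deriv γ u) u := fun u =>
      (hγ.differentiable (by norm_num) u).hasDerivAt
    have hξd : ∀ u, HasDerivAt (fun u => γ u - X u) _ u := fun u => (hγd u).sub (hXd u)
    set W : ℝ → ℝ := fun u => τ u / 2 + dot (P u) (γ u - X u) -
      Λ / 2 * (τ u * dot (γ u - X u) (γ u - X u)) with hW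
    have hWd : ∀ u, HasDerivAt W (τ' u / 2 + (dot (τ' u • -hamXvec M (X u) (P u)) (γ u - X u) +
        dot (P u) (deriv γ u - τ' u • sharp M (X u) (P u))) -
        Λ / 2 * (τ' u * dot (γ u - X u) (γ u - X u) + τ u *
          (dot (deriv γ u - τ' u • sharp M (X u) (P u)) (γ u - X u) +
          dot (γ u - X u) (deriv γ u - τ' u • sharp M (X u) (P u))))) u := fun u =>
      (((hτd u).div_const 2).add (HasDerivAt.dot (hPd u) (hξd u))).sub
        (((hτd u).mul (HasDerivAt.dot (hξd u) (hξd u))).const_mul (Λ / 2))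
    have hle : ∀ u ∈ Icc (0 : ℝ) 1, deriv W u ≤ (ℓ + ε) / (2 * T) * speed M γ u := by
      intro u hu
      rw [(hWd u).deriv]
      obtain ⟨ht0, htT⟩ := hτr u hu
      have hs : Λ * τ u ≤ 1 := by nlinarith
      have hs0 : 0 ≤ Λ * τ u := by positivity
      set ξ := γ u - X u with hξ
      set s := Λ * τ u with hs'
      have hγu : γ u = X u + ξ := by simp [hξ]
      have hb : bf M (X u) (P u) (P u) = 1 := bf_unit hz _
      have hxi : ‖(-s) • ξ‖ ≤ ‖ξ‖ := by
        rw [norm_smul, norm_neg, Real.norm_eq_abs, abs_of_nonneg hs0]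
        exact mul_le_of_le_one_left (norm_nonneg _) hs
      have hTa := (abs_le.1 (hT (X u) (P u) ξ ((-s) • ξ) ‖ξ‖ hb le_rfl hxi)).2
      have hF := fenchel M (γ u) (P u + (-s) • ξ) (deriv γ u) (hτ'p u)
      have hq : bf M (γ u) (P u + (-s) • ξ) (P u + (-s) • ξ) =
          2 * ham M (X u + ξ, P u + (-s) • ξ) := by rw [hγu]; simp [ham]; ring
      have hh0 : ham M (X u, P u) = 1 / 2 := by simp [ham, hb]
      rw [hq] at hF
      rw [hh0] at hTa
      have hsq := sq_norm_le_dot ξ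
      have hspd : M.g (γ u) (deriv γ u) (deriv γ u) / (2 * τ' u) ≤
          (ℓ + ε) / (2 * T) * speed M γ u := by
        rw [← speed_sq, hτ', div_le_iff₀ (by have := hτ'p u; positivity)]
        have h0 := speed_nonneg M γ u
        have : (ℓ + ε) / (2 * T) * speed M γ u * (2 * (T / (ℓ + ε) * (speed M γ u + ε))) =
          speed M γ u * (speed M γ u + ε) := by field_simp
        rw [this]
        nlinarith
      have hps : dot (P u) (sharp M (X u) (P u)) = 1 := by rw [dot_sharp, hb]
      have hX' := dot_hamXvec M (X u) (P u) ξ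
      have t1 : dot (τ' u • -hamXvec M (X u) (P u)) ξ = -(τ' u * hamX M (X u) (P u) ξ) := by
        rw [← hX']; simp [dot]; ring
      have t2 : dot (P u) (deriv γ u - τ' u • sharp M (X u) (P u)) = dot (P u) (deriv γ u) - τ' u := by
        rw [show dot (P u) (deriv γ u - τ' u • sharp M (X u) (P u)) = dot (P u) (deriv γ u) -
          τ' u * dot (P u) (sharp M (X u) (P u)) by simp [dot]; ring, hps, mul_one]
      have t3 : dot (deriv γ u - τ' u • sharp M (X u) (P u)) ξ =
          dot ξ (deriv γ u) - τ' u * dot ξ (sharp M (X u) (P u)) := by simp [dot]; ring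
      have t4 : dot ξ (deriv γ u - τ' u • sharp M (X u) (P u)) =
          dot ξ (deriv γ u) - τ' u * dot ξ (sharp M (X u) (P u)) := by simp [dot]; ring
      have t5 : dot (P u + (-s) • ξ) (deriv γ u) = dot (P u) (deriv γ u) - s * dot ξ (deriv γ u) := by
        simp [dot]; ring
      have t6 : dot ((-s) • ξ) (sharp M (X u) (P u)) = - (s * dot ξ (sharp M (X u) (P u))) := by
        simp [dot]; ring
      rw [t1, t2, t3, t4]
      rw [t5] at hF
      rw [t6] at hTa
      have hCq : C₀ * ‖ξ‖ ^ 2 ≤ C * dot ξ ξ := by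
        have := sq_nonneg ‖ξ‖
        nlinarith
      have hTb : ham M (X u + ξ, P u + (-s) • ξ) - 1 / 2 - hamX M (X u) (P u) ξ +
          s * dot ξ (sharp M (X u) (P u)) - C * dot ξ ξ ≤ 0 := by linarith
      have hΛe : Λ / 2 = C := by rw [hΛ]; ring
      rw [hΛe]
      exact calibration_step (hτ'p u).le hF hspd hTb
    have hWc : Continuous (deriv W) := by
      have : deriv W = fun u => _ := funext fun u => (hWd u).deriv
      rw [this]
      have c1 : Continuous X := continuous_iff_continuousAt.2 fun u => (hXd u).continuousAt
      have c2 : Continuous P := continuous_iff_continuousAt.2 fun u => (hPd u).continuousAt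
      have c3 : Continuous γ := hγ.continuous
      have c4 : Continuous (deriv γ) := hγ.continuous_deriv le_rfl
      have c5 : Continuous τ := continuous_iff_continuousAt.2 fun u => (hτd u).continuousAt
      have c6 : Continuous τ' := continuous_const.mul (hsp.add continuous_const)
      have c7 : Continuous fun u => sharp M (X u) (P u) := (continuous_sharp M).comp (c1.prodMk c2)
      have a1 := ((contDiff_al M).continuous_fderiv (by simp)).comp c1
      have a2 := ((contDiff_be M).continuous_fderiv (by simp)).comp c1
      have a3 := ((contDiff_ga M).continuous_fderiv (by simp)).comp c1
      have c8 : Continuous fun u => hamXvec M (X u) (P u) := by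
        simp only [Function.comp_def] at a1 a2 a3
        unfold hamXvec hamX
        fun_prop
      have d1 {f g : ℝ → V} (hf : Continuous f) (hg : Continuous g) :
          Continuous fun u => dot (f u) (g u) := continuous_dot.comp (hf.prodMk hg)
      have c9 := c4.sub (c6.smul c7)
      exact ((c6.div_const 2).add ((d1 (c6.smul c8.neg) (c3.sub c1)).add (d1 c2 c9))).sub
        (continuous_const.mul ((c6.mul (d1 (c3.sub c1) (c3.sub c1))).add
          (c5.mul ((d1 c9 (c3.sub c1)).add (d1 (c3.sub c1) c9)))))
    have hle : W 1 - W 0 ≤ (ℓ + ε) / (2 * T) * ℓ := by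
      rw [← intervalIntegral.integral_deriv_eq_sub (fun u _ => (hWd u).differentiableAt)
        (hWc.intervalIntegrable _ _), hℓ, length_eq, ← intervalIntegral.integral_const_mul]
      exact intervalIntegral.integral_mono_on zero_le_one (hWc.intervalIntegrable _ _)
        ((continuous_const.mul hsp).intervalIntegrable _ _) hle
    have hW0 : W 0 = 0 := by simp [hW, hX, hτ0, gx_zero, hγ0, dot]
    have hW1 : W 1 = T / 2 := by simp [hW, hX, hτ1, hγ1, dot]
    rw [hW0, hW1, sub_zero] at hle
    have : T / 2 * (2 * T) ≤ (ℓ + ε) / (2 * T) * ℓ * (2 * T) := by gcongr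
    have e : (ℓ + ε) / (2 * T) * ℓ * (2 * T) = ℓ * (ℓ + ε) := by field_simp
    nlinarith
  have h2 : T ^ 2 ≤ ℓ ^ 2 := by
    apply le_of_forall_pos_le_add
    intro ε hε
    have := key (ε / (ℓ + 1)) (by positivity)
    have h3 : ℓ * (ε / (ℓ + 1)) ≤ ε := by
      rw [← mul_div_assoc, div_le_iff₀ (by positivity)]; nlinarith
    nlinarith
  nlinarith

end FlatTorus

namespace FlatTorus

open scoped NNReal

variable {M : TorusMetric}

theorem gx_flow (z : V × V) (s t : ℝ) : gx M (hamFlow M s z) t = gx M z (t + s) := by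
  simp only [gx, hamFlow_add]

theorem gp_flow (z : V × V) (s t : ℝ) : gp M (hamFlow M s z) t = gp M z (t + s) := by
  simp only [gp, hamFlow_add]

theorem ham_flow_unit {z : V × V} (hz : ham M z = 1 / 2) (s : ℝ) :
    ham M (hamFlow M s z) = 1 / 2 := by rw [ham_hamFlow, hz]

theorem gx_per (z : V × V) (k : ℤ × ℤ) (t : ℝ) : gx M (z + (lat k, 0)) t = gx M z t + lat k := by
  simp [gx, hamFlow_per]

theorem gp_per (z : V × V) (k : ℤ × ℤ) (t : ℝ) : gp M (z + (lat k, 0)) t = gp M z t := by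
  simp [gp, hamFlow_per]

theorem ham_reverse {z : V × V} : ham M (scale (-1) z) = ham M z := by rw [ham_scale]; ring

theorem gx_reverse {z : V × V} (hz : ham M z = 1 / 2) (t : ℝ) :
    gx M (scale (-1) z) t = gx M z (-t) := by
  rw [gx, gx, hamFlow_scale M hz.le (by norm_num)]; simp [scale]

theorem gp_reverse {z : V × V} (hz : ham M z = 1 / 2) (t : ℝ) :
    gp M (scale (-1) z) t = -gp M z (-t) := by
  rw [gp, gp, hamFlow_scale M hz.le (by norm_num)]; simp [scale]

theorem sharp_neg (x p : V) : sharp M x (-p) = -sharp M x p := by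
  ext <;> simp [sharp] <;> ring

theorem abs_dot_le (p v : V) : |dot p v| ≤ 2 * ‖p‖ * ‖v‖ := by
  have h1 := norm_fst_le p; have h2 := norm_snd_le p
  have h3 := norm_fst_le v; have h4 := norm_snd_le v
  unfold dot
  refine (abs_add_le _ _).trans ?_
  rw [abs_mul, abs_mul]
  simp only [Real.norm_eq_abs] at *
  have := mul_le_mul h1 h3 (abs_nonneg _) (norm_nonneg _)
  have := mul_le_mul h2 h4 (abs_nonneg _) (norm_nonneg _)
  linarith

theorem exists_flat_lip (M : TorusMetric) : ∃ C : ℝ, 0 < C ∧ ∀ (x y ξ v : V) (n P : ℝ), ‖y‖ ≤ P →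
    ‖ξ‖ ≤ n → ‖v‖ ≤ n → ‖flat M (x + ξ) (y + v) - flat M x y‖ ≤ C * (P + 1) * n := by
  obtain ⟨Ca, ha⟩ := exists_taylorBound ((contDiff_cE M).of_le two_le_top) (cE_per M)
  obtain ⟨Cb, hb⟩ := exists_taylorBound ((contDiff_cF M).of_le two_le_top) (cF_per M)
  obtain ⟨Cc, hc⟩ := exists_taylorBound ((contDiff_cG M).of_le two_le_top) (cG_per M)
  have ha0 := ha.pos; have hb0 := hb.pos; have hc0 := hc.pos
  have aux {a : V → ℝ} {K : ℝ} (h : TaylorBound a K) (x ξ : V) {y v n P : ℝ} (hy : |y| ≤ P)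
      (hξ : ‖ξ‖ ≤ n) (hv : |v| ≤ n) : |a (x + ξ) * (y + v) - a x * y| ≤ K * (P + 1) * n := by
    have hK := h.pos
    have hn : 0 ≤ n := (norm_nonneg _).trans hξ
    rw [show a (x + ξ) * (y + v) - a x * y = (a (x + ξ) - a x) * y + a (x + ξ) * v by ring]
    refine (abs_add_le _ _).trans ?_
    rw [abs_mul, abs_mul]
    have h1 := (h.lip x ξ).trans (show K * ‖ξ‖ ≤ K * n by gcongr)
    have h2 := h.bound (x + ξ)
    have := mul_le_mul h1 hy (abs_nonneg _) (by positivity)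
    have := mul_le_mul h2 hv (abs_nonneg _) (by positivity)
    linarith
  refine ⟨Ca + 2 * Cb + Cc, by positivity, fun x y ξ v n P hy hξ hv => ?_⟩
  have hn : 0 ≤ n := (norm_nonneg _).trans hξ
  have hP : 0 ≤ P := (norm_nonneg _).trans hy
  have hy1 : |y.1| ≤ P := (norm_fst_le y).trans hy
  have hy2 : |y.2| ≤ P := (norm_snd_le y).trans hy
  have hv1 : |v.1| ≤ n := (norm_fst_le v).trans hv
  have hv2 : |v.2| ≤ n := (norm_snd_le v).trans hv
  have e1 := aux ha x ξ hy1 hξ hv1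
  have e2 := aux hb x ξ hy2 hξ hv2
  have e3 := aux hb x ξ hy1 hξ hv1
  have e4 := aux hc x ξ hy2 hξ hv2
  have q : 0 ≤ (P + 1) * n := by positivity
  have q1 := mul_nonneg ha0.le q
  have q2 := mul_nonneg hb0.le q
  have q3 := mul_nonneg hc0.le q
  rw [mul_assoc] at e1 e2 e3 e4 ⊢
  rw [abs_le] at e1 e2 e3 e4
  refine norm_prod_le_iff.2 ⟨?_, ?_⟩ <;>
  · simp only [flat, Prod.fst_sub, Prod.snd_sub, Prod.fst_add, Prod.snd_add, Real.norm_eq_abs, abs_le]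
    constructor <;> linarith [e1.1, e1.2, e2.1, e2.2, e3.1, e3.2, e4.1, e4.2]

/-- Second order upper bound for the speed of a varied unit speed solution. -/
theorem exists_speed_bound (M : TorusMetric) : ∃ C : ℝ, 0 < C ∧ ∀ (x p ξ v : V) (n : ℝ),
    bf M x p p = 1 → ‖ξ‖ ≤ n → ‖v‖ ≤ n →
    Real.sqrt (M.g (x + ξ) (sharp M x p + v) (sharp M x p + v)) ≤
      1 + dot p v - hamX M x p ξ + C * n ^ 2 := by
  obtain ⟨C₀, hC₀, hT⟩ := exists_ham_taylor M
  obtain ⟨C₁, hC₁, hF⟩ := exists_flat_lip M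
  obtain ⟨c, C', hc, _, hg⟩ := g_bounds M
  set P := Real.sqrt (1 / c) with hP
  have hPp : 0 ≤ P := Real.sqrt_nonneg _
  set D := C₁ * (P + 1) with hD
  have hD0 : 0 < D := by positivity
  refine ⟨C₀ * (D + 1) ^ 2 + 2 * D, by positivity, fun x p ξ v n h1 hξ hv => ?_⟩
  have hn : 0 ≤ n := (norm_nonneg _).trans hξ
  set y := sharp M x p with hy
  set q := flat M (x + ξ) (y + v) with hq
  have hyP : ‖y‖ ≤ P := by
    apply Real.le_sqrt_of_sq_le
    rw [le_div_iff₀ hc]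
    have := (hg x y).1
    rw [hy, g_sharp_sharp, h1, ← hy] at this
    linarith
  have hr : ‖q - p‖ ≤ D * n := by
    have := hF x y ξ v n P hyP hξ hv
    rwa [hy, flat_sharp, ← hy, ← hq] at this
  have hr' : ‖q - p‖ ≤ (D + 1) * n := hr.trans (by gcongr; linarith)
  have hξ' : ‖ξ‖ ≤ (D + 1) * n := hξ.trans (by nlinarith)
  have hTa := (abs_le.1 (hT x p ξ (q - p) _ h1 hξ' hr')).1
  have e1 : ham M (x + ξ, q) = M.g (x + ξ) (y + v) (y + v) / 2 := by simp only [ham, hq, bf_flat]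
  have e2 : dot q (y + v) = M.g (x + ξ) (y + v) (y + v) := dot_flat ..
  have e3 : dot p y = 1 := by rw [hy, dot_sharp, h1]
  have e4 : ham M (x, p) = 1 / 2 := by simp [ham, h1]
  rw [add_sub_cancel, e1, e4, ← hy] at hTa
  have e5 : dot (q - p) y = dot q (y + v) - dot p y - dot p v - dot (q - p) v := by
    simp [dot]; ring
  have e6 : |dot (q - p) v| ≤ 2 * (D * n) * n := (abs_dot_le _ _).trans (by gcongr)
  have e7 := (abs_le.1 e6).2
  have e8 : Real.sqrt (M.g (x + ξ) (y + v) (y + v)) ≤ (1 + M.g (x + ξ) (y + v) (y + v)) / 2 := by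
    have h0 := Real.sq_sqrt (g_nonneg M (x + ξ) (y + v))
    nlinarith [sq_nonneg (Real.sqrt (M.g (x + ξ) (y + v) (y + v)) - 1)]
  rw [e5, e2, e3] at hTa
  nlinarith

theorem mdist_le_of_speed_le {γ : ℝ → V} {f f' : ℝ → ℝ} {a b : ℝ} (hab : a ≤ b)
    (hγ : ContDiff ℝ 1 γ) (hf : ∀ t, HasDerivAt f (f' t) t) (hc : Continuous f')
    (h : ∀ t ∈ Icc a b, speed M γ t ≤ f' t) : M.dist (γ a) (γ b) ≤ f b - f a := by
  refine (dist_le_length M hγ hab).trans ?_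
  rw [length_eq, ← intervalIntegral.integral_eq_sub_of_hasDerivAt (fun t _ => hf t)
    (hc.intervalIntegrable _ _)]
  exact intervalIntegral.integral_mono_on hab ((speed_continuous M hγ).intervalIntegrable _ _)
    (hc.intervalIntegrable _ _) h

/-- First variation at the endpoint, with a uniform quadratic error. -/
theorem exists_first_variation (M : TorusMetric) {τ : ℝ} (hτ : 0 < τ) : ∃ C : ℝ, 0 < C ∧
    ∀ z : V × V, ham M z = 1 / 2 → ∀ b : V,
      M.dist z.1 (gx M z τ + b) ≤ τ + dot (gp M z τ) b + C * ‖b‖ ^ 2 := by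
  obtain ⟨C, hC, hS⟩ := exists_speed_bound M
  set m := max 1 τ⁻¹ with hm
  have hm0 : 0 < m := lt_max_of_lt_left one_pos
  refine ⟨C * m ^ 2 * τ, by positivity, fun z hz b => ?_⟩
  set γ : ℝ → V := fun t => gx M z t + (t / τ) • b with hγ
  set f : ℝ → ℝ := fun t => t + dot (gp M z t) ((t / τ) • b) + C * (m * ‖b‖) ^ 2 * t with hf
  have hγc : ContDiff ℝ 1 γ := by
    have := (gx_contDiff (M := M) z).of_le (m := 1) (by exact_mod_cast le_top)
    have h2 : ContDiff ℝ 1 fun t : ℝ => (t / τ) • b := by fun_prop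
    exact this.add h2
  have hbd : ∀ t, HasDerivAt (fun t : ℝ => (t / τ) • b) (τ⁻¹ • b) t := fun t => by
    have h1 : HasDerivAt (fun t : ℝ => t / τ) (1 / τ) t := (hasDerivAt_id t).div_const τ
    rw [one_div] at h1
    exact h1.smul_const b
  have hγd : ∀ t, deriv γ t = sharp M (gx M z t) (gp M z t) + τ⁻¹ • b := fun t =>
    ((gx_hasDerivAt hz.le t).add (hbd t)).deriv
  have hfd : ∀ t, HasDerivAt f (1 + (dot (-hamXvec M (gx M z t) (gp M z t)) ((t / τ) • b) +
      dot (gp M z t) (τ⁻¹ • b)) + C * (m * ‖b‖) ^ 2) t := fun t => by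
    have h3 : HasDerivAt (fun t : ℝ => C * (m * ‖b‖) ^ 2 * t) (C * (m * ‖b‖) ^ 2) t := by
      simpa using (hasDerivAt_id t).const_mul (C * (m * ‖b‖) ^ 2)
    exact ((hasDerivAt_id t).add (HasDerivAt.dot (gp_hasDerivAt hz.le t) (hbd t))).add h3
  have hfc : Continuous fun t => 1 + (dot (-hamXvec M (gx M z t) (gp M z t)) ((t / τ) • b) +
      dot (gp M z t) (τ⁻¹ • b)) + C * (m * ‖b‖) ^ 2 := by
    have c1 : Continuous (gx M z) := (gx_contDiff z).continuous
    have c2 : Continuous (gp M z) := (gp_contDiff z).continuous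
    have c3 : Continuous fun t => -hamXvec M (gx M z t) (gp M z t) := by
      have : (fun t => -hamXvec M (gx M z t) (gp M z t)) = deriv (gp M z) :=
        funext fun t => (gp_hasDerivAt hz.le t).deriv.symm
      rw [this]
      exact (gp_contDiff z).continuous_deriv (by exact_mod_cast le_top)
    have d1 {f g : ℝ → V} (hf : Continuous f) (hg : Continuous g) :
        Continuous fun u => dot (f u) (g u) := continuous_dot.comp (hf.prodMk hg)
    exact (continuous_const.add ((d1 c3 (by fun_prop)).add (d1 c2 continuous_const))).add
      continuous_const
  have := mdist_le_of_speed_le (M := M) hτ.le hγc hfd hfc ?_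
  · simp only [hγ, hf, gx_zero, zero_div, zero_smul, add_zero, div_self hτ.ne', one_smul, mul_zero] at this
    simp only [dot, Prod.fst_zero, Prod.snd_zero, mul_zero, add_zero, sub_zero] at this ⊢
    linarith [show C * (m * ‖b‖) ^ 2 * τ = C * m ^ 2 * τ * ‖b‖ ^ 2 by ring]
  · intro t ht
    have hn1 : ‖(t / τ) • b‖ ≤ m * ‖b‖ := by
      rw [norm_smul, Real.norm_eq_abs, abs_of_nonneg (div_nonneg ht.1 hτ.le)]
      gcongr
      exact ((div_le_one hτ).2 ht.2).trans (le_max_left _ _)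
    have hn2 : ‖τ⁻¹ • b‖ ≤ m * ‖b‖ := by
      rw [norm_smul, Real.norm_eq_abs, abs_of_nonneg (inv_pos.2 hτ).le]
      gcongr
      exact le_max_right _ _
    have := hS _ _ _ _ _ (bf_unit hz t) hn1 hn2
    rw [speed, hγd]
    refine this.trans (le_of_eq ?_)
    rw [← dot_hamXvec]
    simp [dot]; ring

theorem exists_first_variation_start (M : TorusMetric) {τ : ℝ} (hτ : 0 < τ) : ∃ C : ℝ, 0 < C ∧
    ∀ z : V × V, ham M z = 1 / 2 → ∀ a : V,
      M.dist (z.1 + a) (gx M z τ) ≤ τ - dot z.2 a + C * ‖a‖ ^ 2 := by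
  obtain ⟨C, hC, h⟩ := exists_first_variation M hτ
  refine ⟨C, hC, fun z hz a => ?_⟩
  have hz' := ham_flow_unit hz τ
  have := h (scale (-1) (hamFlow M τ z)) (by rw [ham_reverse, hz']) a
  rw [gx_reverse hz', gp_reverse hz', gx_flow, gp_flow, neg_add_cancel, gx_zero, gp_zero] at this
  rw [mdist_comm]
  refine le_trans this (le_of_eq ?_)
  simp [dot]; ring

theorem exists_mdist_gx (M : TorusMetric) : ∃ ρ : ℝ, 0 < ρ ∧ ∀ z : V × V, ham M z = 1 / 2 →
    ∀ s t, s ≤ t → t - s ≤ ρ → M.dist (gx M z s) (gx M z t) = t - s := by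
  obtain ⟨ρ, hρ, h⟩ := exists_minimality_radius M
  refine ⟨ρ, hρ, fun z hz s t hst ht => (mdist_gx_le hz hst).antisymm ?_⟩
  rcases hst.eq_or_lt with rfl | hst
  · rw [sub_self]; exact mdist_nonneg ..
  · have := h (hamFlow M s z) (ham_flow_unit hz s) (t - s) (by linarith) ht
    rwa [gx_flow, sub_add_cancel] at this

theorem isGeodesic_gx {z : V × V} (hz : ham M z = 1 / 2) : M.IsGeodesic (gx M z) := by
  obtain ⟨ρ, hρ, h⟩ := exists_mdist_gx M
  refine ⟨gx_contDiff z, g_deriv_unit hz, fun t => ⟨ρ / 2, by positivity, fun s₁ s₂ h1 h2 h3 => ?_⟩⟩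
  rw [length_unit hz, h z hz s₁ s₂ h2 (by linarith)]

end FlatTorus

namespace FlatTorus

open scoped NNReal

variable {M : TorusMetric}

theorem exists_unit (M : TorusMetric) (x : V) : ∃ p : V, bf M x p p = 1 := by
  have h := bf_pos M x (p := (1, 0)) (by simp)
  refine ⟨(Real.sqrt (bf M x (1, 0) (1, 0)))⁻¹ • (1, 0), ?_⟩
  have e : ∀ (r : ℝ) (p : V), bf M x (r • p) (r • p) = r ^ 2 * bf M x p p := fun r p => by
    simp [bf]; ring
  rw [e, inv_pow, Real.sq_sqrt h.le, inv_mul_cancel₀ h.ne']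

theorem ham_unit {x p : V} (h : bf M x p p = 1) : ham M (x, p) = 1 / 2 := by simp [ham, h]

theorem unit_of_ham {z : V × V} (h : ham M z = 1 / 2) : bf M z.1 z.2 z.2 = 1 := by
  simp only [ham] at h; linarith

/-- The musical isomorphism at `x` as a continuous linear map. -/
def sharpL (M : TorusMetric) (x : V) : V →L[ℝ] V :=
  LinearMap.toContinuousLinearMap
    { toFun := sharp M x
      map_add' := fun p q => by ext <;> simp [sharp] <;> ring
      map_smul' := fun r p => by ext <;> simp [sharp] <;> ring }

@[simp] theorem sharpL_apply (x p : V) : sharpL M x p = sharp M x p := rfl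

theorem flat_zero (x : V) : flat M x 0 = 0 := by simp [flat]

theorem exists_flat_bound (M : TorusMetric) : ∃ C : ℝ, 0 < C ∧ ∀ x v : V, ‖flat M x v‖ ≤ C * ‖v‖ := by
  obtain ⟨C, hC, h⟩ := exists_flat_lip M
  refine ⟨C, hC, fun x v => ?_⟩
  have := h x 0 0 v ‖v‖ 0 (by simp) (by simp) le_rfl
  simpa [flat_zero] using this

theorem gx_scale_zero (x : V) (t : ℝ) : gx M (x, 0) t = x := by
  obtain ⟨p, hp⟩ := exists_unit M x
  have := hamFlow_scale M (z := (x, p)) (ham_unit hp).le (r := 0) (by norm_num) t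
  simp only [scale, zero_smul, zero_mul, hamFlow_zero] at this
  rw [gx, this]

theorem exists_local_surj (M : TorusMetric) : ∃ h₀ > 0, ∀ h : ℝ, 0 < h → h ≤ h₀ → ∃ δ > 0, ∀ x y : V,
    ‖y - x‖ ≤ δ → ∃ q, ham M (x, q) ≤ 1 / 2 ∧ gx M (x, q) h = y := by
  obtain ⟨L, K, L₂, K₂, hL, hK, hL₂, hK₂, hD⟩ := hamField_bounds M
  obtain ⟨N, hN, hflat⟩ := exists_flat_bound M
  obtain ⟨c, C, hc, hC, hbf⟩ := bf_bounds M
  have hZ : ∀ z t, HasDerivAt (fun s => hamField M (hamFlow M s z)) (hamAccel M (hamFlow M t z)) t :=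
    fun z t => (((contDiff_hamField M).differentiable (by simp) _).hasFDerivAt).comp_hasDerivAt t
      (hamFlow_hasDerivAt M z t)
  set B : ℝ := K₂ * Real.exp K with hB
  have hB0 : 0 ≤ B := by positivity
  refine ⟨min 1 (1 / (2 * N * (B + 1))), by positivity, fun h h0 hh => ?_⟩
  have h1 : h ≤ 1 := hh.trans (min_le_left _ _)
  have h2 : h * (2 * N * (B + 1)) ≤ 1 := by
    have := hh.trans (min_le_right _ _)
    rwa [le_div_iff₀ (by positivity)] at this
  set r : ℝ := Real.sqrt (1 / C) / 2 with hr
  have hr0 : 0 < r := by positivity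
  have hrC : C * r ^ 2 ≤ 1 / 4 := by
    rw [hr, div_pow, Real.sq_sqrt (by positivity)]; field_simp; norm_num
  refine ⟨(h / N - B * h ^ 2) * r, ?_, fun x y hxy => ?_⟩
  · have : B * h ^ 2 < h / N := by
      rw [lt_div_iff₀ hN]
      nlinarith [mul_pos h0 (mul_pos hN h0), mul_nonneg hB0 (mul_pos h0 (mul_pos hN h0)).le]
    nlinarith
  have hq : ∀ q ∈ Metric.closedBall (0 : V) r, ham M (x, q) ≤ 1 / 2 := by
    intro q hq
    rw [mem_closedBall_zero_iff] at hq
    have := (hbf x q).2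
    have h3 : C * ‖q‖ ^ 2 ≤ C * r ^ 2 := by gcongr
    simp only [ham]
    linarith
  have hA : ApproximatesLinearOn (fun q => gx M (x, q) h) (h • sharpL M x) (Metric.closedBall 0 r)
      (B * h ^ 2).toNNReal := by
    intro q₁ hq₁ q₂ hq₂
    have e := flow_taylor_lipschitz hK (hamFlow_zero M) (hamFlow_hasDerivAt M) hZ hK₂
      (h := h) (by rw [abs_of_pos h0]; exact h1) (x, q₁) (x, q₂)
    rw [Real.coe_toNNReal _ (by positivity)]
    refine le_trans ?_ (e.trans (le_of_eq ?_))
    · refine le_trans (le_of_eq ?_) (norm_fst_le _)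
      rw [hamField_eq M (lt_of_le_of_lt (hq _ hq₁) (by norm_num)),
        hamField_eq M (lt_of_le_of_lt (hq _ hq₂) (by norm_num))]
      congr 1
      simp only [gx, Prod.fst_sub, Prod.smul_fst, smul_apply, map_sub, sharpL_apply]
      abel
    · simp [Prod.norm_def, hB]
  let inv : ContinuousLinearMap.NonlinearRightInverse (h • sharpL M x) :=
    { toFun := fun v => flat M x (h⁻¹ • v)
      nnnorm := (N / h).toNNReal
      bound' := fun v => by
        rw [Real.coe_toNNReal _ (by positivity)]
        refine (hflat _ _).trans (le_of_eq ?_)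
        rw [norm_smul, Real.norm_eq_abs, abs_of_pos (inv_pos.2 h0)]; field_simp
      right_inv' := fun v => by
        rw [smul_apply, sharpL_apply, sharp_flat, smul_smul, mul_inv_cancel₀ h0.ne', one_smul] }
  have hs := hA.surjOn_closedBall_of_nonlinearRightInverse inv hr0.le subset_rfl
  have hy : y ∈ Metric.closedBall (gx M (x, 0) h)
      (((inv.nnnorm : ℝ)⁻¹ - ((B * h ^ 2).toNNReal : ℝ)) * r) := by
    rw [gx_scale_zero, mem_closedBall_iff_norm]
    refine hxy.trans (le_of_eq ?_)
    simp only [inv]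
    rw [Real.coe_toNNReal _ (by positivity), Real.coe_toNNReal _ (by positivity), inv_div]
  obtain ⟨q, hqm, hqy⟩ := hs hy
  exact ⟨q, hq q hqm, hqy⟩

theorem exists_local_minimizer (M : TorusMetric) : ∃ δ > 0, ∀ x y : V, M.dist x y ≤ δ →
    ∃ p, bf M x p p = 1 ∧ gx M (x, p) (M.dist x y) = y := by
  obtain ⟨ρ, hρ, hmin⟩ := exists_mdist_gx M
  obtain ⟨h₀, hh₀, H⟩ := exists_local_surj M
  obtain ⟨δ, hδ, H⟩ := H (min h₀ ρ) (by positivity) (min_le_left _ _)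
  set h := min h₀ ρ with hh
  have hh0 : 0 < h := by positivity
  have hhρ : h ≤ ρ := min_le_right _ _
  obtain ⟨c, C, hc, hC, hd⟩ := exists_mdist_bounds M
  refine ⟨c * δ, by positivity, fun x y hxy => ?_⟩
  have h1 : ‖y - x‖ ≤ δ := by
    have := (hd x y).1.trans hxy
    exact le_of_mul_le_mul_left this hc
  obtain ⟨q, hq, hqy⟩ := H x y h1
  by_cases hq0 : q = 0
  · rw [hq0, gx_scale_zero] at hqy
    subst hqy
    obtain ⟨p, hp⟩ := exists_unit M x
    exact ⟨p, hp, by rw [mdist_self, gx_zero]⟩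
  set m := Real.sqrt (bf M x q q) with hm
  have hb := bf_pos M x hq0
  have hm0 : 0 < m := Real.sqrt_pos.2 hb
  have hm2 : m ^ 2 = bf M x q q := Real.sq_sqrt hb.le
  have hm1 : m ≤ 1 := by
    have : bf M x q q ≤ 1 := by simp only [ham] at hq; linarith
    rw [hm, Real.sqrt_le_one]; exact this
  set p := m⁻¹ • q with hp
  have hpu : bf M x p p = 1 := by
    have : bf M x p p = (m⁻¹) ^ 2 * bf M x q q := by simp [hp, bf]; ring
    rw [this, ← hm2]; field_simp
  have hqp : (x, q) = scale m (x, p) := by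
    simp [scale, hp, smul_smul, hm0.ne']
  have e : gx M (x, q) h = gx M (x, p) (m * h) := by
    rw [hqp, gx, hamFlow_scale M (ham_unit hpu).le (by rw [abs_of_pos hm0]; exact hm1)]
    rfl
  have := hmin (x, p) (ham_unit hpu) 0 (m * h) (by positivity) (by nlinarith)
  rw [gx_zero, ← e, hqy, sub_zero] at this
  exact ⟨p, hpu, by rw [this, ← e, hqy]⟩

theorem deriv_nonneg_of_right {f : ℝ → ℝ} {f' ε : ℝ} (hf : HasDerivAt f f' 0) (h0 : f 0 = 0)
    (hε : 0 < ε) (h : ∀ s, 0 ≤ s → s ≤ ε → 0 ≤ f s) : 0 ≤ f' := by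
  have := hf.tendsto_slope_zero_right
  refine ge_of_tendsto this ?_
  filter_upwards [Ioc_mem_nhdsGT hε] with s hs
  simp only [zero_add, h0, sub_zero, smul_eq_mul]
  exact mul_nonneg (inv_pos.2 hs.1).le (h s hs.1.le hs.2)

theorem eq_of_unit_of_one_le {x p q : V} (hp : bf M x p p = 1) (hq : bf M x q q = 1)
    (h : 1 ≤ bf M x p q) : p = q := by
  by_contra hne
  have := bf_pos M x (sub_ne_zero.2 hne)
  have e : bf M x (p - q) (p - q) = bf M x p p + bf M x q q - 2 * bf M x p q := by simp [bf]; ring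
  linarith

/-- A minimizing curve has no corners. -/
theorem no_corner {z₁ z₂ : V × V} (h1 : ham M z₁ = 1 / 2) (h2 : ham M z₂ = 1 / 2)
    (h12 : z₁.1 = z₂.1) {τ ε : ℝ} (hτ : 0 < τ) (hε : 0 < ε)
    (h : ∀ s, 0 ≤ s → s ≤ ε → τ + s ≤ M.dist (gx M z₁ (-τ)) (gx M z₂ s)) : z₁ = z₂ := by
  obtain ⟨C, hC, hfv⟩ := exists_first_variation M hτ
  have hb : HasDerivAt (fun s => gx M z₂ s - z₁.1) (sharp M z₂.1 z₂.2) 0 := by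
    have := (gx_hasDerivAt h2.le 0).sub_const z₁.1
    rwa [gx_zero, gp_zero] at this
  have hp : HasDerivAt (fun _ : ℝ => z₁.2) 0 0 := hasDerivAt_const _ _
  have hf := ((HasDerivAt.dot hp hb).add ((HasDerivAt.dot hb hb).const_mul C)).sub
    (hasDerivAt_id (0 : ℝ))
  have hge := deriv_nonneg_of_right hf ?_ hε ?_
  · have h12' : gx M z₂ 0 - z₁.1 = 0 := by rw [gx_zero, h12, sub_self]
    rw [h12'] at hge
    have e : dot z₁.2 (sharp M z₂.1 z₂.2) = bf M z₂.1 z₁.2 z₂.2 := dot_sharp ..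
    rw [e] at hge
    simp only [dot, Prod.fst_zero, Prod.snd_zero, mul_zero, zero_mul, add_zero, zero_add] at hge
    have hz1 := unit_of_ham h1
    rw [h12] at hz1
    exact Prod.ext h12 (eq_of_unit_of_one_le hz1 (unit_of_ham h2) (by linarith))
  · simp [gx_zero, h12, dot]
  · intro s hs0 hs
    have k1 := h s hs0 hs
    have k2 := hfv (hamFlow M (-τ) z₁) (ham_flow_unit h1 _) (gx M z₂ s - z₁.1)
    rw [gx_flow, gp_flow, add_neg_cancel, gx_zero, gp_zero, add_sub_cancel] at k2
    have k3 : (hamFlow M (-τ) z₁).1 = gx M z₁ (-τ) := rfl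
    rw [k3] at k2
    have k4 := mul_le_mul_of_nonneg_left (sq_norm_le_dot (gx M z₂ s - z₁.1)) hC.le
    simp only [Pi.sub_apply, Pi.add_apply, id]
    linarith

theorem isCompact_sphere (M : TorusMetric) (x : V) (δ : ℝ) : IsCompact {z | M.dist x z = δ} := by
  obtain ⟨c, C, hc, hC, hd⟩ := exists_mdist_bounds M
  refine Metric.isCompact_of_isClosed_isBounded ?_ ?_
  · exact isClosed_eq ((continuous_mdist M).comp (continuous_const.prodMk continuous_id))
      continuous_const
  · refine (Metric.isBounded_closedBall (x := x) (r := δ / c)).subset fun z hz => ?_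
    have hz : M.dist x z = δ := hz
    rw [mem_closedBall_iff_norm, le_div_iff₀ hc]
    have := (hd x z).1
    linarith

/-- Hopf–Rinow: any two points are joined by a minimizing unit speed solution. -/
theorem exists_minimizer (M : TorusMetric) (x y : V) :
    ∃ p, bf M x p p = 1 ∧ gx M (x, p) (M.dist x y) = y := by
  obtain ⟨ρ, hρ, hmin⟩ := exists_mdist_gx M
  obtain ⟨δ₀, hδ₀, hloc⟩ := exists_local_minimizer M
  set δ := min ρ δ₀ with hδd
  have hδ : 0 < δ := lt_min hρ hδ₀
  suffices H : ∀ (n : ℕ) (x y : V), M.dist x y ≤ n * δ →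
      ∃ p, bf M x p p = 1 ∧ gx M (x, p) (M.dist x y) = y by
    obtain ⟨n, hn⟩ := exists_nat_ge (M.dist x y / δ)
    exact H n x y (by rwa [div_le_iff₀ hδ] at hn)
  intro n
  induction n with
  | zero =>
    intro x y hxy
    simp only [Nat.cast_zero, zero_mul] at hxy
    exact hloc x y (hxy.trans hδ₀.le)
  | succ n ih =>
    intro x y hxy
    rcases le_or_gt (M.dist x y) δ with hle | hlt
    · exact hloc x y (hle.trans (min_le_right _ _))
    have hne : {z | M.dist x z = δ}.Nonempty := by
      obtain ⟨p, hp⟩ := exists_unit M x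
      refine ⟨gx M (x, p) δ, ?_⟩
      have := hmin (x, p) (ham_unit hp) 0 δ hδ.le (by rw [sub_zero]; exact min_le_left _ _)
      rwa [gx_zero, sub_zero] at this
    obtain ⟨z, hz, hzmin⟩ := (isCompact_sphere M x δ).exists_isMinOn hne
      (f := fun z => M.dist z y)
      ((continuous_mdist M).comp (continuous_id.prodMk continuous_const)).continuousOn
    have hz : M.dist x z = δ := hz
    have hzy : M.dist z y = M.dist x y - δ := by
      apply le_antisymm
      · rw [le_sub_iff_add_le']
        refine le_dist M fun c hc h0 h1 => ?_
        have hcc : ContinuousOn (fun t => M.dist x (c t)) (Icc 0 1) :=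
          ((continuous_mdist M).comp (continuous_const.prodMk hc.continuous)).continuousOn
        obtain ⟨t, ht, htδ⟩ := intermediate_value_Icc zero_le_one hcc
          (show δ ∈ Icc (M.dist x (c 0)) (M.dist x (c 1)) by
            rw [h0, h1, mdist_self]; exact ⟨hδ.le, hlt.le⟩)
        have l1 := dist_le_length M hc ht.1
        have l2 := dist_le_length M hc ht.2
        have l3 : M.length c 0 t + M.length c t 1 = M.length c 0 1 := by
          simp only [length_eq]
          exact intervalIntegral.integral_add_adjacent_intervals
            ((speed_continuous M hc).intervalIntegrable _ _)
            ((speed_continuous M hc).intervalIntegrable _ _)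
        have l4 : M.dist z y ≤ M.dist (c t) y := hzmin htδ
        simp only at htδ
        rw [h0, htδ] at l1
        rw [h1] at l2
        linarith
      · have := mdist_triangle M x z y
        linarith
    obtain ⟨q, hq, hqy⟩ := ih z y (by push_cast at hxy; rw [hzy]; linarith)
    obtain ⟨p, hp, hpz⟩ := hloc x z (by rw [hz]; exact min_le_right _ _)
    rw [hz] at hpz
    have hzpos : 0 < M.dist z y := by rw [hzy]; linarith
    have key : hamFlow M δ (x, p) = (z, q) := by
      refine no_corner (ham_flow_unit (ham_unit hp) δ) (ham_unit hq) hpz hδ hzpos fun s hs0 hs => ?_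
      rw [gx_flow, neg_add_cancel, gx_zero]
      have t1 := mdist_triangle M x (gx M (z, q) s) y
      have t2 := mdist_gx_le (ham_unit hq) hs
      rw [hqy] at t2
      linarith
    refine ⟨p, hp, ?_⟩
    have := gx_flow (M := M) (x, p) δ (M.dist z y)
    rw [key, hqy, hzy, sub_add_cancel] at this
    exact this.symm

end FlatTorus

namespace FlatTorus

open scoped NNReal

variable {M : TorusMetric}

/-- No geodesic intersects one of its translates transversally. -/
def NoCrossing (M : TorusMetric) : Prop := ∀ c, M.IsGeodesic c → ∀ k : ℤ × ℤ, k ≠ 0 →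
  transInter c (transl k c) Set.univ Set.univ = ∅

theorem sharp_per (k : ℤ × ℤ) (x p : V) : sharp M (x + lat k) p = sharp M x p := by
  simp only [sharp, al_per, be_per, ga_per]

theorem bf_per (k : ℤ × ℤ) (x p q : V) : bf M (x + lat k) p q = bf M x p q := by
  simp only [bf, al_per, be_per, ga_per]

theorem bf_gram (x p q : V) : bf M x p p * bf M x q q - bf M x p q ^ 2 =
    cD M x * crossDet (sharp M x p) (sharp M x q) ^ 2 := by
  rw [← g_sharp_sharp, ← g_sharp_sharp, ← dot_sharp, ← g_sharp, g_eq, g_eq, g_eq, cD, crossDet]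
  ring

theorem bf_neg_right (x p q : V) : bf M x p (-q) = -bf M x p q := by simp [bf]; ring

theorem bf_neg_neg (x p q : V) : bf M x (-p) (-q) = bf M x p q := by simp [bf]

theorem exists_axis (h : NoCrossing M) (x : V) {k : ℤ × ℤ} (hk : k ≠ 0) : ∃ p, bf M x p p = 1 ∧
    hamFlow M (M.dist x (x + lat k)) (x, p) = (x, p) + (lat k, 0) := by
  obtain ⟨p, hp, hpk⟩ := exists_minimizer M x (x + lat k)
  set T := M.dist x (x + lat k) with hT
  have hz := ham_unit hp
  set q := gp M (x, p) T with hq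
  have hflow : hamFlow M T (x, p) = (x + lat k, q) := Prod.ext hpk rfl
  have hqu : bf M x q q = 1 := by
    have := bf_unit hz T
    rwa [hpk, bf_per] at this
  have hcross : crossDet (sharp M x q) (sharp M x p) = 0 := by
    by_contra hne
    have hempty := h _ (isGeodesic_gx hz) k hk
    have hd1 := (gx_hasDerivAt hz.le T).deriv
    have hd2 : deriv (transl k (gx M (x, p))) 0 = sharp M x p := by
      have := ((gx_hasDerivAt hz.le 0).add_const (lat k)).deriv
      rwa [gx_zero, gp_zero] at this
    have : x + lat k ∈ transInter (gx M (x, p)) (transl k (gx M (x, p))) univ univ := by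
      refine ⟨T, mem_univ _, 0, mem_univ _, hpk, by simp [transl, gx_zero], ?_⟩
      rw [hd1, hd2, hpk, sharp_per]
      exact hne
    rw [hempty] at this
    exact this
  have hg := bf_gram (M := M) x q p
  rw [hcross, hqu, hp] at hg
  have hsq : bf M x q p ^ 2 = 1 := by linarith
  rcases mul_self_eq_one_iff.1 ((sq _).symm.trans hsq) with h1 | h1
  · have : q = p := eq_of_unit_of_one_le hqu hp h1.ge
    exact ⟨p, hp, by rw [hflow, this]; simp⟩
  · exfalso
    have hqp : q = -p := eq_of_unit_of_one_le hqu (by rw [bf_neg_neg, hp])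
      (by rw [bf_neg_right, h1, neg_neg])
    have e := gp_flow (M := M) (x, p) T (-(T / 2))
    have : hamFlow M T (x, p) = scale (-1) (x, p) + (lat k, 0) := by
      rw [hflow, hqp]; simp [scale]
    rw [this, gp_per, gp_reverse hz, show -(T / 2) + T = T / 2 by ring, neg_neg] at e
    have h0 : gp M (x, p) (T / 2) = 0 := by
      have := self_eq_neg.1 e.symm
      exact this
    have := bf_unit hz (T / 2)
    rw [h0] at this
    simp [bf] at this

theorem hasFDerivAt_of_quadratic {F : V → ℝ} {x : V} {L : V →L[ℝ] ℝ} {C : ℝ}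
    (h : ∀ a, |F (x + a) - F x - L a| ≤ C * ‖a‖ ^ 2) : HasFDerivAt F L x := by
  rw [hasFDerivAt_iff_isLittleO_nhds_zero]
  refine Asymptotics.IsBigO.trans_isLittleO (g := fun a : V => ‖a‖ ^ 2) ?_ ?_
  · refine Asymptotics.IsBigO.of_bound C (Eventually.of_forall fun a => ?_)
    simpa using h a
  · have := Asymptotics.isLittleO_norm_pow_id (E' := V) (n := 2) (by norm_num)
    exact this

theorem gx_axis {x p : V} {k : ℤ × ℤ} {T : ℝ} (hflow : hamFlow M T (x, p) = (x, p) + (lat k, 0))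
    (t : ℝ) : gx M (x, p) (t + T) = gx M (x, p) t + lat k := by
  rw [← gx_flow, hflow, gx_per]

theorem dist_translate_const (h : NoCrossing M) (k : ℤ × ℤ) (x : V) :
    M.dist x (x + lat k) = M.dist 0 (lat k) := by
  rcases eq_or_ne k 0 with rfl | hk
  · simp [lat_zero, mdist_self]
  obtain ⟨c, C', hc, -, hd⟩ := exists_mdist_bounds M
  have hcT : ∀ x, c ≤ M.dist x (x + lat k) := fun x => by
    have := (hd x (x + lat k)).1
    rw [add_sub_cancel_left] at this
    nlinarith [one_le_norm_lat hk]
  have hτ : 0 < c / 2 := by positivity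
  obtain ⟨C₁, hC₁, h1⟩ := exists_first_variation M hτ
  obtain ⟨C₂, hC₂, h2⟩ := exists_first_variation_start M hτ
  set τ := c / 2 with hτd
  have key : ∀ x a : V, M.dist (x + a) (x + a + lat k) ≤ M.dist x (x + lat k) + (C₁ + C₂) * ‖a‖ ^ 2 := by
    intro x a
    obtain ⟨p, hp, hflow⟩ := exists_axis h x hk
    have hT := hcT x
    set T := M.dist x (x + lat k)
    have hz := ham_unit hp
    have e1 := h2 (x, p) hz a
    have e2 := mdist_gx_le hz (a := τ) (b := T - τ) (by linarith)
    have e3 := h1 (hamFlow M (T - τ) (x, p)) (ham_flow_unit hz _) a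
    have e4 : (hamFlow M (T - τ) (x, p)).1 = gx M (x, p) (T - τ) := rfl
    have e5 : gx M (x, p) T = x + lat k := by simp [gx, hflow]
    have e6 : gp M (x, p) T = p := by simp [gp, hflow]
    rw [gx_flow, gp_flow, e4, add_sub_cancel, e5, e6] at e3
    have t1 := mdist_triangle M (x + a) (gx M (x, p) τ) (x + a + lat k)
    have t2 := mdist_triangle M (gx M (x, p) τ) (gx M (x, p) (T - τ)) (x + a + lat k)
    rw [show x + lat k + a = x + a + lat k by abel] at e3
    simp only at e1
    linarith
  have hfd : ∀ x, HasFDerivAt (fun x => M.dist x (x + lat k)) (0 : V →L[ℝ] ℝ) x := fun x => by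
    refine hasFDerivAt_of_quadratic (C := C₁ + C₂) fun a => ?_
    have k1 := key x a
    have k2 := key (x + a) (-a)
    rw [norm_neg, add_neg_cancel_right] at k2
    rw [zero_apply, sub_zero, abs_le]
    constructor <;> linarith
  have := is_const_of_fderiv_eq_zero (𝕜 := ℝ) (fun x => (hfd x).differentiableAt)
    (fun x => (hfd x).fderiv) x 0
  simpa using this

/-- The stable norm of a lattice vector. -/
def stab (M : TorusMetric) (k : ℤ × ℤ) : ℝ := M.dist 0 (lat k)

theorem stab_neg (k : ℤ × ℤ) : stab M (-k) = stab M k := by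
  have := mdist_add_lat M k 0 (lat (-k))
  rw [lat_neg, neg_add_cancel, zero_add, mdist_comm] at this
  rw [stab, stab, lat_neg, this]

/-- The dual unit ball of the stable norm. -/
def dualBall (M : TorusMetric) : Set V := {f | ∀ k, dot f (lat k) ≤ stab M k}

/-- The boundary of the dual unit ball. -/
def dualSphere (M : TorusMetric) : Set V :=
  {f | f ∈ dualBall M ∧ ∀ r : ℝ, 1 < r → ∃ k, stab M k < r * dot f (lat k)}

theorem neg_dot (f v : V) : dot (-f) v = -dot f v := by simp [dot]; ring
theorem dot_neg (f v : V) : dot f (-v) = -dot f v := by simp [dot]; ring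
theorem dot_add (f v w : V) : dot f (v + w) = dot f v + dot f w := by simp [dot]; ring
theorem smul_dot (r : ℝ) (f v : V) : dot (r • f) v = r * dot f v := by simp [dot]; ring
theorem dot_smul (r : ℝ) (f v : V) : dot f (r • v) = r * dot f v := by simp [dot]; ring

theorem neg_mem_dualBall {f : V} (hf : f ∈ dualBall M) : -f ∈ dualBall M := fun k => by
  have := hf (-k)
  rwa [stab_neg, lat_neg, dot_neg, ← neg_dot] at this

theorem neg_mem_dualSphere {f : V} (hf : f ∈ dualSphere M) : -f ∈ dualSphere M := by
  refine ⟨neg_mem_dualBall hf.1, fun r hr => ?_⟩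
  obtain ⟨k, hk⟩ := hf.2 r hr
  exact ⟨-k, by rw [stab_neg, lat_neg, dot_neg, neg_dot, neg_neg]; exact hk⟩

/-- Equivariant functions that are `1`-Lipschitz for the Riemannian distance. -/
structure Calib (M : TorusMetric) (f : V) (F : V → ℝ) : Prop where
  lip : ∀ x y, F y - F x ≤ M.dist x y
  equi : ∀ x k, F (x + lat k) = F x + dot f (lat k)

theorem Calib.neg {f : V} {F : V → ℝ} (h : Calib M f F) : Calib M (-f) (fun x => -F x) where
  lip x y := by have := h.lip y x; rw [mdist_comm] at this; linarith
  equi x k := by rw [h.equi, neg_dot]; ring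

theorem Calib.abs_le {f : V} {F : V → ℝ} (h : Calib M f F) (x y : V) : |F y - F x| ≤ M.dist x y := by
  have h1 := h.lip x y
  have h2 := h.lip y x
  rw [mdist_comm] at h2
  rw [_root_.abs_le]; constructor <;> linarith

theorem exists_calib_lipschitz (M : TorusMetric) : ∃ C : ℝ≥0, ∀ f F, Calib M f F →
    LipschitzWith C F := by
  obtain ⟨c, C, hc, hC, hd⟩ := exists_mdist_bounds M
  refine ⟨C.toNNReal, fun f F h => LipschitzWith.of_dist_le_mul fun x y => ?_⟩
  rw [Real.coe_toNNReal _ hC.le, dist_comm, dist_comm x y, Real.dist_eq, dist_eq_norm]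
  exact (h.abs_le x y).trans (hd x y).2

theorem Calib.continuous {f : V} {F : V → ℝ} (h : Calib M f F) : Continuous F := by
  obtain ⟨C, hC⟩ := exists_calib_lipschitz M
  exact (hC f F h).continuous

/-- The calibration function associated with a point of the dual ball. -/
def calibFun (M : TorusMetric) (f : V) (x : V) : ℝ :=
  ⨆ k : ℤ × ℤ, (dot f (lat k) - M.dist x (lat k))

theorem calibFun_bdd {f : V} (hf : f ∈ dualBall M) (x : V) :
    BddAbove (range fun k : ℤ × ℤ => dot f (lat k) - M.dist x (lat k)) := by
  refine ⟨M.dist 0 x, ?_⟩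
  rintro _ ⟨k, rfl⟩
  have h1 := hf k
  have h2 := mdist_triangle M 0 x (lat k)
  simp only [stab] at h1
  linarith

theorem calib_calibFun {f : V} (hf : f ∈ dualBall M) : Calib M f (calibFun M f) where
  lip x y := by
    rw [sub_le_iff_le_add]
    refine ciSup_le fun k => ?_
    have h1 := le_ciSup (calibFun_bdd hf x) k
    have h2 := mdist_triangle M x y (lat k)
    simp only [calibFun] at h1 ⊢
    linarith
  equi x l := by
    have e : ∀ k, dot f (lat (k + l)) - M.dist (x + lat l) (lat (k + l)) =
        dot f (lat k) - M.dist x (lat k) + dot f (lat l) := fun k => by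
      rw [lat_add, dot_add, mdist_add_lat]; ring
    simp only [calibFun]
    rw [← (Equiv.addRight l).iSup_comp, ciSup_add (calibFun_bdd hf x)]
    simp only [Equiv.coe_addRight, e]

theorem calibFun_zero {f : V} (hf : f ∈ dualBall M) : calibFun M f 0 = 0 := by
  apply le_antisymm
  · exact ciSup_le fun k => by have := hf k; simp only [stab] at this; linarith
  · have := le_ciSup (calibFun_bdd hf 0) 0
    simpa [calibFun, lat_zero, mdist_self, dot] using this

theorem exists_dualBall_bound (M : TorusMetric) : ∃ C : ℝ, 0 < C ∧ ∀ f ∈ dualBall M, ‖f‖ ≤ C := by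
  refine ⟨max 1 (max (stab M (1, 0)) (stab M (0, 1))), by positivity, fun f hf => ?_⟩
  have h1 := hf (1, 0)
  have h2 := hf (-(1, 0))
  have h3 := hf (0, 1)
  have h4 := hf (-(0, 1))
  rw [stab_neg] at h2 h4
  simp [dot, lat] at h1 h2 h3 h4
  refine le_max_of_le_right ?_
  rw [Prod.norm_def]
  exact max_le_max (abs_le.2 ⟨by linarith, h1⟩) (abs_le.2 ⟨by linarith, h3⟩)

theorem exists_calib_approx (M : TorusMetric) : ∃ C : ℝ, 0 < C ∧ ∀ f ∈ dualBall M, ∀ F, Calib M f F →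
    ∀ y, |F y - F 0 - dot f y| ≤ C := by
  obtain ⟨C₁, hC₁, hB⟩ := exists_dualBall_bound M
  obtain ⟨c, C, hc, hC, hd⟩ := exists_mdist_bounds M
  refine ⟨C + 2 * C₁, by positivity, fun f hf F hF y => ?_⟩
  obtain ⟨k, hk⟩ := exists_lat_mem y
  have hn : ‖y + lat k‖ ≤ 1 := by
    refine norm_prod_le_iff.2 ⟨?_, ?_⟩ <;> rw [Real.norm_eq_abs, abs_le]
    · exact ⟨by linarith [hk.1.1, show (0 : V).1 = 0 from rfl], hk.2.1⟩
    · exact ⟨by linarith [hk.1.2, show (0 : V).2 = 0 from rfl], hk.2.2⟩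
  have h1 := hF.abs_le 0 (y + lat k)
  have h2 := (hd 0 (y + lat k)).2
  rw [sub_zero] at h2
  have h3 : |dot f (y + lat k)| ≤ 2 * C₁ * 1 :=
    (abs_dot_le _ _).trans (by gcongr; exact hB f hf)
  rw [hF.equi] at h1
  rw [dot_add] at h3
  rw [abs_le] at *
  constructor <;> nlinarith

theorem exists_recurrence_time {ζ : ℝ} (hζ : 0 < ζ) : ∃ S : ℕ, 0 < S ∧ ∀ u : ℕ → V,
    ∃ i j : ℕ, i < j ∧ j ≤ S ∧ ∃ k : ℤ × ℤ, ‖u j - (u i + lat k)‖ ≤ ζ := by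
  obtain ⟨t, -, htf, ht⟩ := isCompact_cell.finite_cover_balls (half_pos hζ)
  lift t to Finset V using htf
  choose κ hκ using exists_lat_mem
  have hsel : ∀ x : V, ∃ y ∈ t, dist (x + lat (κ x)) y < ζ / 2 := fun x => by
    have := ht (hκ x)
    simp only [mem_iUnion, Metric.mem_ball, Finset.mem_coe, exists_prop] at this
    exact this
  choose σ hσt hσ using hsel
  refine ⟨t.card + 1, by positivity, fun u => ?_⟩
  obtain ⟨i, hi, j, hj, hne, hij⟩ := Finset.exists_ne_map_eq_of_card_lt_of_maps_to
    (s := Finset.range (t.card + 1)) (t := t) (by simp) (f := fun n => σ (u n))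
    (fun n _ => hσt _)
  have main : ∀ i j, σ (u i) = σ (u j) → ∃ k : ℤ × ℤ, ‖u j - (u i + lat k)‖ ≤ ζ := by
    intro i j hij
    refine ⟨κ (u i) - κ (u j), ?_⟩
    have h1 := hσ (u i)
    have h2 := hσ (u j)
    rw [← hij] at h2
    have := dist_triangle_right (u j + lat (κ (u j))) (u i + lat (κ (u i))) (σ (u i))
    rw [dist_eq_norm] at this
    rw [lat_sub, show u j - (u i + (lat (κ (u i)) - lat (κ (u j)))) =
      u j + lat (κ (u j)) - (u i + lat (κ (u i))) by abel]
    linarith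
  rw [Finset.mem_range] at hi hj
  rcases lt_or_gt_of_ne hne with hlt | hlt
  · exact ⟨i, j, hlt, hj.le, main i j hij⟩
  · exact ⟨j, i, hlt, hi.le, main j i hij.symm⟩

theorem Calib.gx_le {f : V} {F : V → ℝ} (h : Calib M f F) {z : V × V} (hz : ham M z = 1 / 2) {s t : ℝ}
    (hst : s ≤ t) : F (gx M z t) - F (gx M z s) ≤ t - s :=
  (h.lip _ _).trans (mdist_gx_le hz hst)

theorem Calib.axis_add {f : V} {F : V → ℝ} (h : Calib M f F) {x p : V} {k : ℤ × ℤ} {T : ℝ}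
    (hflow : hamFlow M T (x, p) = (x, p) + (lat k, 0)) (s : ℝ) (n : ℕ) :
    F (gx M (x, p) (s + n * T)) = F (gx M (x, p) s) + n * dot f (lat k) := by
  induction n with
  | zero => simp
  | succ n ih =>
    push_cast
    rw [show s + (n + 1) * T = s + n * T + T by ring, gx_axis hflow, h.equi, ih]; ring

theorem exists_steep_block (h : NoCrossing M) {f : V} (hf : f ∈ dualSphere M) {S σ : ℝ} (hS : 0 < S)
    (hσ0 : 0 < σ) (hσ : σ < 1) : ∃ z, ham M z = 1 / 2 ∧
      S * σ ≤ calibFun M f (gx M z S) - calibFun M f z.1 := by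
  have hF := calib_calibFun hf.1
  set F := calibFun M f
  obtain ⟨r, hr1, hrσ⟩ := exists_between ((one_lt_inv₀ hσ0).2 hσ)
  obtain ⟨k, hk⟩ := hf.2 r hr1
  have hk0 : k ≠ 0 := by
    rintro rfl
    simp [stab, lat_zero, mdist_self, dot] at hk
  obtain ⟨p, hp, hflow⟩ := exists_axis h 0 hk0
  rw [zero_add] at hflow
  change hamFlow M (stab M k) _ = _ at hflow
  set T := stab M k with hT
  have hT0 : 0 < T := by
    rw [hT, stab]; exact mdist_pos M (lat_ne_zero hk0).symm
  have hz := ham_unit hp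
  by_contra! hcon
  have step : ∀ t, F (gx M (0, p) (t + S)) - F (gx M (0, p) t) < S * σ := fun t => by
    have := hcon (hamFlow M t (0, p)) (ham_flow_unit hz t)
    rwa [gx_flow, add_comm S t] at this
  have steps : ∀ n : ℕ, F (gx M (0, p) (n * S)) - F (gx M (0, p) 0) ≤ n * (S * σ) := fun n => by
    induction n with
    | zero => simp
    | succ n ih =>
      have := step (n * S)
      push_cast
      rw [show ((n : ℝ) + 1) * S = n * S + S by ring]
      linarith
  have hr0 : 0 < r := by linarith
  have hkT : σ * T < dot f (lat k) := by
    have h1 : σ * r < 1 := by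
      have := mul_lt_mul_of_pos_left hrσ hσ0
      rwa [mul_inv_cancel₀ hσ0.ne'] at this
    have h2 : 0 < dot f (lat k) := by
      by_contra hneg
      nlinarith
    nlinarith
  have lower : ∀ m : ℕ, m * dot f (lat k) ≤ (m * T / S + 1) * (S * σ) + S := fun m => by
    have h1 := hF.axis_add hflow 0 m
    rw [zero_add] at h1
    have h2 := hF.gx_le hz (s := ⌊m * T / S⌋₊ * S) (t := m * T)
      (by rw [← le_div_iff₀ hS]; exact Nat.floor_le (by positivity))
    have h3 := steps ⌊m * T / S⌋₊
    have h4 := Nat.floor_le (a := m * T / S) (by positivity)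
    have h5 := Nat.lt_floor_add_one (m * T / S)
    have h6 : m * T < (⌊m * T / S⌋₊ + 1) * S := by rwa [← div_lt_iff₀ hS]
    have h7 : (⌊m * T / S⌋₊ : ℝ) * (S * σ) ≤ (m * T / S + 1) * (S * σ) := by
      gcongr; linarith
    linarith
  have e : ∀ m : ℕ, (m : ℝ) * (dot f (lat k) - σ * T) ≤ S * σ + S := fun m => by
    have := lower m
    have e : (m * T / S + 1) * (S * σ) = m * T * σ + S * σ := by field_simp
    rw [e] at this
    linarith
  obtain ⟨m, hm⟩ := exists_nat_gt ((S * σ + S) / (dot f (lat k) - σ * T))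
  rw [div_lt_iff₀ (by linarith)] at hm
  linarith [e m]

theorem exists_almost_tight (h : NoCrossing M) {f : V} (hf : f ∈ dualSphere M) {η : ℝ} (hη : 0 < η) :
    ∃ k : ℤ × ℤ, k ≠ 0 ∧ stab M k - dot f (lat k) ≤ η := by
  wlog hη1 : η ≤ 1 generalizing η
  · obtain ⟨k, hk, hk'⟩ := this one_pos le_rfl
    exact ⟨k, hk, by linarith⟩
  obtain ⟨c, C, hc, hC, hd⟩ := exists_mdist_bounds M
  obtain ⟨S, hS, hrec⟩ := exists_recurrence_time (ζ := η / (4 * C)) (by positivity)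
  have hS1 : (1 : ℝ) ≤ S := by exact_mod_cast hS
  have hS0 : (0 : ℝ) < S := by linarith
  have hσ : η / (2 * S) < 1 := by rw [div_lt_one (by positivity)]; linarith
  obtain ⟨z, hz, hblock⟩ := exists_steep_block h hf (S := S) (σ := 1 - η / (2 * S)) hS0
    (by linarith) (by linarith [show 0 < η / (2 * S) by positivity])
  have hF := calib_calibFun hf.1
  set F := calibFun M f
  obtain ⟨i, j, hij, hjS, k, hk⟩ := hrec fun n => gx M z n
  have hij' : (i : ℝ) + 1 ≤ j := by exact_mod_cast hij
  have hjS' : (j : ℝ) ≤ S := by exact_mod_cast hjS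
  have hi0 : (0 : ℝ) ≤ i := by positivity
  have a1 := hF.gx_le hz (s := 0) (t := i) hi0
  have a2 := hF.gx_le hz (s := j) (t := S) hjS'
  rw [gx_zero] at a1
  have e1 : (S : ℝ) * (1 - η / (2 * S)) = S - η / 2 := by field_simp
  rw [e1] at hblock
  have a3 : M.dist (gx M z j) (gx M z i + lat k) ≤ η / 4 := by
    rw [mdist_comm]
    refine (hd _ _).2.trans ?_
    calc C * ‖gx M z j - (gx M z i + lat k)‖ ≤ C * (η / (4 * C)) := by gcongr
      _ = η / 4 := by field_simp
  have a4 := hF.lip (gx M z i + lat k) (gx M z j)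
  rw [mdist_comm, hF.equi] at a4
  have a5 := mdist_triangle M (gx M z i) (gx M z j) (gx M z i + lat k)
  rw [dist_translate_const h k] at a5
  have a6 := mdist_gx_le hz (a := i) (b := j) (by linarith)
  refine ⟨k, ?_, by simp only [stab]; linarith⟩
  rintro rfl
  rw [lat_zero, add_zero] at a3
  simp only [lat_zero, dot, Prod.fst_zero, Prod.snd_zero, mul_zero, add_zero] at a4
  linarith

theorem isCompact_unit (M : TorusMetric) (x : V) : IsCompact {p | bf M x p p = 1} := by
  obtain ⟨c, C, hc, hC, hd⟩ := bf_bounds M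
  refine Metric.isCompact_of_isClosed_isBounded ?_ ?_
  · exact isClosed_eq ((continuous_bf M).comp (continuous_const.prodMk
      (continuous_id.prodMk continuous_id))) continuous_const
  · refine (Metric.isBounded_closedBall (x := 0) (r := Real.sqrt (1 / c))).subset fun p hp => ?_
    have hp : bf M x p p = 1 := hp
    rw [mem_closedBall_zero_iff]
    apply Real.le_sqrt_of_sq_le
    rw [le_div_iff₀ hc]
    have := (hd x p).1
    linarith

theorem gx_continuous (M : TorusMetric) (t : ℝ) : Continuous fun z => gx M z t :=
  continuous_fst.comp ((hamFlow_continuous M).comp (continuous_const.prodMk continuous_id))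

/-- The orbit of `(x, p)` is calibrated by all calibration functions with slope `f`. -/
def IsCalibrated (M : TorusMetric) (f x p : V) : Prop := bf M x p p = 1 ∧ ∀ F, Calib M f F → ∀ s t,
  s ≤ t → F (gx M (x, p) t) - F (gx M (x, p) s) = t - s

theorem exists_calibrated (h : NoCrossing M) {f : V} (hf : f ∈ dualSphere M) (x : V) :
    ∃ p, IsCalibrated M f x p := by
  have hη : ∀ n : ℕ, (0 : ℝ) < 1 / (n + 1) := fun n => by positivity
  choose k hk0 hk using fun n => exists_almost_tight h hf (hη n)
  choose p hp hflow using fun n => exists_axis h x (hk0 n)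
  simp only [dist_translate_const h] at hflow
  obtain ⟨c, C, hc, hC, hd⟩ := exists_mdist_bounds M
  have hcT : ∀ n, c ≤ stab M (k n) := fun n => by
    have := (hd 0 (lat (k n))).1
    rw [sub_zero] at this
    rw [stab]
    nlinarith [one_le_norm_lat (hk0 n)]
  obtain ⟨q, hq, φ, hφ, hlim⟩ := (isCompact_unit M x).tendsto_subseq hp
  refine ⟨q, hq, fun F hF s t hst => le_antisymm (hF.gx_le (ham_unit hq) hst) ?_⟩
  have hlow : ∀ n : ℕ, (t - s) - ((t - s) / c + 1) * (1 / ((n : ℝ) + 1)) ≤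
      F (gx M (x, p n) t) - F (gx M (x, p n) s) := fun n => by
    set T := stab M (k n) with hT
    have hT0 : 0 < T := hc.trans_le (hcT n)
    set m := ⌈(t - s) / T⌉₊ with hm
    have h1 : (t - s) / T ≤ m := Nat.le_ceil _
    have h2 : (m : ℝ) < (t - s) / T + 1 := Nat.ceil_lt_add_one (by
      apply div_nonneg <;> linarith)
    have h3 : (t - s) / T ≤ (t - s) / c := by
      apply div_le_div_of_nonneg_left (by linarith) hc (hcT n)
    rw [div_le_iff₀ hT0] at h1
    have h4 := hF.axis_add (hflow n) s m
    change F (gx M (x, p n) (s + m * T)) = _ at h4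
    have h5 := hF.gx_le (ham_unit (hp n)) (s := t) (t := s + m * T) (by linarith)
    have h6 : (m : ℝ) * (T - 1 / ((n : ℝ) + 1)) ≤ m * dot f (lat (k n)) := by
      have := hk n
      gcongr; linarith
    have h7 : (m : ℝ) * (1 / ((n : ℝ) + 1)) ≤ ((t - s) / c + 1) * (1 / ((n : ℝ) + 1)) := by
      gcongr; linarith
    linarith
  have hlim2 : ∀ u, Tendsto (fun n => F (gx M (x, p (φ n)) u)) atTop (𝓝 (F (gx M (x, q) u))) :=
    fun u => ((hF.continuous.comp ((gx_continuous M u).comp (continuous_const.prodMk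
      continuous_id))).tendsto q).comp hlim
  have hlim3 : Tendsto (fun n : ℕ => (t - s) - ((t - s) / c + 1) * (1 / ((φ n : ℝ) + 1))) atTop
      (𝓝 ((t - s) - ((t - s) / c + 1) * 0)) :=
    ((tendsto_one_div_add_atTop_nhds_zero_nat.comp hφ.tendsto_atTop).const_mul _).const_sub _
  rw [mul_zero, sub_zero] at hlim3
  exact le_of_tendsto_of_tendsto' hlim3 ((hlim2 t).sub (hlim2 s)) fun n => hlow (φ n)

end FlatTorus

namespace FlatTorus

open scoped NNReal

variable {M : TorusMetric}

/-- The linear functional represented by a covector. -/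
def dotL (p : V) : V →L[ℝ] ℝ :=
  LinearMap.toContinuousLinearMap
    { toFun := dot p
      map_add' := fun v w => dot_add p v w
      map_smul' := fun r v => dot_smul r p v }

@[simp] theorem dotL_apply (p v : V) : dotL p v = dot p v := rfl

theorem dotL_injective : Function.Injective dotL := fun p q hpq => by
  have h1 := DFunLike.congr_fun hpq (1, 0)
  have h2 := DFunLike.congr_fun hpq (0, 1)
  simp [dot] at h1 h2
  exact Prod.ext h1 h2

/-- Calibration functions are differentiable along calibrated orbits, with uniform remainder. -/
theorem exists_calib_taylor (M : TorusMetric) : ∃ C : ℝ, 0 < C ∧ ∀ f x p, IsCalibrated M f x p →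
    ∀ F, Calib M f F → ∀ a, |F (x + a) - F x - dotL p a| ≤ C * ‖a‖ ^ 2 := by
  obtain ⟨C₁, hC₁, h1⟩ := exists_first_variation M one_pos
  obtain ⟨C₂, hC₂, h2⟩ := exists_first_variation_start M one_pos
  refine ⟨C₁ + C₂, by positivity, fun f x p ⟨hp, hcal⟩ F hF a => ?_⟩
  have hz := ham_unit hp
  have e1 := hcal F hF 0 1 zero_le_one
  have e2 := hcal F hF (-1) 0 (by norm_num)
  rw [gx_zero] at e1 e2
  have a1 := h2 (x, p) hz a
  have a2 := h1 (hamFlow M (-1) (x, p)) (ham_flow_unit hz _) a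
  rw [gx_flow, gp_flow, add_neg_cancel, gx_zero, gp_zero] at a2
  have e3 : (hamFlow M (-1) (x, p)).1 = gx M (x, p) (-1) := rfl
  rw [e3] at a2
  have a3 := hF.lip (x + a) (gx M (x, p) 1)
  have a4 := hF.lip (gx M (x, p) (-1)) (x + a)
  have q1 : 0 ≤ C₁ * ‖a‖ ^ 2 := by positivity
  have q2 : 0 ≤ C₂ * ‖a‖ ^ 2 := by positivity
  simp only at *
  rw [dotL_apply, abs_le]
  constructor <;> linarith

theorem IsCalibrated.hasFDerivAt {f x p : V} (hp : IsCalibrated M f x p) {F : V → ℝ}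
    (hF : Calib M f F) : HasFDerivAt F (dotL p) x := by
  obtain ⟨C, -, h⟩ := exists_calib_taylor M
  exact hasFDerivAt_of_quadratic (h f x p hp F hF)

open Classical in
/-- The covector at `x` calibrated by the slope `f`. -/
def theta (M : TorusMetric) (f x : V) : V := if h : ∃ p, IsCalibrated M f x p then h.choose else 0

theorem isCalibrated_theta (h : NoCrossing M) {f : V} (hf : f ∈ dualSphere M) (x : V) :
    IsCalibrated M f x (theta M f x) := by
  have := exists_calibrated h hf x
  rw [theta, dif_pos this]
  exact this.choose_spec

theorem theta_eq_of_hasFDerivAt (h : NoCrossing M) {f : V} (hf : f ∈ dualSphere M) {x p : V}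
    {F : V → ℝ} (hF : Calib M f F) (hd : HasFDerivAt F (dotL p) x) : theta M f x = p :=
  dotL_injective (((isCalibrated_theta h hf x).hasFDerivAt hF).unique hd)

theorem theta_neg (h : NoCrossing M) {f : V} (hf : f ∈ dualSphere M) (x : V) :
    theta M (-f) x = -theta M f x := by
  refine theta_eq_of_hasFDerivAt h (neg_mem_dualSphere hf) (calib_calibFun hf.1).neg ?_
  have := ((isCalibrated_theta h hf x).hasFDerivAt (calib_calibFun hf.1)).neg
  refine this.congr_fderiv ?_
  ext <;> simp [neg_dot]

theorem continuous_dot_left (v : V) : Continuous fun f => dot f v :=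
  continuous_dot.comp (continuous_id.prodMk continuous_const)

theorem theta_tendsto (h : NoCrossing M) {ι : Type*} {l : Filter ι} {f : ι → V} {f₀ : V}
    (hf : ∀ i, f i ∈ dualSphere M) (hf₀ : f₀ ∈ dualSphere M) (hl : Tendsto f l (𝓝 f₀)) (x : V) :
    Tendsto (fun i => theta M (f i) x) l (𝓝 (theta M f₀ x)) := by
  rw [tendsto_iff_ultrafilter]
  intro U hU
  have hfU : Tendsto f U (𝓝 f₀) := hl.mono_left hU
  obtain ⟨p, -, hp⟩ := (isCompact_unit M x).ultrafilter_le_nhds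
    (U.map fun i => theta M (f i) x)
    (by
      rw [le_principal_iff]
      exact Filter.mem_map.2 (Filter.univ_mem' fun i => (isCalibrated_theta h (hf i) x).1))
  have hp : Tendsto (fun i => theta M (f i) x) U (𝓝 p) := hp
  have hlim : ∀ y, ∃ r, Tendsto (fun i => calibFun M (f i) y) U (𝓝 r) := fun y => by
    obtain ⟨r, -, hr⟩ := (isCompact_Icc (a := -M.dist 0 y) (b := M.dist 0 y)).ultrafilter_le_nhds
      (U.map fun i => calibFun M (f i) y)
      (by
        rw [le_principal_iff]
        refine Filter.mem_map.2 (Filter.univ_mem' fun i => ?_)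
        have := (calib_calibFun (hf i).1).abs_le 0 y
        rw [calibFun_zero (hf i).1, sub_zero] at this
        exact _root_.abs_le.1 this)
    exact ⟨r, hr⟩
  choose F hF using hlim
  have hcal : Calib M f₀ F :=
    { lip := fun a b => le_of_tendsto' ((hF b).sub (hF a)) fun i =>
        (calib_calibFun (hf i).1).lip a b
      equi := fun a k => by
        have h1 := hF (a + lat k)
        have h2 := (hF a).add (((continuous_dot_left (lat k)).tendsto f₀).comp hfU)
        refine tendsto_nhds_unique h1 (h2.congr fun i => ?_)
        exact ((calib_calibFun (hf i).1).equi a k).symm }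
  obtain ⟨C, -, hT⟩ := exists_calib_taylor M
  have hder : HasFDerivAt F (dotL p) x := by
    refine hasFDerivAt_of_quadratic (C := C) fun a => ?_
    have h3 : Tendsto (fun i => dotL (theta M (f i) x) a) U (𝓝 (dotL p a)) :=
      ((continuous_dot_left a).tendsto p).comp hp
    refine le_of_tendsto' (((hF (x + a)).sub (hF x)).sub h3).abs fun i => ?_
    exact hT _ _ _ (isCalibrated_theta h (hf i) x) _ (calib_calibFun (hf i).1) a
  rw [theta_eq_of_hasFDerivAt h hf₀ hcal hder]
  exact hp

/-- The gauge of the dual unit ball. -/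
def gaugeN (M : TorusMetric) (u : V) : ℝ := ⨆ k : ℤ × ℤ, dot u (lat k) / stab M k

theorem exists_stab_bound (M : TorusMetric) : ∃ c : ℝ, 0 < c ∧ ∀ k, c * ‖lat k‖ ≤ stab M k := by
  obtain ⟨c, C, hc, hC, hd⟩ := exists_mdist_bounds M
  refine ⟨c, hc, fun k => ?_⟩
  have := (hd 0 (lat k)).1
  rwa [sub_zero] at this

theorem stab_pos {k : ℤ × ℤ} (hk : k ≠ 0) : 0 < stab M k := mdist_pos M (lat_ne_zero hk).symm

theorem stab_zero : stab M 0 = 0 := by rw [stab, lat_zero, mdist_self]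

theorem exists_gauge_bound (M : TorusMetric) : ∃ C : ℝ, 0 < C ∧ ∀ u k,
    dot u (lat k) / stab M k ≤ C * ‖u‖ := by
  obtain ⟨c, hc, h⟩ := exists_stab_bound M
  refine ⟨2 / c, by positivity, fun u k => ?_⟩
  rcases eq_or_ne k 0 with rfl | hk
  · rw [stab_zero, div_zero]; positivity
  · rw [div_le_iff₀ (stab_pos hk)]
    refine (le_abs_self _).trans ((abs_dot_le _ _).trans ?_)
    have h1 := mul_le_mul_of_nonneg_left (h k) (show 0 ≤ 2 / c * ‖u‖ by positivity)
    refine le_trans (le_of_eq ?_) h1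
    field_simp

theorem gauge_bdd (M : TorusMetric) (u : V) : BddAbove (range fun k => dot u (lat k) / stab M k) := by
  obtain ⟨C, -, h⟩ := exists_gauge_bound M
  refine ⟨C * ‖u‖, ?_⟩
  rintro _ ⟨k, rfl⟩
  exact h u k

theorem le_gauge (u : V) (k : ℤ × ℤ) : dot u (lat k) / stab M k ≤ gaugeN M u :=
  le_ciSup (gauge_bdd M u) k

theorem continuous_gauge (M : TorusMetric) : Continuous (gaugeN M) := by
  obtain ⟨C, hC, h⟩ := exists_gauge_bound M
  refine (LipschitzWith.of_le_add_mul C.toNNReal fun u v => ?_).continuous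
  rw [Real.coe_toNNReal _ hC.le, dist_eq_norm]
  refine ciSup_le fun k => ?_
  have h1 := h (u - v) k
  have h2 := le_gauge (M := M) v k
  have : dot u (lat k) / stab M k = dot (u - v) (lat k) / stab M k + dot v (lat k) / stab M k := by
    rw [← add_div]; simp [dot]; ring
  linarith

theorem gauge_neg (u : V) : gaugeN M (-u) = gaugeN M u := by
  rw [gaugeN, ← (Equiv.neg (ℤ × ℤ)).iSup_comp]
  simp only [Equiv.neg_apply, stab_neg, lat_neg, dot_neg, neg_dot, neg_neg, gaugeN]

theorem gauge_pos {u : V} (hu : u ≠ 0) : 0 < gaugeN M u := by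
  have main : ∀ k : ℤ × ℤ, dot u (lat k) ≠ 0 → 0 < gaugeN M u := by
    intro k hk
    have hk0 : k ≠ 0 := by rintro rfl; simp [lat_zero, dot] at hk
    rcases lt_or_gt_of_ne hk with hlt | hlt
    · rw [← gauge_neg]
      refine lt_of_lt_of_le (div_pos ?_ (stab_pos hk0)) (le_gauge (-u) k)
      rw [neg_dot]; linarith
    · exact lt_of_lt_of_le (div_pos hlt (stab_pos hk0)) (le_gauge u k)
  by_contra hcon
  have h1 : dot u (lat (1, 0)) = 0 := by by_contra hne; exact hcon (main _ hne)
  have h2 : dot u (lat (0, 1)) = 0 := by by_contra hne; exact hcon (main _ hne)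
  simp [dot, lat] at h1 h2
  exact hu (Prod.ext h1 h2)

theorem normalize_mem_dualSphere {u : V} (hu : u ≠ 0) : (gaugeN M u)⁻¹ • u ∈ dualSphere M := by
  have hN := gauge_pos (M := M) hu
  refine ⟨fun k => ?_, fun r hr => ?_⟩
  · rcases eq_or_ne k 0 with rfl | hk
    · simp [lat_zero, dot, stab_zero]
    · rw [smul_dot, inv_mul_le_iff₀ hN, ← div_le_iff₀ (stab_pos hk)]
      exact le_gauge u k
  · have : gaugeN M u / r < gaugeN M u := div_lt_self hN hr
    obtain ⟨k, hk⟩ := exists_lt_of_lt_ciSup this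
    have hk0 : k ≠ 0 := by
      rintro rfl
      rw [stab_zero, div_zero] at hk
      exact absurd hk (not_lt.2 (div_pos hN (by linarith)).le)
    refine ⟨k, ?_⟩
    rw [lt_div_iff₀ (stab_pos hk0)] at hk
    rw [smul_dot]
    have hr0 : 0 < r := by linarith
    calc stab M k = r / gaugeN M u * (gaugeN M u / r * stab M k) := by field_simp
      _ < r / gaugeN M u * dot u (lat k) := by gcongr
      _ = r * ((gaugeN M u)⁻¹ * dot u (lat k)) := by field_simp

/-- Every unit speed solution is calibrated. -/
theorem exists_slope (h : NoCrossing M) {x q : V} (hq : bf M x q q = 1) :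
    ∃ f ∈ dualSphere M, IsCalibrated M f x q := by
  set u : ℝ → V := fun θ => (Real.cos θ, Real.sin θ) with hu
  have hu0 : ∀ θ, u θ ≠ 0 := fun θ h0 => by
    have h1 := congrArg Prod.fst h0
    have h2 := congrArg Prod.snd h0
    have h3 := Real.sin_sq_add_cos_sq θ
    simp only [hu, Prod.fst_zero, Prod.snd_zero] at h1 h2
    rw [h1, h2] at h3
    norm_num at h3
  have huc : Continuous u := Real.continuous_cos.prodMk Real.continuous_sin
  set f : ℝ → V := fun θ => (gaugeN M (u θ))⁻¹ • u θ with hf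
  have hfS : ∀ θ, f θ ∈ dualSphere M := fun θ => normalize_mem_dualSphere (hu0 θ)
  have hfc : Continuous f := (((continuous_gauge M).comp huc).inv₀ fun θ =>
    (gauge_pos (hu0 θ)).ne').smul huc
  have hθ : Continuous fun θ => theta M (f θ) x := continuous_iff_continuousAt.2 fun θ =>
    theta_tendsto h hfS (hfS θ) (hfc.tendsto θ) x
  set ψ : ℝ → ℝ := fun θ => crossDet (sharp M x q) (sharp M x (theta M (f θ) x)) with hψ
  have hψc : Continuous ψ := by
    have : Continuous fun θ => sharp M x (theta M (f θ) x) :=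
      (continuous_sharp M).comp (continuous_const.prodMk hθ)
    simp only [hψ, crossDet]
    fun_prop
  have hfπ : f Real.pi = -f 0 := by
    have : u Real.pi = -u 0 := by ext <;> simp [hu]
    simp only [hf, this, gauge_neg, smul_neg]
  have hψπ : ψ Real.pi = -ψ 0 := by
    simp only [hψ, hfπ, theta_neg h (hfS 0), sharp_neg, crossDet, Prod.fst_neg, Prod.snd_neg]
    ring
  obtain ⟨θ, -, hz⟩ : ∃ θ ∈ Icc 0 Real.pi, ψ θ = 0 := by
    rcases le_total (ψ 0) 0 with h0 | h0
    · exact intermediate_value_Icc Real.pi_pos.le hψc.continuousOn ⟨h0, by rw [hψπ]; linarith⟩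
    · exact intermediate_value_Icc' Real.pi_pos.le hψc.continuousOn ⟨by rw [hψπ]; linarith, h0⟩
  have hcal := isCalibrated_theta h (hfS θ) x
  have hg := bf_gram (M := M) x q (theta M (f θ) x)
  rw [show crossDet (sharp M x q) (sharp M x (theta M (f θ) x)) = 0 from hz, hcal.1, hq] at hg
  have hsq : bf M x q (theta M (f θ) x) * bf M x q (theta M (f θ) x) = 1 := by linarith
  rcases mul_self_eq_one_iff.1 hsq with h1 | h1
  · rw [eq_of_unit_of_one_le hq hcal.1 h1.ge]
    exact ⟨_, hfS θ, hcal⟩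
  · have : q = theta M (-f θ) x := by
      rw [theta_neg h (hfS θ)]
      exact eq_of_unit_of_one_le hq (by rw [bf_neg_neg, hcal.1]) (by rw [bf_neg_right, h1, neg_neg])
    rw [this]
    exact ⟨_, neg_mem_dualSphere (hfS θ), isCalibrated_theta h (neg_mem_dualSphere (hfS θ)) x⟩

theorem exists_linear_progress (h : NoCrossing M) : ∃ C : ℝ, 0 < C ∧ ∀ z, ham M z = 1 / 2 →
    ∃ f ∈ dualSphere M, ∀ t, 0 ≤ t → t - C ≤ dot f (gx M z t - z.1) := by
  obtain ⟨C, hC, hA⟩ := exists_calib_approx M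
  refine ⟨2 * C, by positivity, fun z hz => ?_⟩
  obtain ⟨f, hf, hcal⟩ := exists_slope h (unit_of_ham hz)
  have hF := calib_calibFun hf.1
  refine ⟨f, hf, fun t ht => ?_⟩
  have e := hcal.2 _ hF 0 t ht
  rw [gx_zero] at e
  have h1 := _root_.abs_le.1 (hA f hf.1 _ hF (gx M z t))
  have h2 := _root_.abs_le.1 (hA f hf.1 _ hF z.1)
  rw [show dot f (gx M z t - z.1) = dot f (gx M z t) - dot f z.1 by simp [dot]; ring]
  have e' : calibFun M f (gx M z t) - calibFun M f z.1 = t - 0 := e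
  linarith [h1.1, h1.2, h2.1, h2.2]

end FlatTorus

namespace FlatTorus

open scoped NNReal
open MeasureTheory

variable {M : TorusMetric}

/-! ### Invariance of the Liouville measure -/

def phaseEquiv : (V × V) ≃ₗ[ℝ] (Fin 4 → ℝ) where
  toFun z := ![z.1.1, z.1.2, z.2.1, z.2.2]
  invFun v := ((v 0, v 1), (v 2, v 3))
  left_inv z := by simp
  right_inv v := by ext i; fin_cases i <;> simp
  map_add' z w := by ext i; fin_cases i <;> simp
  map_smul' r z := by ext i; fin_cases i <;> simp

theorem det_eq_matrix (L : (V × V) →L[ℝ] (V × V)) :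
    L.det = !![(L ((1, 0), 0)).1.1, (L ((0, 1), 0)).1.1, (L (0, (1, 0))).1.1, (L (0, (0, 1))).1.1;
      (L ((1, 0), 0)).1.2, (L ((0, 1), 0)).1.2, (L (0, (1, 0))).1.2, (L (0, (0, 1))).1.2;
      (L ((1, 0), 0)).2.1, (L ((0, 1), 0)).2.1, (L (0, (1, 0))).2.1, (L (0, (0, 1))).2.1;
      (L ((1, 0), 0)).2.2, (L ((0, 1), 0)).2.2, (L (0, (1, 0))).2.2, (L (0, (0, 1))).2.2].det := by
  have e1 : phaseEquiv.symm (Pi.single 0 1) = ((1, 0), 0) := by ext <;> simp [phaseEquiv]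
  have e2 : phaseEquiv.symm (Pi.single 1 1) = ((0, 1), 0) := by ext <;> simp [phaseEquiv]
  have e3 : phaseEquiv.symm (Pi.single 2 1) = (0, (1, 0)) := by ext <;> simp [phaseEquiv]
  have e4 : phaseEquiv.symm (Pi.single 3 1) = (0, (0, 1)) := by ext <;> simp [phaseEquiv]
  rw [ContinuousLinearMap.det, ← LinearMap.det_toMatrix (Module.Basis.ofEquivFun phaseEquiv)]
  congr 1
  ext i j
  rw [LinearMap.toMatrix_apply, Module.Basis.coe_ofEquivFun, Module.Basis.ofEquivFun_repr_apply]
  fin_cases j <;>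
    simp only [Fin.zero_eta, Fin.mk_one, Fin.reduceFinMk, e1, e2, e3, e4] <;>
    fin_cases i <;> rfl

theorem det_one_add_hamiltonian (h : ℝ) {L : (V × V) →L[ℝ] (V × V)}
    {a₁ a₂ a₃ a₄ b₁ b₂ b₃ c₁ c₂ c₃ : ℝ}
    (h1 : L ((1, 0), 0) = ((a₁, a₃), (-c₁, -c₂))) (h2 : L ((0, 1), 0) = ((a₂, a₄), (-c₂, -c₃)))
    (h3 : L (0, (1, 0)) = ((b₁, b₂), (-a₁, -a₂))) (h4 : L (0, (0, 1)) = ((b₂, b₃), (-a₃, -a₄))) :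
    ((1 : (V × V) →L[ℝ] (V × V)) + h • L).det = 1 - h ^ 2 * (a₁ ^ 2 + 2 * a₂ * a₃ + a₄ ^ 2
      - b₁ * c₁ - 2 * b₂ * c₂ - b₃ * c₃) + h ^ 4 * L.det := by
  rw [det_eq_matrix, det_eq_matrix]
  simp [Matrix.det_succ_row_zero, Fin.sum_univ_succ, Fin.succAbove, h1, h2, h3, h4]
  ring

theorem det_bound_aux {h D k a₁ a₂ a₃ a₄ b₁ b₂ b₃ c₁ c₂ c₃ d : ℝ} (hh : |h| ≤ 1)
    (m1 : |a₁ * a₁| ≤ k) (m2 : |a₂ * a₃| ≤ k) (m3 : |a₄ * a₄| ≤ k) (m4 : |b₁ * c₁| ≤ k)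
    (m5 : |b₂ * c₂| ≤ k) (m6 : |b₃ * c₃| ≤ k) (hd : |d| ≤ D) :
    1 - (8 * k + D) * h ^ 2 ≤ 1 - h ^ 2 * (a₁ ^ 2 + 2 * a₂ * a₃ + a₄ ^ 2
      - b₁ * c₁ - 2 * b₂ * c₂ - b₃ * c₃) + h ^ 4 * d := by
  rw [_root_.abs_le] at m1 m2 m3 m4 m5 m6 hd
  have h2 : h ^ 2 ≤ 1 := by rw [← sq_abs]; nlinarith [abs_nonneg h]
  have h4 : -(h ^ 2 * D) ≤ h ^ 4 * d := by
    have h5 : h ^ 4 * D ≤ h ^ 2 * D :=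
      mul_le_mul_of_nonneg_right (by nlinarith [sq_nonneg h]) (by linarith)
    have h6 := mul_le_mul_of_nonneg_left hd.1 (show 0 ≤ h ^ 4 by positivity)
    linarith
  have h7 : a₁ ^ 2 + 2 * a₂ * a₃ + a₄ ^ 2 - b₁ * c₁ - 2 * b₂ * c₂ - b₃ * c₃ ≤ 8 * k := by
    linarith [m1.2, m2.2, m3.2, m4.1, m5.1, m6.1]
  have h8 := mul_le_mul_of_nonneg_left h7 (sq_nonneg h)
  linarith

theorem exists_det_bound (M : TorusMetric) : ∃ C : ℝ, 0 ≤ C ∧ ∀ h, |h| ≤ 1 → ∀ z,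
    1 - C * h ^ 2 ≤ |((1 : (V × V) →L[ℝ] (V × V)) + h • fderiv ℝ (hamField M) z).det| := by
  obtain ⟨L, K, L₂, K₂, -, -, -, -, hK⟩ := hamField_bounds M
  have hD : ContDiff ℝ (⊤ : ℕ∞) (fderiv ℝ (hamCut M)) := (contDiff_hamCut M).fderiv_right (by simp)
  obtain ⟨D, hDb⟩ := (isCompact_closedBall (0 : (V × V) →L[ℝ] (V × V)) K).exists_bound_of_continuousOn
    ContinuousLinearMap.continuous_det.continuousOn
  have hD0 : 0 ≤ D := (norm_nonneg _).trans (hDb 0 (by simp))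
  refine ⟨8 * K ^ 2 + D, by positivity, fun h hh z => ?_⟩
  set B : V × V → V × V → ℝ := fun u v => fderiv ℝ (fderiv ℝ (hamCut M)) z u v with hB
  have hsymm : ∀ u v, B u v = B v u := fun u v =>
    second_derivative_symmetric (f := hamCut M) (f' := fderiv ℝ (hamCut M)) (x := z)
      (fun y => ((contDiff_hamCut M).differentiable (by simp) y).hasFDerivAt)
      ((hD.differentiable (by simp) z).hasFDerivAt) u v
  have hY : ∀ u, fderiv ℝ (hamField M) z u =
      ((B u (0, (1, 0)), B u (0, (0, 1))), (-B u ((1, 0), 0), -B u ((0, 1), 0))) := by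
    intro u
    have h1 : ∀ v, HasFDerivAt (fun z => fderiv ℝ (hamCut M) z v)
        ((fderiv ℝ (fderiv ℝ (hamCut M)) z).flip v) z := fun v => by
      have := (hD.differentiable (by simp) z).hasFDerivAt.clm_apply (hasFDerivAt_const v z)
      exact this.congr_fderiv (by simp)
    have : HasFDerivAt (hamField M) _ z :=
      ((h1 (0, (1, 0))).prodMk (h1 (0, (0, 1)))).prodMk
        ((h1 ((1, 0), 0)).neg.prodMk (h1 ((0, 1), 0)).neg)
    rw [this.fderiv]
    rfl
  have hb : ∀ u, ‖u‖ ≤ 1 → ‖fderiv ℝ (hamField M) z u‖ ≤ K := fun u hu =>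
    ((fderiv ℝ (hamField M) z).le_opNorm u).trans (by
      have := hK z
      nlinarith [norm_nonneg (fderiv ℝ (hamField M) z), norm_nonneg u])
  have hdet := det_one_add_hamiltonian h (L := fderiv ℝ (hamField M) z)
    (a₁ := B ((1, 0), 0) (0, (1, 0))) (a₃ := B ((1, 0), 0) (0, (0, 1)))
    (a₂ := B ((0, 1), 0) (0, (1, 0))) (a₄ := B ((0, 1), 0) (0, (0, 1)))
    (b₁ := B (0, (1, 0)) (0, (1, 0))) (b₂ := B (0, (1, 0)) (0, (0, 1)))
    (b₃ := B (0, (0, 1)) (0, (0, 1))) (c₁ := B ((1, 0), 0) ((1, 0), 0))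
    (c₂ := B ((1, 0), 0) ((0, 1), 0)) (c₃ := B ((0, 1), 0) ((0, 1), 0))
    (hY _) (by rw [hY, hsymm ((0, 1), 0) ((1, 0), 0)])
    (by rw [hY, hsymm _ ((1, 0), 0), hsymm _ ((0, 1), 0)])
    (by rw [hY, hsymm _ ((1, 0), 0), hsymm _ ((0, 1), 0), hsymm (0, (0, 1)) (0, (1, 0))])
  rw [hdet]
  have k1 := hb ((1, 0), 0) (by simp [Prod.norm_def])
  have k2 := hb ((0, 1), 0) (by simp [Prod.norm_def])
  have k3 := hb (0, (1, 0)) (by simp [Prod.norm_def])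
  have k4 := hb (0, (0, 1)) (by simp [Prod.norm_def])
  rw [hY] at k1 k2 k3 k4
  simp only [Prod.norm_def, sup_le_iff, norm_neg] at k1 k2 k3 k4
  have hmul : ∀ {a b : ℝ}, ‖a‖ ≤ K → ‖b‖ ≤ K → |a * b| ≤ K ^ 2 := fun {a b} ha hb => by
    rw [abs_mul, sq]
    exact mul_le_mul ha hb (abs_nonneg _) K.2
  have m1 := hmul k1.1.1 k1.1.1
  have m2 := hmul k2.1.1 k1.1.2
  have m3 := hmul k2.1.2 k2.1.2
  have m4 := hmul k3.1.1 k1.2.1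
  have m5 := hmul k3.1.2 k1.2.2
  have m6 := hmul k4.1.2 k2.2.2
  have hdb : |(fderiv ℝ (hamField M) z).det| ≤ D := hDb _ (by simpa using hK z)
  exact (det_bound_aux hh m1 m2 m3 m4 m5 m6 hdb).trans (le_abs_self _)

instance : (volume : Measure V).IsAddHaarMeasure :=
  inferInstanceAs ((volume : Measure ℝ).prod (volume : Measure ℝ)).IsAddHaarMeasure

instance : (volume : Measure (V × V)).IsAddHaarMeasure :=
  inferInstanceAs ((volume : Measure V).prod (volume : Measure V)).IsAddHaarMeasure

theorem lintegral_euler_le (M : TorusMetric) : ∃ C : ℝ, 0 ≤ C ∧ ∃ δ > 0, ∀ h, |h| ≤ δ →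
    ∀ G : V × V → ℝ≥0∞, ENNReal.ofReal (1 - C * h ^ 2) *
      ∫⁻ z, G (z + h • hamField M z) ≤ ∫⁻ z, G z := by
  obtain ⟨C, hC, hdet⟩ := exists_det_bound M
  obtain ⟨L, K, L₂, K₂, -, hK, -⟩ := hamField_bounds M
  refine ⟨C, hC, 1 / (K + 1), by positivity, fun h hh G => ?_⟩
  have hhK : |h| * (K + 1) ≤ 1 := (le_div_iff₀ (by positivity)).1 hh
  have hK0 : (0 : ℝ) ≤ K := K.2
  have hinj : Function.Injective fun z => z + h • hamField M z := by
    intro z w e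
    simp only at e
    have h1 : z - w = h • (hamField M w - hamField M z) := by
      rw [smul_sub, sub_eq_sub_iff_add_eq_add, e, add_comm]
    have h2 : ‖z - w‖ ≤ |h| * (K * ‖z - w‖) := by
      conv_lhs => rw [h1, norm_smul, Real.norm_eq_abs]
      gcongr
      rw [norm_sub_rev]
      exact hK.norm_sub_le z w
    by_contra hne
    have hpos : 0 < ‖z - w‖ := norm_pos_iff.2 (sub_ne_zero.2 hne)
    rcases (abs_nonneg h).eq_or_lt with h0 | h0
    · rw [← h0] at h2; linarith
    · nlinarith [mul_pos h0 hpos]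
  have hd : ∀ z ∈ univ, HasFDerivWithinAt (fun z => z + h • hamField M z)
      ((1 : (V × V) →L[ℝ] (V × V)) + h • fderiv ℝ (hamField M) z) univ z := fun z _ =>
    ((hasFDerivAt_id z).add
      (((contDiff_hamField M).differentiable (by simp) z).hasFDerivAt.const_smul h)).hasFDerivWithinAt
  have key := lintegral_image_eq_lintegral_abs_det_fderiv_mul (volume : Measure (V × V))
    MeasurableSet.univ hd hinj.injOn G
  rw [← lintegral_const_mul' _ _ ENNReal.ofReal_ne_top]
  calc ∫⁻ z, ENNReal.ofReal (1 - C * h ^ 2) * G (z + h • hamField M z)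
      ≤ ∫⁻ z, ENNReal.ofReal |((1 : (V × V) →L[ℝ] (V × V)) + h • fderiv ℝ (hamField M) z).det| *
          G (z + h • hamField M z) := by
        refine lintegral_mono fun z => ?_
        gcongr
        refine hdet h (hh.trans ?_) z
        rw [div_le_one (by positivity)]; linarith
    _ ≤ ∫⁻ z, G z := by
        rw [← setLIntegral_univ, ← key]
        exact setLIntegral_le_lintegral _ _

end FlatTorus

namespace FlatTorus

open scoped NNReal
open MeasureTheory

variable {M : TorusMetric}

theorem continuous_hamFlow (M : TorusMetric) (s : ℝ) : Continuous (hamFlow M s) :=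
  (hamFlow_continuous M).comp (continuous_const.prodMk continuous_id : Continuous fun z => (s, z))

theorem euler_tendsto (M : TorusMetric) (s : ℝ) (z : V × V) :
    Tendsto (fun n : ℕ => (fun w => w + (s / n) • hamField M w)^[n] z) atTop
      (𝓝 (hamFlow M s z)) := by
  obtain ⟨L, K, L₂, K₂, hL, hK, hL₂, hK₂, -⟩ := hamField_bounds M
  have hZ : ∀ z t, HasDerivAt (fun s => hamField M (hamFlow M s z))
      (hamAccel M (hamFlow M t z)) t := fun z t =>
    (((contDiff_hamField M).differentiable (by simp) _).hasFDerivAt).comp_hasDerivAt t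
      (hamFlow_hasDerivAt M z t)
  have step : ∀ (h : ℝ) (j : ℕ), ‖hamFlow M (j * h) z - (fun w => w + h • hamField M w)^[j] z‖ ≤
      j * (L₂ * h ^ 2) * Real.exp (K * |h|) ^ j := by
    intro h j
    induction j with
    | zero => simp [hamFlow_zero]
    | succ j ih =>
      rw [Function.iterate_succ_apply']
      set w := (fun w => w + h • hamField M w)^[j] z with hw
      rw [show ((j + 1 : ℕ) : ℝ) * h = h + j * h by push_cast; ring, hamFlow_add]
      have h1 := flow_dist_le hK (hamFlow_zero M) (hamFlow_hasDerivAt M) h (hamFlow M (j * h) z) w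
      have h2 := flow_taylor (hamFlow_zero M) (hamFlow_hasDerivAt M) hZ hL₂ h w
      rw [dist_eq_norm, dist_eq_norm] at h1
      have he : 1 ≤ Real.exp (K * |h|) := Real.one_le_exp (by positivity)
      have h3 : ‖hamFlow M h (hamFlow M (j * h) z) - (w + h • hamField M w)‖ ≤
          ‖hamFlow M (j * h) z - w‖ * Real.exp (K * |h|) + L₂ * h ^ 2 := by
        have : hamFlow M h (hamFlow M (j * h) z) - (w + h • hamField M w) =
          (hamFlow M h (hamFlow M (j * h) z) - hamFlow M h w) +
            (hamFlow M h w - w - h • hamField M w) := by abel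
        rw [this]
        exact (norm_add_le _ _).trans (add_le_add h1 h2)
      have h4 := mul_le_mul_of_nonneg_right ih (zero_le_one.trans he)
      have h5 : (L₂ : ℝ) * h ^ 2 ≤ L₂ * h ^ 2 * Real.exp (K * |h|) ^ (j + 1) :=
        le_mul_of_one_le_right (by positivity) (one_le_pow₀ he)
      refine h3.trans ((add_le_add h4 h5).trans (le_of_eq ?_))
      push_cast
      ring
  rw [tendsto_iff_norm_sub_tendsto_zero]
  have hlim : Tendsto (fun n : ℕ => L₂ * s ^ 2 * Real.exp (K * |s|) / (n : ℝ)) atTop (𝓝 0) :=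
    tendsto_const_div_atTop_nhds_zero_nat _
  refine squeeze_zero' (Eventually.of_forall fun _ => norm_nonneg _) ?_ hlim
  filter_upwards [eventually_gt_atTop 0] with n hn
  have hn' : (0 : ℝ) < n := by exact_mod_cast hn
  have := step (s / n) n
  rw [mul_div_cancel₀ s hn'.ne'] at this
  rw [norm_sub_rev]
  refine this.trans (le_of_eq ?_)
  rw [← Real.exp_nat_mul, abs_div, abs_of_pos hn']
  rw [show (n : ℝ) * (K * (|s| / n)) = K * |s| by field_simp]
  field_simp

theorem lintegral_euler_iterate_le (M : TorusMetric) (s : ℝ) : ∃ C : ℝ, 0 ≤ C ∧ ∀ᶠ n : ℕ in atTop,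
    ∀ G : V × V → ℝ≥0∞, ENNReal.ofReal (1 - C / n) *
      ∫⁻ z, G ((fun w => w + (s / n) • hamField M w)^[n] z) ≤ ∫⁻ z, G z := by
  obtain ⟨C, hC, δ, hδ, hE⟩ := lintegral_euler_le M
  refine ⟨C * s ^ 2, by positivity, ?_⟩
  have h1 : ∀ᶠ n : ℕ in atTop, |s / n| ≤ δ := by
    have := (tendsto_const_div_atTop_nhds_zero_nat s).abs
    rw [abs_zero] at this
    exact this.eventually_le_const hδ
  have h2 : ∀ᶠ n : ℕ in atTop, C * s ^ 2 / n ≤ 1 :=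
    (tendsto_const_div_atTop_nhds_zero_nat _).eventually_le_const one_pos
  filter_upwards [h1, h2, eventually_gt_atTop 0] with n hn1 hn2 hn G
  have hn' : (1 : ℝ) ≤ n := by exact_mod_cast hn
  set r : ℝ := 1 - C * (s / n) ^ 2 with hr
  have hr2 : C * (s / n) ^ 2 ≤ 1 := by
    refine le_trans ?_ hn2
    rw [div_pow, mul_div_assoc]
    gcongr
    nlinarith
  have iter : ∀ j : ℕ, ENNReal.ofReal r ^ j *
      ∫⁻ z, G ((fun w => w + (s / n) • hamField M w)^[j] z) ≤ ∫⁻ z, G z := by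
    intro j
    induction j with
    | zero => simp
    | succ j ih =>
      refine le_trans ?_ ih
      rw [pow_succ, mul_assoc]
      gcongr
      exact hE (s / n) hn1 fun w => G ((fun w => w + (s / n) • hamField M w)^[j] w)
  refine le_trans ?_ (iter n)
  gcongr
  rw [← ENNReal.ofReal_pow (by linarith)]
  refine ENNReal.ofReal_le_ofReal ?_
  have := one_add_mul_le_pow (a := -(C * (s / n) ^ 2)) (by linarith) n
  rw [show 1 + -(C * (s / n) ^ 2) = r by ring] at this
  refine le_trans (le_of_eq ?_) this
  field_simp
  ring

theorem volume_preimage_hamFlow_le (M : TorusMetric) (s : ℝ) {U : Set (V × V)} (hU : IsOpen U) :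
    volume (hamFlow M s ⁻¹' U) ≤ volume U := by
  obtain ⟨C, hC, hE⟩ := lintegral_euler_iterate_le M s
  set e : ℕ → V × V → V × V := fun n => (fun w => w + (s / n) • hamField M w)^[n] with he
  have hec : ∀ n, Continuous (e n) := fun n =>
    (continuous_id'.add ((contDiff_hamField M).continuous.const_smul (s / n))).iterate n
  set G : V × V → ℝ≥0∞ := U.indicator 1 with hG
  have hGm : Measurable G := measurable_one.indicator hU.measurableSet
  have hpt : ∀ z, (hamFlow M s ⁻¹' U).indicator 1 z ≤ liminf (fun n => G (e n z)) atTop := by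
    intro z
    by_cases hz : hamFlow M s z ∈ U
    · rw [indicator_of_mem (by exact hz)]
      refine le_liminf_of_le (by isBoundedDefault) ?_
      filter_upwards [(euler_tendsto M s z).eventually (hU.mem_nhds hz)] with n hn
      rw [hG, indicator_of_mem (by exact hn)]
      exact le_rfl
    · rw [indicator_of_notMem (by exact hz)]; exact zero_le
  have hc := continuous_hamFlow M s
  have hlim : Tendsto (fun n : ℕ => (ENNReal.ofReal (1 - C / n))⁻¹ * volume U) atTop
      (𝓝 (volume U)) := by
    have h1 : Tendsto (fun n : ℕ => ENNReal.ofReal (1 - C / n)) atTop (𝓝 1) := by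
      have := (tendsto_const_div_atTop_nhds_zero_nat C).const_sub 1
      rw [sub_zero] at this
      simpa using ENNReal.tendsto_ofReal this
    have h2 := ENNReal.Tendsto.mul_const (b := volume U) h1.inv (Or.inl (by simp))
    simpa using h2
  calc volume (hamFlow M s ⁻¹' U)
      = ∫⁻ z, (hamFlow M s ⁻¹' U).indicator 1 z :=
        (lintegral_indicator_one (hU.preimage hc).measurableSet).symm
    _ ≤ ∫⁻ z, liminf (fun n => G (e n z)) atTop := lintegral_mono hpt
    _ ≤ liminf (fun n => ∫⁻ z, G (e n z)) atTop :=
        lintegral_liminf_le fun n => hGm.comp (hec n).measurable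
    _ ≤ liminf (fun n : ℕ => (ENNReal.ofReal (1 - C / n))⁻¹ * volume U) atTop := by
        refine liminf_le_liminf ?_
        have h2 : ∀ᶠ n : ℕ in atTop, C / n < 1 :=
          (tendsto_const_div_atTop_nhds_zero_nat _).eventually_lt_const one_pos
        filter_upwards [hE, h2] with n hn hn2
        have := hn G
        rw [hG, lintegral_indicator_one hU.measurableSet] at this
        rw [mul_comm, ← div_eq_mul_inv, ENNReal.le_div_iff_mul_le (Or.inl (by simp; linarith))
          (Or.inl (by simp)), mul_comm]
        exact this
    _ = volume U := hlim.liminf_eq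

theorem measurePreserving_hamFlow (M : TorusMetric) (s : ℝ) :
    MeasurePreserving (hamFlow M s) (volume : Measure (V × V)) volume := by
  have hc := continuous_hamFlow M
  have hle : ∀ (s : ℝ) (A : Set (V × V)), volume (hamFlow M s ⁻¹' A) ≤ volume A := by
    intro s A
    rw [A.measure_eq_iInf_isOpen]
    refine le_iInf₂ fun U hAU => le_iInf fun hU => ?_
    exact (measure_mono (preimage_mono hAU)).trans (volume_preimage_hamFlow_le M s hU)
  refine ⟨(hc s).measurable, Measure.ext fun A hA => ?_⟩
  rw [Measure.map_apply (hc s).measurable hA]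
  refine le_antisymm (hle s A) ?_
  have h1 := hle (-s) (hamFlow M s ⁻¹' A)
  rw [← preimage_comp] at h1
  have : hamFlow M s ∘ hamFlow M (-s) = id := by
    funext z
    have := hamFlow_neg_cancel M (-s) z
    rwa [neg_neg] at this
  rwa [this, preimage_id] at h1

end FlatTorus

namespace FlatTorus

open scoped NNReal
open MeasureTheory

variable {M : TorusMetric}

/-! ### The invariant measure on the unit disc bundle of the torus -/

def latHom : (ℤ × ℤ) →+ V × V where
  toFun k := (lat k, 0)
  map_zero' := by simp [lat]
  map_add' j k := by simp [lat_add]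

def latGroup : AddSubgroup (V × V) := latHom.range

instance : Countable latGroup := by
  have : Function.Surjective latHom.rangeRestrict := latHom.rangeRestrict_surjective
  exact this.countable

def cell : Set (V × V) := (Ico (0 : ℝ) 1 ×ˢ Ico (0 : ℝ) 1) ×ˢ univ

theorem measurableSet_cell : MeasurableSet cell :=
  (measurableSet_Ico.prod measurableSet_Ico).prod MeasurableSet.univ

theorem existsUnique_cell (z : V × V) : ∃! g : latGroup, g +ᵥ z ∈ cell := by
  refine ⟨⟨(lat (-⌊z.1.1⌋, -⌊z.1.2⌋), 0), ⟨_, rfl⟩⟩, ?_, ?_⟩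
  · refine ⟨⟨⟨?_, ?_⟩, ?_, ?_⟩, trivial⟩ <;>
      simp [AddSubgroup.vadd_def, lat, neg_add_eq_sub, Int.fract_lt_one]
  · rintro ⟨g, ⟨k, rfl⟩⟩ ⟨⟨⟨h1, h2⟩, h3, h4⟩, -⟩
    have h1' : (0 : ℝ) ≤ k.1 + z.1.1 := h1
    have h2' : (k.1 : ℝ) + z.1.1 < 1 := h2
    have h3' : (0 : ℝ) ≤ k.2 + z.1.2 := h3
    have h4' : (k.2 : ℝ) + z.1.2 < 1 := h4
    have e1 : ⌊z.1.1⌋ = -k.1 := by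
      rw [Int.floor_eq_iff]; push_cast; constructor <;> linarith
    have e2 : ⌊z.1.2⌋ = -k.2 := by
      rw [Int.floor_eq_iff]; push_cast; constructor <;> linarith
    apply Subtype.ext
    simp [e1, e2, latHom]

theorem isAddFundamentalDomain_preimage {Ψ : V × V → V × V} (hc : Continuous Ψ)
    (hp : ∀ k z, Ψ (z + (lat k, 0)) = Ψ z + (lat k, 0)) :
    IsAddFundamentalDomain latGroup (Ψ ⁻¹' cell) (volume : Measure (V × V)) := by
  refine IsAddFundamentalDomain.mk' (hc.measurable measurableSet_cell).nullMeasurableSet fun z => ?_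
  have : ∀ g : latGroup, g +ᵥ z ∈ Ψ ⁻¹' cell ↔ g +ᵥ Ψ z ∈ cell := by
    rintro ⟨g, ⟨k, rfl⟩⟩
    have e : Ψ ((lat k, 0) + z) = (lat k, 0) + Ψ z := by rw [add_comm, hp, add_comm]
    simp only [AddSubgroup.vadd_def, mem_preimage, vadd_eq_add]
    exact iff_of_eq (congrArg (· ∈ cell) e)
  simp only [this]
  exact existsUnique_cell (Ψ z)

def discBundle (M : TorusMetric) : Set (V × V) := {z | ham M z ≤ 1 / 2}

theorem measurableSet_discBundle (M : TorusMetric) : MeasurableSet (discBundle M) :=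
  (isClosed_le (contDiff_ham M).continuous continuous_const).measurableSet

/-- Liouville measure on the unit disc bundle of the torus. -/
def liouville (M : TorusMetric) : Measure (V × V) := volume.restrict (cell ∩ discBundle M)

theorem integral_liouville (M : TorusMetric) (f : V × V → ℝ) :
    ∫ z, f z ∂(liouville M) = ∫ z in cell, (discBundle M).indicator f z := by
  rw [liouville, setIntegral_indicator (measurableSet_discBundle M)]

theorem measurableEmbedding_hamFlow (M : TorusMetric) (s : ℝ) : MeasurableEmbedding (hamFlow M s) := by
  let e : (V × V) ≃ₜ (V × V) :=
    { toFun := hamFlow M s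
      invFun := hamFlow M (-s)
      left_inv := hamFlow_neg_cancel M s
      right_inv := fun z => by simpa using hamFlow_neg_cancel M (-s) z
      continuous_toFun := continuous_hamFlow M s
      continuous_invFun := continuous_hamFlow M (-s) }
  exact e.measurableEmbedding

theorem integral_hamFlow (s : ℝ) {f : V × V → ℝ} (hf : ∀ k z, f (z + (lat k, 0)) = f z) :
    ∫ z, f (hamFlow M s z) ∂(liouville M) = ∫ z, f z ∂(liouville M) := by
  set g := (discBundle M).indicator f with hg
  have hgp : ∀ k z, g (z + (lat k, 0)) = g z := fun k z => by
    simp only [hg, indicator, discBundle, mem_ofPred_eq, ham_per, hf]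
  have hgΦ : (discBundle M).indicator (fun z => f (hamFlow M s z)) = fun z => g (hamFlow M s z) := by
    funext z
    by_cases hz : ham M z ≤ 1 / 2
    · rw [indicator_of_mem (show z ∈ discBundle M from hz), hg, indicator_of_mem
        (show hamFlow M s z ∈ discBundle M from (ham_hamFlow M s z).trans_le hz)]
    · rw [indicator_of_notMem (show z ∉ discBundle M from hz), hg, indicator_of_notMem
        (show hamFlow M s z ∉ discBundle M from fun hn => hz ((ham_hamFlow M s z).symm.trans_le hn))]
  have hinv : ∀ (γ : latGroup) (z : V × V), g (hamFlow M s (γ +ᵥ z)) = g (hamFlow M s z) := by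
    rintro ⟨γ, ⟨k, rfl⟩⟩ z
    have : hamFlow M s ((lat k, 0) + z) = hamFlow M s z + (lat k, 0) := by
      rw [add_comm, hamFlow_per]
    simp only [AddSubgroup.vadd_def, vadd_eq_add]
    exact (congrArg g this).trans (hgp k _)
  rw [integral_liouville, integral_liouville, hgΦ]
  have h1 := (isAddFundamentalDomain_preimage continuous_id fun k z => rfl).setIntegral_eq (f := fun z => g (hamFlow M s z))
    (isAddFundamentalDomain_preimage (continuous_hamFlow M s) fun k z => hamFlow_per M k s z) hinv
  rw [preimage_id] at h1
  rw [h1]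
  exact (measurePreserving_hamFlow M s).setIntegral_preimage_emb (measurableEmbedding_hamFlow M s) g cell

theorem exists_discBundle_bound (M : TorusMetric) : ∃ C : ℝ, ∀ z ∈ discBundle M, ‖z.2‖ ≤ C := by
  obtain ⟨c, C, hc, hC, h⟩ := bf_bounds M
  refine ⟨1 / c + 1, fun z hz => ?_⟩
  have h1 := (h z.1 z.2).1
  have h2 : bf M z.1 z.2 z.2 / 2 ≤ 1 / 2 := hz
  by_contra hn
  push Not at hn
  have h4 : 0 < 1 / c := by positivity
  have h3 : 1 / c < ‖z.2‖ ^ 2 := by nlinarith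
  rw [div_lt_iff₀ hc] at h3
  linarith

instance (M : TorusMetric) : IsFiniteMeasure (liouville M) := by
  obtain ⟨C, hC⟩ := exists_discBundle_bound M
  refine ⟨?_⟩
  rw [liouville, Measure.restrict_apply_univ]
  refine lt_of_le_of_lt (measure_mono (t := Metric.closedBall (0 : V × V) (max 1 C)) ?_)
    (isCompact_closedBall _ _).measure_lt_top
  rintro z ⟨⟨⟨⟨h1, h2⟩, h3, h4⟩, -⟩, h5⟩
  have := hC z h5
  rw [mem_closedBall_zero_iff, Prod.norm_def, Prod.norm_def]
  refine max_le ?_ (this.trans (le_max_right _ _))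
  refine le_trans ?_ (le_max_left 1 C)
  rw [Real.norm_of_nonneg h1, Real.norm_of_nonneg h3]
  exact max_le h2.le h4.le

end FlatTorus

namespace FlatTorus

open scoped NNReal

variable {M : TorusMetric}

/-! ### The extremal ellipse -/

theorem isCompact_convexHull_of_finiteDimensional {E : Type*} [NormedAddCommGroup E]
    [NormedSpace ℝ E] [FiniteDimensional ℝ E] {s : Set E} (hs : IsCompact s) :
    IsCompact (convexHull ℝ s) := by
  classical
  set n := Module.finrank ℝ E + 1
  set Ψ : (Fin n → ℝ) × (Fin n → E) → E := fun q => ∑ i, q.1 i • q.2 i with hΨ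
  have hc : Continuous Ψ := by fun_prop
  have : convexHull ℝ s = Ψ '' (stdSimplex ℝ (Fin n) ×ˢ Set.pi univ fun _ => s) := by
    apply Subset.antisymm
    · intro x hx
      obtain ⟨ι, _, z, w, hz, hind, hw, hw1, hx⟩ := eq_pos_convex_span_of_mem_convexHull hx
      have hcard : Fintype.card ι ≤ Fintype.card (Fin n) := by
        rw [Fintype.card_fin]
        exact hind.card_le_finrank_succ.trans (Nat.succ_le_succ (Submodule.finrank_le _))
      obtain ⟨e⟩ := Function.Embedding.nonempty_of_card_le hcard
      obtain ⟨i₀⟩ : Nonempty ι := by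
        by_contra hne
        rw [not_nonempty_iff] at hne
        simp at hw1
      have hz' : ∀ i, z i ∈ s := fun i => hz ⟨i, rfl⟩
      refine ⟨(Function.extend e w 0, Function.extend e z fun _ => z i₀), ⟨⟨fun j => ?_, ?_⟩, ?_⟩, ?_⟩
      · by_cases hj : ∃ i, e i = j
        · obtain ⟨i, rfl⟩ := hj
          show 0 ≤ Function.extend e w 0 (e i)
          rw [e.injective.extend_apply]
          exact (hw i).le
        · show 0 ≤ Function.extend e w 0 j
          rw [Function.extend_apply' _ _ _ hj]; rfl
      · show ∑ j, Function.extend e w 0 j = 1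
        rw [← hw1]
        refine (Fintype.sum_of_injective e e.injective _ _ (fun j hj => ?_) fun i => ?_).symm
        · rw [Function.extend_apply' _ _ _ (by simpa using hj)]; rfl
        · rw [e.injective.extend_apply]
      · intro j _
        by_cases hj : ∃ i, e i = j
        · obtain ⟨i, rfl⟩ := hj
          simp only [e.injective.extend_apply]
          exact hz' i
        · simp only [Function.extend_apply' _ _ _ hj]
          exact hz' i₀
      · rw [← hx]
        refine (Fintype.sum_of_injective e e.injective _ _ (fun j hj => ?_) fun i => ?_).symm
        · simp only [Function.extend_apply' _ _ _ (show ¬∃ i, e i = j by simpa using hj)]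
          simp
        · simp only [e.injective.extend_apply]
    · rintro _ ⟨⟨w, z⟩, ⟨⟨hw0, hw1⟩, hz⟩, rfl⟩
      exact (convex_convexHull ℝ s).sum_mem (fun i _ => hw0 i) hw1
        fun i _ => subset_convexHull ℝ s (hz i trivial)
  rw [this]
  exact ((isCompact_stdSimplex ℝ _).prod (isCompact_univ_pi fun _ => hs)).image hc

theorem exists_extremal_form {S : Set V} (hS : IsCompact S) {u v : V} (hu : u ∈ S) (hv : v ∈ S)
    (huv : crossDet u v ≠ 0) : ∃ (ι : Type) (_ : Fintype ι) (f : ι → V) (w : ι → ℝ) (a b c : ℝ),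
      (∀ i, f i ∈ S) ∧ (∀ i, 0 ≤ w i) ∧ ∑ i, w i = 1 ∧ a = 2 * ∑ i, w i * (f i).1 ^ 2 ∧
      b = 2 * ∑ i, w i * ((f i).1 * (f i).2) ∧ c = 2 * ∑ i, w i * (f i).2 ^ 2 ∧
      0 < a ∧ 0 < a * c - b ^ 2 ∧
      ∀ f ∈ S, c * f.1 ^ 2 + a * f.2 ^ 2 - 2 * b * (f.1 * f.2) ≤ a * c - b ^ 2 := by
  set φ : V → ℝ × ℝ × ℝ := fun f => (f.1 ^ 2, f.1 * f.2, f.2 ^ 2) with hφ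
  have hK : IsCompact (convexHull ℝ (φ '' S)) :=
    isCompact_convexHull_of_finiteDimensional (hS.image (by fun_prop))
  have hne : (convexHull ℝ (φ '' S)).Nonempty := ⟨φ u, subset_convexHull ℝ _ ⟨u, hu, rfl⟩⟩
  obtain ⟨m, hm, hmax⟩ := hK.exists_isMaxOn hne
    (f := fun m : ℝ × ℝ × ℝ => m.1 * m.2.2 - m.2.1 ^ 2) (by fun_prop)
  have hmax' : ∀ x ∈ convexHull ℝ (φ '' S), x.1 * x.2.2 - x.2.1 ^ 2 ≤ m.1 * m.2.2 - m.2.1 ^ 2 :=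
    fun x hx => hmax hx
  have hconv := convex_convexHull ℝ (φ '' S)
  have hpos : 0 < m.1 * m.2.2 - m.2.1 ^ 2 := by
    have h1 := hmax' _ (hconv (subset_convexHull ℝ _ ⟨u, hu, rfl⟩)
      (subset_convexHull ℝ _ ⟨v, hv, rfl⟩) (show (0 : ℝ) ≤ 1 / 2 by norm_num)
      (show (0 : ℝ) ≤ 1 / 2 by norm_num) (by norm_num))
    refine lt_of_lt_of_le ?_ h1
    simp only [hφ, Prod.fst_add, Prod.snd_add, Prod.smul_fst, Prod.smul_snd, smul_eq_mul]
    have : 0 < (crossDet u v) ^ 2 := by positivity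
    simp only [crossDet] at this
    nlinarith
  obtain ⟨ι, _, z, w, hz, -, hw, hw1, hx⟩ := eq_pos_convex_span_of_mem_convexHull hm
  choose f hfS hf using fun i => hz ⟨i, rfl⟩
  have e1 : m.1 = ∑ i, w i * (f i).1 ^ 2 := by
    rw [← hx, Prod.fst_sum]; refine Finset.sum_congr rfl fun i _ => ?_
    rw [← hf]; rfl
  have e2 : m.2.1 = ∑ i, w i * ((f i).1 * (f i).2) := by
    rw [← hx, Prod.snd_sum, Prod.fst_sum]; refine Finset.sum_congr rfl fun i _ => ?_
    rw [← hf]; rfl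
  have e3 : m.2.2 = ∑ i, w i * (f i).2 ^ 2 := by
    rw [← hx, Prod.snd_sum, Prod.snd_sum]; refine Finset.sum_congr rfl fun i _ => ?_
    rw [← hf]; rfl
  have h1 : 0 ≤ m.1 := by
    rw [e1]; exact Finset.sum_nonneg fun i _ => mul_nonneg (hw i).le (sq_nonneg _)
  have h1' : 0 < m.1 := by
    rcases h1.eq_or_lt with h | h
    · rw [← h] at hpos; nlinarith [sq_nonneg m.2.1]
    · exact h
  refine ⟨ι, ‹_›, f, w, 2 * m.1, 2 * m.2.1, 2 * m.2.2, hfS, fun i => (hw i).le, hw1, by rw [e1],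
    by rw [e2], by rw [e3], by linarith, by nlinarith, fun f hf => ?_⟩
  by_contra hcon
  push Not at hcon
  set p : ℝ := m.2.2 * f.1 ^ 2 + m.1 * f.2 ^ 2 - 2 * m.2.1 * (f.1 * f.2) -
    2 * (m.1 * m.2.2 - m.2.1 ^ 2) with hp
  have hp0 : 0 < p := by nlinarith
  have key : ∀ t ∈ Icc (0 : ℝ) 1, p * t ≤ (p + (m.1 * m.2.2 - m.2.1 ^ 2)) * t ^ 2 := by
    intro t ht
    have h2 := hmax' _ (hconv hm (subset_convexHull ℝ _ ⟨f, hf, rfl⟩)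
      (show (0 : ℝ) ≤ 1 - t by linarith [ht.2]) ht.1 (by ring))
    simp only [hφ, Prod.fst_add, Prod.snd_add, Prod.smul_fst, Prod.smul_snd, smul_eq_mul] at h2
    nlinarith
  set D := m.1 * m.2.2 - m.2.1 ^ 2
  have := key (p / (2 * (p + D))) ⟨by positivity, by rw [div_le_one (by positivity)]; linarith⟩
  have e : (p + D) * (p / (2 * (p + D))) ^ 2 = p / (2 * (p + D)) * p / 2 := by field_simp
  rw [e] at this
  have : 0 < p / (2 * (p + D)) * p := by positivity
  nlinarith

theorem isCompact_dualSphere (M : TorusMetric) : IsCompact (dualSphere M) := by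
  obtain ⟨C, -, hC⟩ := exists_dualBall_bound M
  obtain ⟨c, hc, hs⟩ := exists_stab_bound M
  refine Metric.isCompact_of_isClosed_isBounded ?_
    (isBounded_iff_forall_norm_le.2 ⟨C, fun f hf => hC f hf.1⟩)
  refine isClosed_of_closure_subset fun f hf => ?_
  rw [Metric.mem_closure_iff] at hf
  have hclose : ∀ ε > 0, ∃ g ∈ dualSphere M, ∀ k,
      |dot f (lat k) - dot g (lat k)| ≤ ε * stab M k := by
    intro ε hε
    obtain ⟨g, hg, hd⟩ := hf (ε * c / 2) (by positivity)
    refine ⟨g, hg, fun k => ?_⟩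
    have h1 := abs_dot_le (f - g) (lat k)
    rw [show dot (f - g) (lat k) = dot f (lat k) - dot g (lat k) by simp [dot]; ring] at h1
    rw [dist_eq_norm] at hd
    have h2 := hs k
    have := norm_nonneg (lat k)
    nlinarith
  refine ⟨fun k => ?_, fun r hr => ?_⟩
  · refine le_of_forall_pos_le_add fun ε hε => ?_
    have h0 : 0 ≤ stab M k := le_trans (by positivity) (hs k)
    obtain ⟨g, hg, hd⟩ := hclose (ε / (stab M k + 1)) (by positivity)
    have h1 := (_root_.abs_le.1 (hd k)).2
    have h2 := hg.1 k
    have h3 : ε / (stab M k + 1) * stab M k ≤ ε := by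
      rw [div_mul_eq_mul_div, div_le_iff₀ (by positivity)]; nlinarith
    linarith
  · obtain ⟨g, hg, hd⟩ := hclose ((r - 1) / (2 * r * (1 + r))) (by positivity)
    obtain ⟨k, hk⟩ := hg.2 ((1 + r) / 2) (by linarith)
    refine ⟨k, ?_⟩
    have h1 := (_root_.abs_le.1 (hd k)).1
    have h2 := hg.1 k
    have h3 := mul_le_mul_of_nonneg_left h1 (show 0 ≤ 2 * r * (1 + r) by positivity)
    have e : 2 * r * (1 + r) * -((r - 1) / (2 * r * (1 + r)) * stab M k) = -((r - 1) * stab M k) := by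
      field_simp
    rw [e] at h3
    have h0 : 0 ≤ stab M k := le_trans (by positivity) (hs k)
    have h4 := mul_lt_mul_of_pos_left hk (show 0 < 4 * r by positivity)
    nlinarith

end FlatTorus

namespace FlatTorus

open scoped NNReal
open MeasureTheory

variable {M : TorusMetric}

/-! ### A tight frame of slopes -/

def nsq (v : V) : ℝ := v.1 ^ 2 + v.2 ^ 2

theorem nsq_nonneg (v : V) : 0 ≤ nsq v := by unfold nsq; positivity

theorem sq_dot_le (u v : V) : dot u v ^ 2 ≤ nsq u * nsq v := by
  simp only [dot, nsq]; nlinarith [sq_nonneg (u.1 * v.2 - u.2 * v.1)]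

theorem tight_frame {ι : Type} [Fintype ι] {e : ι → V} {w : ι → ℝ} (h11 : ∑ i, w i * (e i).1 ^ 2 = 1)
    (h12 : ∑ i, w i * ((e i).1 * (e i).2) = 0) (h22 : ∑ i, w i * (e i).2 ^ 2 = 1) (u : V) :
    ∑ i, (w i * dot (e i) u) • e i = u := by
  ext
  · rw [Prod.fst_sum]
    calc ∑ i, ((w i * dot (e i) u) • e i).1
        = u.1 * ∑ i, w i * (e i).1 ^ 2 + u.2 * ∑ i, w i * ((e i).1 * (e i).2) := by
          rw [Finset.mul_sum, Finset.mul_sum, ← Finset.sum_add_distrib]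
          refine Finset.sum_congr rfl fun i _ => ?_
          simp only [dot, Prod.smul_fst, smul_eq_mul]; ring
      _ = u.1 := by rw [h11, h12]; ring
  · rw [Prod.snd_sum]
    calc ∑ i, ((w i * dot (e i) u) • e i).2
        = u.1 * ∑ i, w i * ((e i).1 * (e i).2) + u.2 * ∑ i, w i * (e i).2 ^ 2 := by
          rw [Finset.mul_sum, Finset.mul_sum, ← Finset.sum_add_distrib]
          refine Finset.sum_congr rfl fun i _ => ?_
          simp only [dot, Prod.smul_snd, smul_eq_mul]; ring
      _ = u.2 := by rw [h12, h22]; ring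

theorem dot_sum {ι : Type} [Fintype ι] (β : ι → ℝ) (e : ι → V) (u : V) :
    dot (∑ i, β i • e i) u = ∑ i, β i * dot (e i) u := by
  simp only [dot, Prod.fst_sum, Prod.snd_sum, Finset.sum_mul, ← Finset.sum_add_distrib,
    Prod.smul_fst, Prod.smul_snd, smul_eq_mul]
  refine Finset.sum_congr rfl fun i _ => by ring

theorem nsq_frame_le {ι : Type} [Fintype ι] {e : ι → V} {w : ι → ℝ} (hw : ∀ i, 0 ≤ w i)
    (hfr : ∀ u, ∑ i, (w i * dot (e i) u) • e i = u) (α : ι → ℝ) :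
    nsq (∑ i, (w i * α i) • e i) ≤ ∑ i, w i * α i ^ 2 := by
  set U := ∑ i, (w i * α i) • e i with hU
  have h1 : nsq U = ∑ i, w i * α i * dot (e i) U := by
    rw [← dot_sum, ← hU]; simp only [nsq, dot]; ring
  have h2 : nsq U = ∑ i, w i * dot (e i) U * dot (e i) U := by
    rw [← dot_sum, hfr]; simp only [nsq, dot]; ring
  have h3 : 0 ≤ ∑ i, w i * (α i - dot (e i) U) ^ 2 :=
    Finset.sum_nonneg fun i _ => mul_nonneg (hw i) (sq_nonneg _)
  have h4 : ∑ i, w i * (α i - dot (e i) U) ^ 2 = ∑ i, w i * α i ^ 2 -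
      2 * ∑ i, w i * α i * dot (e i) U + ∑ i, w i * dot (e i) U * dot (e i) U := by
    rw [Finset.mul_sum, ← Finset.sum_sub_distrib, ← Finset.sum_add_distrib]
    exact Finset.sum_congr rfl fun i _ => by ring
  linarith

theorem exists_frame (M : TorusMetric) : ∃ (ι : Type) (_ : Fintype ι) (f e : ι → V) (w : ι → ℝ)
    (T : V →ₗ[ℝ] V), (∀ i, f i ∈ dualSphere M) ∧ (∀ i, 0 ≤ w i) ∧ ∑ i, w i = 2 ∧
      (∀ v, ∑ i, (w i * dot (f i) v) • e i = T v) ∧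
      (∀ α : ι → ℝ, nsq (∑ i, (w i * α i) • e i) ≤ ∑ i, w i * α i ^ 2) ∧
      ∀ f ∈ dualSphere M, ∀ v, dot f v ^ 2 ≤ nsq (T v) := by
  have hcr : crossDet ((gaugeN M (1, 0))⁻¹ • ((1, 0) : V)) ((gaugeN M (0, 1))⁻¹ • ((0, 1) : V)) ≠ 0 := by
    have h1 := gauge_pos (M := M) (show ((1, 0) : V) ≠ 0 by simp)
    have h2 := gauge_pos (M := M) (show ((0, 1) : V) ≠ 0 by simp)
    simp [crossDet, h1.ne', h2.ne']
  obtain ⟨ι, _, f, w, a, b, c, hf, hw, hw1, ha, hb, hc, ha0, hD, hS⟩ :=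
    exists_extremal_form (isCompact_dualSphere M) (normalize_mem_dualSphere (M := M)
      (show ((1, 0) : V) ≠ 0 by simp)) (normalize_mem_dualSphere (M := M)
      (show ((0, 1) : V) ≠ 0 by simp)) hcr
  obtain ⟨r, hr, rfl⟩ : ∃ r : ℝ, 0 < r ∧ a = r ^ 2 :=
    ⟨√a, Real.sqrt_pos.2 ha0, (Real.sq_sqrt ha0.le).symm⟩
  obtain ⟨s, hs, hs2⟩ : ∃ s : ℝ, 0 < s ∧ s ^ 2 = (r ^ 2 * c - b ^ 2) / r ^ 2 :=
    ⟨√((r ^ 2 * c - b ^ 2) / r ^ 2), Real.sqrt_pos.2 (by positivity), Real.sq_sqrt (by positivity)⟩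
  have hs3 : r ^ 2 * c = b ^ 2 + r ^ 2 * s ^ 2 := by rw [hs2]; field_simp; ring
  set Q : V → V := fun f => (f.1 / r, (f.2 - b / r ^ 2 * f.1) / s) with hQ
  let T : V →ₗ[ℝ] V :=
    { toFun := fun v => (r * v.1 + b / r * v.2, s * v.2)
      map_add' := fun p q => by ext <;> simp <;> ring
      map_smul' := fun t p => by ext <;> simp <;> ring }
  have hT : ∀ f v, dot f v = dot (Q f) (T v) := fun f v => by
    simp only [dot, hQ, T, LinearMap.coe_mk, AddHom.coe_mk]; field_simp; ring
  have hsum : ∀ A B C : ℝ, ∑ i, 2 * w i * (A * (f i).1 ^ 2 + B * ((f i).1 * (f i).2) + C * (f i).2 ^ 2) =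
      A * r ^ 2 + B * b + C * c := fun A B C => by
    rw [ha, hb, hc]
    simp only [Finset.mul_sum, ← Finset.sum_add_distrib]
    exact Finset.sum_congr rfl fun i _ => by ring
  have hfr : ∀ u, ∑ i, (2 * w i * dot (Q (f i)) u) • Q (f i) = u := by
    refine tight_frame ?_ ?_ ?_
    · convert hsum (1 / r ^ 2) 0 0 using 1
      · refine Finset.sum_congr rfl fun i _ => ?_
        simp only [hQ]; field_simp; ring
      · field_simp; ring
    · convert hsum (-(b / r ^ 2) / (r * s)) (1 / (r * s)) 0 using 1
      · refine Finset.sum_congr rfl fun i _ => ?_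
        simp only [hQ]; field_simp; ring
      · field_simp; ring
    · convert hsum ((b / r ^ 2) ^ 2 / s ^ 2) (-2 * (b / r ^ 2) / s ^ 2) (1 / s ^ 2) using 1
      · refine Finset.sum_congr rfl fun i _ => ?_
        simp only [hQ]; field_simp; ring
      · field_simp; linarith
  have hw' : ∀ i, 0 ≤ 2 * w i := fun i => by linarith [hw i]
  refine ⟨ι, ‹_›, f, fun i => Q (f i), fun i => 2 * w i, T, hf, hw', ?_, fun v => ?_,
    nsq_frame_le hw' hfr, fun f hf v => ?_⟩
  · rw [← Finset.mul_sum, hw1]; norm_num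
  · exact (Finset.sum_congr rfl fun i _ => by rw [hT]).trans (hfr (T v))
  · rw [hT]
    have h1 : nsq (Q f) ≤ 1 := by
      have e : nsq (Q f) = (c * f.1 ^ 2 + r ^ 2 * f.2 ^ 2 - 2 * b * (f.1 * f.2)) /
          (r ^ 2 * c - b ^ 2) := by
        rw [eq_div_iff hD.ne', show r ^ 2 * c - b ^ 2 = r ^ 2 * s ^ 2 by linarith]
        have : c = (b ^ 2 + r ^ 2 * s ^ 2) / r ^ 2 := by rw [← hs3]; field_simp
        rw [this]
        simp only [nsq, hQ]; field_simp; ring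
      rw [e, div_le_one hD]
      exact hS f hf
    exact (sq_dot_le _ _).trans (by nlinarith [nsq_nonneg (T v)])

/-! ### Fibrewise rotations -/

/-- Rotation by a right angle in the fibres of the cotangent bundle. -/
def rot (M : TorusMetric) (x p : V) : V :=
  (√(cD M x) * -(be M x * p.1 + ga M x * p.2), √(cD M x) * (al M x * p.1 + be M x * p.2))

theorem cD_mul_dual (x : V) : cD M x * (al M x * ga M x - be M x ^ 2) = 1 := by
  have h := (cD_pos M x).ne'
  simp only [al, be, ga]
  field_simp
  simp only [cD]
  ring

theorem sqrt_cD_mul (x : V) : √(cD M x) * √(cD M x) = cD M x := Real.mul_self_sqrt (cD_pos M x).le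

theorem bf_rot (x p : V) : bf M x (rot M x p) (rot M x p) = bf M x p p := by
  have h : bf M x (rot M x p) (rot M x p) = (√(cD M x) * √(cD M x)) *
      ((al M x * ga M x - be M x ^ 2) * bf M x p p) := by
    simp only [bf, rot]; ring
  rw [h, sqrt_cD_mul, ← mul_assoc, cD_mul_dual, one_mul]

theorem bf_sq_add_rot (x p q : V) : bf M x q p ^ 2 + bf M x q (rot M x p) ^ 2 =
    bf M x q q * bf M x p p := by
  have h : bf M x q (rot M x p) ^ 2 = (√(cD M x) * √(cD M x)) *
      crossDet (sharp M x q) (sharp M x p) ^ 2 := by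
    simp only [bf, rot, crossDet, sharp]; ring
  rw [h, sqrt_cD_mul, ← bf_gram]
  ring

theorem continuous_rot (M : TorusMetric) : Continuous fun z : V × V => rot M z.1 z.2 := by
  have h1 := (contDiff_al M).continuous
  have h2 := (contDiff_be M).continuous
  have h3 := (contDiff_ga M).continuous
  have h4 := (contDiff_cD M).continuous
  unfold rot
  fun_prop

def rotL (M : TorusMetric) (x : V) : V →ₗ[ℝ] V where
  toFun := rot M x
  map_add' p q := by ext <;> simp [rot] <;> ring
  map_smul' r p := by ext <;> simp [rot] <;> ring

theorem det_rotL (x : V) : LinearMap.det (rotL M x) = 1 := by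
  rw [← LinearMap.det_toMatrix (Module.Basis.finTwoProd ℝ), Matrix.det_fin_two]
  simp only [LinearMap.toMatrix_apply, Module.Basis.finTwoProd_zero, Module.Basis.finTwoProd_one,
    Module.Basis.coe_finTwoProd_repr, rotL, LinearMap.coe_mk, AddHom.coe_mk, rot, Matrix.cons_val_zero,
    Matrix.cons_val_one]
  have h1 := cD_mul_dual (M := M) x
  rw [← sqrt_cD_mul] at h1
  linarith

theorem measurePreserving_rot (M : TorusMetric) :
    MeasurePreserving (fun z : V × V => (z.1, rot M z.1 z.2)) volume volume := by
  have : ∀ x, Measure.map (rot M x) (volume : Measure V) = volume := fun x => by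
    have := Measure.map_linearMap_addHaar_eq_smul_addHaar (volume : Measure V)
      (f := rotL M x) (by rw [det_rotL]; exact one_ne_zero)
    rw [det_rotL] at this
    simp only [abs_one, inv_one, ENNReal.ofReal_one, one_smul] at this
    exact this
  exact (MeasurePreserving.id volume).skew_product (g := rot M) (continuous_rot M).measurable
    (Eventually.of_forall this)

theorem integral_rot {φ : V × V → ℝ} (hφ : Measurable φ) :
    ∫ z, φ (z.1, rot M z.1 z.2) ∂(liouville M) = ∫ z, φ z ∂(liouville M) := by
  have h := (measurePreserving_rot M).restrict_preimage
    (measurableSet_cell.inter (measurableSet_discBundle M))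
  have e : (fun z : V × V => (z.1, rot M z.1 z.2)) ⁻¹' (cell ∩ discBundle M) = cell ∩ discBundle M := by
    ext z
    simp [cell, discBundle, ham, bf_rot]
  rw [e] at h
  have h2 := integral_map (μ := volume.restrict (cell ∩ discBundle M)) h.measurable.aemeasurable
    (f := φ) hφ.aestronglyMeasurable
  rw [h.map_eq] at h2
  exact h2.symm

end FlatTorus

namespace FlatTorus

open scoped NNReal
open MeasureTheory

variable {M : TorusMetric}

/-! ### The mean square displacement of a calibrating function -/

theorem tendsto_dyadic {E : Type*} [NormedAddCommGroup E] [NormedSpace ℝ E] {φ : ℝ → E} {d : E}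
    (h : HasDerivAt φ d 0) (T : ℝ) :
    Tendsto (fun n : ℕ => (2 : ℝ) ^ n • (φ (T / 2 ^ n) - φ 0)) atTop (𝓝 (T • d)) := by
  rcases eq_or_ne T 0 with rfl | hT
  · simp
  have h1 := h.tendsto_slope_zero
  have h2 : Tendsto (fun n : ℕ => T / (2 : ℝ) ^ n) atTop (𝓝[≠] 0) := by
    refine tendsto_nhdsWithin_iff.2 ⟨?_, Eventually.of_forall fun n => ?_⟩
    · exact tendsto_const_nhds.div_atTop (tendsto_pow_atTop_atTop_of_one_lt one_lt_two)
    · exact div_ne_zero hT (by positivity)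
  refine ((h1.comp h2).const_smul T).congr fun n => ?_
  simp only [Function.comp_apply, zero_add, inv_div, smul_smul]
  congr 1
  field_simp

theorem exists_scale {z : V × V} (hz : ham M z ≤ 1 / 2) : ∃ r z₀, 0 ≤ r ∧ r ≤ 1 ∧
    ham M z₀ = 1 / 2 ∧ z = scale r z₀ ∧ r ^ 2 = bf M z.1 z.2 z.2 := by
  have h0 : bf M z.1 z.2 z.2 ≤ 1 := by
    have : bf M z.1 z.2 z.2 / 2 ≤ 1 / 2 := hz
    linarith
  by_cases hp : z.2 = 0
  · obtain ⟨p, hp1⟩ := exists_unit M z.1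
    refine ⟨0, (z.1, p), le_rfl, zero_le_one, ham_unit hp1, ?_, ?_⟩
    · ext <;> simp [scale, hp]
    · simp [hp, bf]
  · have hb := bf_pos M z.1 hp
    have hs := Real.sqrt_pos.2 hb
    refine ⟨√(bf M z.1 z.2 z.2), (z.1, (√(bf M z.1 z.2 z.2))⁻¹ • z.2), hs.le,
      Real.sqrt_le_one.2 h0, ?_, ?_, Real.sq_sqrt hb.le⟩
    · have e : ham M (z.1, (√(bf M z.1 z.2 z.2))⁻¹ • z.2) = (√(bf M z.1 z.2 z.2))⁻¹ ^ 2 * ham M z :=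
        ham_scale M _ z
      rw [e, inv_pow, Real.sq_sqrt hb.le, ham]
      field_simp
    · refine Prod.ext rfl ?_
      simp only [scale, smul_smul, mul_inv_cancel₀ hs.ne', one_smul]

theorem gx_scale {z : V × V} (hz : ham M z ≤ 1 / 2) {r : ℝ} (hr0 : 0 ≤ r) (hr : r ≤ 1) (t : ℝ) :
    gx M (scale r z) t = gx M z (r * t) := by
  rw [gx, hamFlow_scale M hz (by rwa [abs_of_nonneg hr0])]; rfl

theorem Calib.abs_gx_le {f : V} {F : V → ℝ} (hF : Calib M f F) {z : V × V} (hz : ham M z ≤ 1 / 2)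
    {t : ℝ} (ht : 0 ≤ t) : |F (gx M z t) - F z.1| ≤ t := by
  obtain ⟨r, z₀, hr0, hr1, hz₀, rfl, -⟩ := exists_scale hz
  rw [gx_scale hz₀.le hr0 hr1]
  have h1 := hF.abs_le (gx M z₀ 0) (gx M z₀ (r * t))
  have h2 := mdist_gx_le hz₀ (show 0 ≤ r * t by positivity)
  rw [gx_zero] at h1 h2
  have : r * t ≤ 1 * t := by gcongr
  calc _ ≤ r * t - 0 := h1.trans h2
    _ ≤ t := by linarith

theorem measurable_theta (h : NoCrossing M) {f : V} (hf : f ∈ dualSphere M) : Measurable (theta M f) := by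
  have e : theta M f = fun x => (fderiv ℝ (calibFun M f) x (1, 0), fderiv ℝ (calibFun M f) x (0, 1)) := by
    funext x
    rw [((isCalibrated_theta h hf x).hasFDerivAt (calib_calibFun hf.1)).fderiv]
    simp [dotL_apply, dot]
  rw [e]
  exact (measurable_fderiv_apply_const ℝ _ _).prodMk (measurable_fderiv_apply_const ℝ _ _)

theorem measurable_bf_theta (h : NoCrossing M) {f : V} (hf : f ∈ dualSphere M) :
    Measurable fun z : V × V => bf M z.1 (theta M f z.1) z.2 :=
  (continuous_bf M).measurable.comp
    (measurable_fst.prodMk (((measurable_theta h hf).comp measurable_fst).prodMk measurable_snd))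

theorem ae_ham_le (M : TorusMetric) : ∀ᵐ z ∂(liouville M), ham M z ≤ 1 / 2 :=
  (ae_restrict_mem (measurableSet_cell.inter (measurableSet_discBundle M))).mono fun _ hz => hz.2

theorem bf_le_one {z : V × V} (hz : ham M z ≤ 1 / 2) : bf M z.1 z.2 z.2 ≤ 1 := by
  have : bf M z.1 z.2 z.2 / 2 ≤ 1 / 2 := hz
  linarith

theorem continuous_kinetic (M : TorusMetric) : Continuous fun z : V × V => bf M z.1 z.2 z.2 :=
  (continuous_bf M).comp (f := fun z : V × V => (z.1, z.2, z.2)) (by fun_prop)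

theorem integrable_kinetic (M : TorusMetric) :
    Integrable (fun z : V × V => bf M z.1 z.2 z.2) (liouville M) := by
  refine Integrable.of_bound (continuous_kinetic M).aestronglyMeasurable 1 ((ae_ham_le M).mono fun z hz => ?_)
  rw [Real.norm_of_nonneg (bf_nonneg M _ _)]
  exact bf_le_one hz

theorem integral_bf_theta_sq (h : NoCrossing M) {f : V} (hf : f ∈ dualSphere M) :
    ∫ z, bf M z.1 (theta M f z.1) z.2 ^ 2 ∂(liouville M) =
      (∫ z, bf M z.1 z.2 z.2 ∂(liouville M)) / 2 := by
  have hid : ∀ z : V × V, bf M z.1 (theta M f z.1) z.2 ^ 2 +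
      bf M z.1 (theta M f z.1) (rot M z.1 z.2) ^ 2 = bf M z.1 z.2 z.2 := fun z => by
    rw [bf_sq_add_rot, (isCalibrated_theta h hf z.1).1, one_mul]
  have hm := (measurable_bf_theta h hf).pow_const 2
  have hi : Integrable (fun z : V × V => bf M z.1 (theta M f z.1) z.2 ^ 2) (liouville M) := by
    refine (integrable_kinetic M).mono' hm.aestronglyMeasurable (Eventually.of_forall fun z => ?_)
    rw [Real.norm_of_nonneg (sq_nonneg _), ← hid z]
    linarith [sq_nonneg (bf M z.1 (theta M f z.1) (rot M z.1 z.2))]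
  have hi2 : Integrable (fun z : V × V => bf M z.1 (theta M f z.1) (rot M z.1 z.2) ^ 2) (liouville M) := by
    refine ((integrable_kinetic M).sub hi).congr (Eventually.of_forall fun z => ?_)
    simp only [Pi.sub_apply]
    linarith [hid z]
  have h1 := integral_rot hm (M := M)
  have h2 := integral_add hi hi2
  simp only [hid] at h2
  simp only at h1
  linarith

theorem tendsto_mean_square (h : NoCrossing M) {f : V} (hf : f ∈ dualSphere M) {T : ℝ} (hT : 0 ≤ T) :
    Tendsto (fun n : ℕ => (4 : ℝ) ^ n *
      ∫ z, (calibFun M f (gx M z (T / 2 ^ n)) - calibFun M f z.1) ^ 2 ∂(liouville M)) atTop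
      (𝓝 (T ^ 2 * ((∫ z, bf M z.1 z.2 z.2 ∂(liouville M)) / 2))) := by
  have hF := calib_calibFun hf.1
  rw [← integral_bf_theta_sq h hf, ← integral_const_mul]
  have e : ∀ n : ℕ, (4 : ℝ) ^ n *
      ∫ z, (calibFun M f (gx M z (T / 2 ^ n)) - calibFun M f z.1) ^ 2 ∂(liouville M) =
      ∫ z, ((2 : ℝ) ^ n * (calibFun M f (gx M z (T / 2 ^ n)) - calibFun M f z.1)) ^ 2 ∂(liouville M) := by
    intro n
    rw [← integral_const_mul]
    refine integral_congr_ae (Eventually.of_forall fun z => ?_)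
    simp only [mul_pow, ← pow_mul, mul_comm n 2]
    simp only [pow_mul]
    norm_num
  simp only [e]
  refine tendsto_integral_of_dominated_convergence (fun _ => T ^ 2) (fun n => ?_)
    (integrable_const _) (fun n => ?_) ?_
  · refine Continuous.aestronglyMeasurable ?_
    have := hF.continuous.comp (gx_continuous M (T / 2 ^ n))
    have h2 := hF.continuous.comp (continuous_fst (X := V) (Y := V))
    exact (continuous_const.mul (this.sub h2)).pow 2
  · filter_upwards [ae_ham_le M] with z hz
    have h1 := hF.abs_gx_le hz (t := T / 2 ^ n) (by positivity)
    rw [Real.norm_of_nonneg (sq_nonneg _), ← sq_abs, abs_mul, abs_of_pos (by positivity : (0 : ℝ) < 2 ^ n)]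
    have h2 : 2 ^ n * |calibFun M f (gx M z (T / 2 ^ n)) - calibFun M f z.1| ≤ T := by
      calc _ ≤ 2 ^ n * (T / 2 ^ n) := by gcongr
        _ = T := by field_simp
    gcongr
  · filter_upwards [ae_ham_le M] with z hz
    have h1 := (isCalibrated_theta h hf z.1).hasFDerivAt hF
    have h2 := gx_hasDerivAt hz 0
    rw [gx_zero, gp_zero] at h2
    rw [← gx_zero (M := M) z] at h1
    have h3 := tendsto_dyadic (h1.comp_hasDerivAt 0 h2) T
    simp only [Function.comp_apply, gx_zero, smul_eq_mul, dotL_apply, dot_sharp] at h3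
    simpa [mul_pow] using h3.pow 2

end FlatTorus

namespace FlatTorus

open scoped NNReal
open MeasureTheory

variable {M : TorusMetric}

/-! ### The affine comparison map -/

theorem sq_norm2 (v : V) : norm2 v ^ 2 = nsq v := Real.sq_sqrt (nsq_nonneg v)

theorem norm2_nonneg (v : V) : 0 ≤ norm2 v := Real.sqrt_nonneg _

theorem norm2_add_le (u v : V) : norm2 (u + v) ≤ norm2 u + norm2 v := by
  have h1 := sq_norm2 (u + v)
  have h2 := sq_norm2 u
  have h3 := sq_norm2 v
  have h4 := sq_dot_le u v
  have h5 := norm2_nonneg u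
  have h6 := norm2_nonneg v
  have h7 : nsq (u + v) = nsq u + nsq v + 2 * dot u v := by simp [nsq, dot]; ring
  have h8 : dot u v ≤ norm2 u * norm2 v := by
    refine le_of_sq_le_sq ?_ (by positivity)
    rw [mul_pow, h2, h3]; exact h4
  refine le_of_sq_le_sq ?_ (by positivity)
  nlinarith

theorem norm2_neg (v : V) : norm2 (-v) = norm2 v := by simp [norm2]

theorem nsq_smul (r : ℝ) (v : V) : nsq (r • v) = r ^ 2 * nsq v := by simp [nsq]; ring

theorem norm2_smul {r : ℝ} (hr : 0 ≤ r) (v : V) : norm2 (r • v) = r * norm2 v := by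
  have : norm2 (r • v) = √(r ^ 2 * nsq v) := congrArg Real.sqrt (nsq_smul r v)
  rw [this, Real.sqrt_mul (sq_nonneg r), Real.sqrt_sq hr]; rfl

theorem norm2_le_of_nsq {v : V} {C : ℝ} (hC : 0 ≤ C) (h : nsq v ≤ C ^ 2) : norm2 v ≤ C :=
  Real.sqrt_le_iff.2 ⟨hC, h⟩

theorem continuous_nsq : Continuous nsq := by unfold nsq; fun_prop

structure Frame (M : TorusMetric) where
  ι : Type
  fin : Fintype ι
  f : ι → V
  e : ι → V
  w : ι → ℝ
  T : V →ₗ[ℝ] V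
  mem : ∀ i, f i ∈ dualSphere M
  nonneg : ∀ i, 0 ≤ w i
  sum_w : ∑ i, w i = 2
  sum_dot : ∀ v, ∑ i, (w i * dot (f i) v) • e i = T v
  nsq_le : ∀ α : ι → ℝ, nsq (∑ i, (w i * α i) • e i) ≤ ∑ i, w i * α i ^ 2
  sq_dot_le : ∀ f ∈ dualSphere M, ∀ v, dot f v ^ 2 ≤ nsq (T v)

instance (M : TorusMetric) : Nonempty (Frame M) := by
  obtain ⟨ι, h, f, e, w, T, h1, h2, h3, h4, h5, h6⟩ := exists_frame M
  exact ⟨⟨ι, h, f, e, w, T, h1, h2, h3, h4, h5, h6⟩⟩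

namespace Frame

variable (A : Frame M)

instance : Fintype A.ι := A.fin

def F (i : A.ι) : V → ℝ := calibFun M (A.f i)

theorem calib (i : A.ι) : Calib M (A.f i) (A.F i) := calib_calibFun (A.mem i).1

def G (x : V) : V := ∑ i, (A.w i * A.F i x) • A.e i

theorem G_sub (x y : V) : A.G y - A.G x = ∑ i, (A.w i * (A.F i y - A.F i x)) • A.e i := by
  simp only [G, ← Finset.sum_sub_distrib, ← sub_smul, mul_sub]

theorem nsq_G_sub_le (x y : V) :
    nsq (A.G y - A.G x) ≤ ∑ i, A.w i * (A.F i y - A.F i x) ^ 2 := by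
  rw [G_sub]; exact A.nsq_le _

theorem G_per (x : V) (k : ℤ × ℤ) : A.G (x + lat k) = A.G x + A.T (lat k) := by
  rw [← A.sum_dot, ← sub_eq_iff_eq_add', G_sub]
  refine Finset.sum_congr rfl fun i _ => ?_
  rw [(A.calib i).equi, add_sub_cancel_left]

theorem continuous_G : Continuous A.G := by
  have := fun i => (A.calib i).continuous
  unfold G
  fun_prop

def dG (x : V) : V →L[ℝ] V := ∑ i, (dotL (theta M (A.f i) x)).smulRight (A.w i • A.e i)

theorem dG_apply (x v : V) :
    A.dG x v = ∑ i, (A.w i * dot (theta M (A.f i) x) v) • A.e i := by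
  simp only [dG, sum_apply, ContinuousLinearMap.smulRight_apply, dotL_apply, smul_smul, mul_comm]

theorem hasFDerivAt_G (h : NoCrossing M) (x : V) : HasFDerivAt A.G (A.dG x) x := by
  have : ∀ i, HasFDerivAt (fun y => (A.w i * A.F i y) • A.e i)
      ((dotL (theta M (A.f i) x)).smulRight (A.w i • A.e i)) x := fun i => by
    have h1 := ((isCalibrated_theta h (A.mem i) x).hasFDerivAt (A.calib i)).smul_const
      (A.w i • A.e i)
    refine h1.congr_of_eventuallyEq (Eventually.of_forall fun y => ?_)
    simp only [smul_smul, mul_comm]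
  exact HasFDerivAt.fun_sum fun i _ => this i

theorem nsq_dG_add_rot (h : NoCrossing M) (x p : V) :
    nsq (A.dG x (sharp M x p)) + nsq (A.dG x (sharp M x (rot M x p))) ≤ 2 * bf M x p p := by
  rw [dG_apply, dG_apply]
  refine (add_le_add (A.nsq_le _) (A.nsq_le _)).trans_eq ?_
  rw [← A.sum_w, Finset.sum_mul, ← Finset.sum_add_distrib]
  refine Finset.sum_congr rfl fun i _ => ?_
  rw [dot_sharp, dot_sharp, ← mul_add, bf_sq_add_rot, (isCalibrated_theta h (A.mem i) x).1, one_mul]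

theorem exists_G_approx : ∃ C : ℝ, 0 < C ∧ ∀ x y, norm2 (A.G y - A.G x - A.T (y - x)) ≤ C := by
  obtain ⟨C, hC, hA⟩ := exists_calib_approx M
  refine ⟨4 * C, by positivity, fun x y => norm2_le_of_nsq (by positivity) ?_⟩
  rw [G_sub, ← A.sum_dot, ← Finset.sum_sub_distrib]
  simp only [← sub_smul, ← mul_sub]
  refine (A.nsq_le _).trans ?_
  calc _ ≤ ∑ i, A.w i * (2 * C) ^ 2 := by
        refine Finset.sum_le_sum fun i _ => mul_le_mul_of_nonneg_left ?_ (A.nonneg i)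
        refine sq_le_sq' ?_ ?_
        all_goals
          have h1 := _root_.abs_le.1 (hA _ (A.mem i).1 _ (A.calib i) x)
          have h2 := _root_.abs_le.1 (hA _ (A.mem i).1 _ (A.calib i) y)
          have h3 : dot (A.f i) (y - x) = dot (A.f i) y - dot (A.f i) x := by simp [dot]; ring
          linarith [h1.1, h1.2, h2.1, h2.2]
    _ ≤ (4 * C) ^ 2 := by
        rw [← Finset.sum_mul, A.sum_w]; nlinarith [sq_nonneg C]

theorem exists_progress (h : NoCrossing M) : ∃ C : ℝ, 0 < C ∧ ∀ z, ham M z = 1 / 2 → ∀ t, 0 ≤ t →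
    t - C ≤ norm2 (A.G (gx M z t) - A.G z.1) := by
  obtain ⟨C₁, hC₁, h1⟩ := exists_linear_progress h
  obtain ⟨C₂, hC₂, h2⟩ := A.exists_G_approx
  refine ⟨C₁ + C₂, by positivity, fun z hz t ht => ?_⟩
  obtain ⟨f, hf, hp⟩ := h1 z hz
  have h3 := hp t ht
  have h4 : dot f (gx M z t - z.1) ≤ norm2 (A.T (gx M z t - z.1)) :=
    Real.le_sqrt_of_sq_le (A.sq_dot_le f hf _)
  have h5 := norm2_add_le (A.G (gx M z t) - A.G z.1)
    (-(A.G (gx M z t) - A.G z.1 - A.T (gx M z t - z.1)))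
  rw [norm2_neg, show A.G (gx M z t) - A.G z.1 + -(A.G (gx M z t) - A.G z.1 - A.T (gx M z t - z.1)) =
    A.T (gx M z t - z.1) by abel] at h5
  linarith [h2 z.1 (gx M z t)]

/-- The displacement of `G` along the base curve of `z`. -/
def disp (T : ℝ) (z : V × V) : V := A.G (gx M z T) - A.G z.1

theorem continuous_disp (T : ℝ) : Continuous (A.disp T) :=
  (A.continuous_G.comp (gx_continuous M T)).sub (A.continuous_G.comp continuous_fst)

theorem disp_per (T : ℝ) (k : ℤ × ℤ) (z : V × V) : A.disp T (z + (lat k, 0)) = A.disp T z := by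
  simp only [disp, gx_per, Prod.fst_add, G_per]; abel

theorem disp_add (s t : ℝ) (z : V × V) :
    A.disp (t + s) z = A.disp s z + A.disp t (hamFlow M s z) := by
  simp only [disp, gx_flow]
  simp only [gx]
  abel

theorem nsq_disp_le {z : V × V} (hz : ham M z ≤ 1 / 2) {T : ℝ} (hT : 0 ≤ T) :
    nsq (A.disp T z) ≤ 2 * T ^ 2 := by
  refine (A.nsq_G_sub_le _ _).trans ?_
  rw [← A.sum_w, Finset.sum_mul]
  refine Finset.sum_le_sum fun i _ => mul_le_mul_of_nonneg_left ?_ (A.nonneg i)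
  rw [← sq_abs]
  gcongr
  exact (A.calib i).abs_gx_le hz hT

theorem integrable_disp {T : ℝ} (hT : 0 ≤ T) :
    Integrable (fun z => nsq (A.disp T z)) (liouville M) := by
  refine Integrable.of_bound (continuous_nsq.comp (A.continuous_disp T)).aestronglyMeasurable
    (2 * T ^ 2) ((ae_ham_le M).mono fun z hz => ?_)
  rw [Real.norm_of_nonneg (nsq_nonneg _)]
  exact A.nsq_disp_le hz hT

theorem integrable_disp_flow {T : ℝ} (hT : 0 ≤ T) (s : ℝ) :
    Integrable (fun z => nsq (A.disp T (hamFlow M s z))) (liouville M) := by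
  refine Integrable.of_bound (continuous_nsq.comp ((A.continuous_disp T).comp
    (continuous_hamFlow M s))).aestronglyMeasurable
    (2 * T ^ 2) ((ae_ham_le M).mono fun z hz => ?_)
  rw [Real.norm_of_nonneg (nsq_nonneg _)]
  exact A.nsq_disp_le ((ham_hamFlow M s z).trans_le hz) hT

/-- The mean square displacement. -/
def D (T : ℝ) : ℝ := ∫ z, nsq (A.disp T z) ∂(liouville M)

theorem D_double {T : ℝ} (hT : 0 ≤ T) : D A (2 * T) +
    ∫ z, nsq (A.disp T (hamFlow M T z) - A.disp T z) ∂(liouville M) = 4 * D A T := by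
  have e : ∀ z, nsq (A.disp T (hamFlow M T z) - A.disp T z) = 2 * nsq (A.disp T z) +
      2 * nsq (A.disp T (hamFlow M T z)) - nsq (A.disp (2 * T) z) := fun z => by
    rw [two_mul T, disp_add]
    simp only [nsq, Prod.fst_sub, Prod.snd_sub, Prod.fst_add, Prod.snd_add]; ring
  have h1 := A.integrable_disp hT
  have h2 := A.integrable_disp_flow hT T
  have h3 := A.integrable_disp (show 0 ≤ 2 * T by positivity)
  simp only [e]
  have h4 : Integrable (fun z => 2 * nsq (A.disp T z) + 2 * nsq (A.disp T (hamFlow M T z)))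
      (liouville M) := (h1.const_mul 2).add (h2.const_mul 2)
  rw [integral_sub h4 h3, integral_add (h1.const_mul 2)
    (h2.const_mul 2), integral_const_mul, integral_const_mul,
    integral_hamFlow T (f := fun z => nsq (A.disp T z)) fun k z => by rw [A.disp_per]]
  simp only [D]; ring

theorem D_double_le {T : ℝ} (hT : 0 ≤ T) : D A (2 * T) ≤ 4 * D A T := by
  have := A.D_double hT
  have h2 : 0 ≤ ∫ z, nsq (A.disp T (hamFlow M T z) - A.disp T z) ∂(liouville M) :=
    integral_nonneg fun _ => nsq_nonneg _
  linarith

theorem D_pow_le {T : ℝ} (hT : 0 ≤ T) (n : ℕ) : D A (2 ^ n * T) ≤ 4 ^ n * D A T := by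
  induction n with
  | zero => simp
  | succ n ih =>
    have := A.D_double_le (show 0 ≤ 2 ^ n * T by positivity)
    rw [pow_succ', pow_succ', mul_assoc, mul_assoc]
    linarith

/-- Total kinetic energy of the unit disc bundle. -/
def energy (M : TorusMetric) : ℝ := ∫ z, bf M z.1 z.2 z.2 ∂(liouville M)

theorem exists_le_D (h : NoCrossing M) : ∃ C : ℝ, ∀ T, 0 ≤ T → T ^ 2 * energy M - C * T ≤ D A T := by
  obtain ⟨C, hC, hp⟩ := A.exists_progress h
  refine ⟨2 * C * (liouville M).real univ, fun T hT => ?_⟩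
  have h1 : T ^ 2 * energy M - 2 * C * (liouville M).real univ * T =
      ∫ z, (T ^ 2 * bf M z.1 z.2 z.2 - 2 * C * T) ∂(liouville M) := by
    rw [integral_sub ((integrable_kinetic M).const_mul _) (integrable_const _), integral_const_mul,
      integral_const, energy, smul_eq_mul]
    ring
  rw [h1]
  refine integral_mono_ae (((integrable_kinetic M).const_mul _).sub (integrable_const _))
    (A.integrable_disp hT) ((ae_ham_le M).mono fun z hz => ?_)
  obtain ⟨r, z₀, hr0, hr1, hz₀, e, hr⟩ := exists_scale hz
  simp only
  rw [← hr, ← sq_norm2]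
  have h2 := hp z₀ hz₀ (r * T) (by positivity)
  rw [← gx_scale hz₀.le hr0 hr1, ← e, show z₀.1 = z.1 by rw [e]; rfl] at h2
  have h3 := norm2_nonneg (A.disp T z)
  have h2' : r * T - C ≤ norm2 (A.disp T z) := h2
  have h4 : r * T ≤ T := by nlinarith
  have h5 : 0 ≤ r * T := by positivity
  rcases le_total (r * T) C with h6 | h6
  · nlinarith
  · have : (r * T - C) ^ 2 ≤ norm2 (A.disp T z) ^ 2 := by
      gcongr
    nlinarith

theorem le_D (h : NoCrossing M) {T : ℝ} (hT : 0 ≤ T) : T ^ 2 * energy M ≤ D A T := by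
  obtain ⟨C, hC⟩ := A.exists_le_D h
  have h1 : Tendsto (fun n : ℕ => T ^ 2 * energy M - C * T / 2 ^ n) atTop
      (𝓝 (T ^ 2 * energy M - 0)) := tendsto_const_nhds.sub
    (tendsto_const_nhds.div_atTop (tendsto_pow_atTop_atTop_of_one_lt one_lt_two))
  rw [sub_zero] at h1
  refine le_of_tendsto' h1 fun n => ?_
  have h2 := (hC (2 ^ n * T) (by positivity)).trans (A.D_pow_le hT n)
  have e4 : (4 : ℝ) ^ n = 2 ^ n * 2 ^ n := by rw [← mul_pow]; norm_num
  have hp : (0 : ℝ) < 2 ^ n := by positivity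
  rw [e4] at h2
  have h3 : 2 ^ n * 2 ^ n * (T ^ 2 * energy M - C * T / 2 ^ n) ≤ 2 ^ n * 2 ^ n * D A T := by
    refine le_trans (le_of_eq ?_) h2
    field_simp
  exact le_of_mul_le_mul_left h3 (by positivity)

theorem D_le (h : NoCrossing M) {T : ℝ} (hT : 0 ≤ T) : D A T ≤ T ^ 2 * energy M := by
  have h1 := tendsto_finsetSum (Finset.univ : Finset A.ι) fun i _ =>
    (tendsto_mean_square h (A.mem i) hT).const_mul (A.w i)
  have e : ∑ i, A.w i * (T ^ 2 * ((∫ z, bf M z.1 z.2 z.2 ∂(liouville M)) / 2)) = T ^ 2 * energy M := by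
    rw [← Finset.sum_mul, A.sum_w, energy]; ring
  rw [e] at h1
  refine ge_of_tendsto' h1 fun n => ?_
  have hs : 0 ≤ T / 2 ^ n := by positivity
  have h2 := A.D_pow_le hs n
  rw [show 2 ^ n * (T / 2 ^ n) = T by field_simp] at h2
  refine h2.trans ?_
  have hi : ∀ i, Integrable (fun z : V × V => (A.F i (gx M z (T / 2 ^ n)) - A.F i z.1) ^ 2)
      (liouville M) := fun i => by
    refine Integrable.of_bound (Continuous.aestronglyMeasurable ?_) ((T / 2 ^ n) ^ 2)
      ((ae_ham_le M).mono fun z hz => ?_)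
    · exact (((A.calib i).continuous.comp (gx_continuous M _)).sub
        ((A.calib i).continuous.comp continuous_fst)).pow 2
    · rw [Real.norm_of_nonneg (sq_nonneg _), ← sq_abs]
      gcongr
      exact (A.calib i).abs_gx_le hz hs
  calc 4 ^ n * D A (T / 2 ^ n)
      ≤ 4 ^ n * ∫ z, ∑ i, A.w i * (A.F i (gx M z (T / 2 ^ n)) - A.F i z.1) ^ 2 ∂(liouville M) := by
        refine mul_le_mul_of_nonneg_left (integral_mono (A.integrable_disp hs)
          (integrable_finsetSum _ fun i _ => (hi i).const_mul _) fun z => A.nsq_G_sub_le _ _)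
          (by positivity)
    _ = _ := by
        rw [integral_finsetSum _ fun i _ => (hi i).const_mul _, Finset.mul_sum]
        refine Finset.sum_congr rfl fun i _ => ?_
        rw [integral_const_mul]
        simp only [F]
        ring

theorem integral_defect (h : NoCrossing M) {T : ℝ} (hT : 0 ≤ T) :
    ∫ z, nsq (A.disp T (hamFlow M T z) - A.disp T z) ∂(liouville M) = 0 := by
  have h1 := A.D_double hT
  have h2 : 0 ≤ ∫ z, nsq (A.disp T (hamFlow M T z) - A.disp T z) ∂(liouville M) :=
    integral_nonneg fun _ => nsq_nonneg _
  have h3 := A.D_le h hT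
  have h4 := A.le_D h (show 0 ≤ 2 * T by positivity)
  nlinarith

end Frame

end FlatTorus

namespace FlatTorus

open scoped NNReal
open MeasureTheory

variable {M : TorusMetric}

/-! ### Flatness -/

namespace Frame

variable (A : Frame M)

theorem defect_eq_zero_of_lt (h : NoCrossing M) {T : ℝ} (hT : 0 ≤ T) {z : V × V}
    (hz : ham M z < 1 / 2) : nsq (A.disp T (hamFlow M T z) - A.disp T z) = 0 := by
  set Q : V × V → ℝ := fun z => nsq (A.disp T (hamFlow M T z) - A.disp T z) with hQ
  have hQc : Continuous Q := continuous_nsq.comp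
    (((A.continuous_disp T).comp (continuous_hamFlow M T)).sub (A.continuous_disp T))
  have hQp : ∀ k z, Q (z + (lat k, 0)) = Q z := fun k z => by
    simp only [hQ, hamFlow_per, disp_per]
  have hle : Integrable Q (liouville M) := by
    refine Integrable.of_bound hQc.aestronglyMeasurable (8 * T ^ 2) ((ae_ham_le M).mono fun z hz => ?_)
    rw [Real.norm_of_nonneg (nsq_nonneg _)]
    have h1 := A.nsq_disp_le hz hT
    have h2 := A.nsq_disp_le ((ham_hamFlow M T z).trans_le hz) hT
    have h3 : Q z = 2 * nsq (A.disp T z) + 2 * nsq (A.disp T (hamFlow M T z)) -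
        nsq (A.disp T z + A.disp T (hamFlow M T z)) := by
      simp only [hQ, nsq, Prod.fst_sub, Prod.snd_sub, Prod.fst_add, Prod.snd_add]; ring
    linarith [nsq_nonneg (A.disp T z + A.disp T (hamFlow M T z))]
  have hae := (integral_eq_zero_iff_of_nonneg (fun z => nsq_nonneg _) hle).1 (A.integral_defect h hT)
  rw [liouville, Filter.EventuallyEq,
    ae_restrict_iff' (measurableSet_cell.inter (measurableSet_discBundle M))] at hae
  set U : Set (V × V) := {z | Q z ≠ 0 ∧ ham M z < 1 / 2} with hU
  have hUo : IsOpen U := (isOpen_ne_fun hQc continuous_const).inter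
    (isOpen_lt (contDiff_ham M).continuous continuous_const)
  have hU0 : volume (U ∩ cell) = 0 := by
    refine measure_mono_null (fun z hz => ?_) hae
    intro hn
    exact hz.1.1 (hn ⟨hz.2, hz.1.2.le⟩)
  have hUinv : ∀ k z, z + (lat k, 0) ∈ U ↔ z ∈ U := fun k z => by
    simp only [hU, mem_ofPred_eq, hQp, ham_per]
  have hfd := isAddFundamentalDomain_preimage continuous_id fun k z => rfl
  rw [preimage_id] at hfd
  have hvol : volume U = 0 := by
    refine hfd.measure_zero_of_invariant U ?_ hU0
    rintro ⟨γ, ⟨k, rfl⟩⟩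
    ext z
    rw [mem_vadd_set_iff_neg_vadd_mem, ← hUinv (-k) z]
    have e : -(⟨latHom k, ⟨k, rfl⟩⟩ : latGroup) +ᵥ z = z + (lat (-k), 0) := by
      rw [AddSubgroup.vadd_def]
      simp [latHom, lat_neg, add_comm]
    rw [e]
  have := hUo.eq_empty_of_measure_zero hvol
  by_contra hne
  have hmem : z ∈ U := ⟨hne, hz⟩
  rw [this] at hmem
  exact hmem

theorem disp_flow (h : NoCrossing M) {T : ℝ} (hT : 0 ≤ T) {z : V × V} (hz : ham M z = 1 / 2) :
    A.disp T (hamFlow M T z) = A.disp T z := by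
  have hc : Continuous fun r : ℝ => nsq (A.disp T (hamFlow M T (scale r z)) - A.disp T (scale r z)) := by
    have hs : Continuous fun r : ℝ => scale r z := by unfold scale; fun_prop
    exact continuous_nsq.comp (((A.continuous_disp T).comp ((continuous_hamFlow M T).comp hs)).sub
      ((A.continuous_disp T).comp hs))
  have h1 := (hc.tendsto 1).mono_left (nhdsWithin_le_nhds (s := Iio 1))
  have h2 : Tendsto (fun r : ℝ => nsq (A.disp T (hamFlow M T (scale r z)) - A.disp T (scale r z)))
      (𝓝[<] 1) (𝓝 0) := by
    refine tendsto_const_nhds.congr' ?_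
    filter_upwards [Ioo_mem_nhdsLT (show (0 : ℝ) < 1 by norm_num)] with r hr
    refine (A.defect_eq_zero_of_lt h hT ?_).symm
    rw [ham_scale, hz]
    nlinarith [hr.1, hr.2]
  have h3 := tendsto_nhds_unique h1 h2
  simp only [scale, one_smul] at h3
  set v := A.disp T (hamFlow M T z) - A.disp T z with hv
  have h4 : nsq v = 0 := h3
  refine sub_eq_zero.1 ?_
  rw [← hv]
  simp only [nsq] at h4
  ext
  · simp only [Prod.fst_zero]; nlinarith [sq_nonneg v.1, sq_nonneg v.2]
  · simp only [Prod.snd_zero]; nlinarith [sq_nonneg v.1, sq_nonneg v.2]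

theorem disp_double (h : NoCrossing M) {T : ℝ} (hT : 0 ≤ T) {z : V × V} (hz : ham M z = 1 / 2) :
    A.disp (2 * T) z = (2 : ℝ) • A.disp T z := by
  rw [two_mul T, disp_add, A.disp_flow h hT hz, two_smul]

theorem disp_pow (h : NoCrossing M) {T : ℝ} (hT : 0 ≤ T) {z : V × V} (hz : ham M z = 1 / 2) (n : ℕ) :
    (2 : ℝ) ^ n • A.disp (T / 2 ^ n) z = A.disp T z := by
  induction n with
  | zero => simp
  | succ n ih =>
    rw [← ih, pow_succ, mul_smul, ← A.disp_double h (by positivity) hz]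
    congr 2
    field_simp

theorem disp_eq (h : NoCrossing M) {T : ℝ} (hT : 0 ≤ T) {z : V × V} (hz : ham M z = 1 / 2) :
    A.disp T z = T • A.dG z.1 (sharp M z.1 z.2) := by
  have h2 := gx_hasDerivAt hz.le 0
  rw [gx_zero, gp_zero] at h2
  have h1 := A.hasFDerivAt_G h z.1
  rw [← gx_zero (M := M) z] at h1
  have h3 := tendsto_dyadic (h1.comp_hasDerivAt 0 h2) T
  simp only [Function.comp_apply, gx_zero] at h3
  refine tendsto_nhds_unique (tendsto_const_nhds.congr fun n => ?_) h3
  exact (A.disp_pow h hT hz n).symm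

theorem one_le_nsq_dG (h : NoCrossing M) {x p : V} (hp : bf M x p p = 1) :
    1 ≤ nsq (A.dG x (sharp M x p)) := by
  obtain ⟨C, hC, hpr⟩ := A.exists_progress h
  rw [← sq_norm2]
  by_contra hn
  push Not at hn
  set ν := norm2 (A.dG x (sharp M x p)) with hν
  have h0 : 0 ≤ ν := norm2_nonneg _
  have h1 : ν < 1 := by nlinarith
  have h2 : 0 < 1 - ν := by linarith
  have hT : 0 ≤ (C + 1) / (1 - ν) := by positivity
  have h3 := hpr (x, p) (ham_unit hp) _ hT
  have h4 : norm2 (A.disp ((C + 1) / (1 - ν)) (x, p)) = (C + 1) / (1 - ν) * ν := by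
    rw [A.disp_eq h hT (ham_unit hp), norm2_smul hT]
  have h5 : (C + 1) / (1 - ν) - C ≤ (C + 1) / (1 - ν) * ν := h4 ▸ h3
  have h6 : (C + 1) / (1 - ν) * (1 - ν) = C + 1 := by field_simp
  nlinarith

theorem norm2_dG (h : NoCrossing M) {x p : V} (hp : bf M x p p = 1) :
    norm2 (A.dG x (sharp M x p)) = 1 := by
  have h1 := A.one_le_nsq_dG h hp
  have h2 := A.one_le_nsq_dG h ((bf_rot x p).trans hp)
  have h3 := A.nsq_dG_add_rot h x p
  rw [hp] at h3
  have h4 : nsq (A.dG x (sharp M x p)) = 1 := by linarith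
  rw [← sq_norm2] at h4
  nlinarith [norm2_nonneg (A.dG x (sharp M x p))]

theorem norm2_G_sub (h : NoCrossing M) (x y : V) : norm2 (A.G y - A.G x) = M.dist x y := by
  obtain ⟨p, hp, hy⟩ := exists_minimizer M x y
  have hd := mdist_nonneg M x y
  have h1 : A.disp (M.dist x y) (x, p) = A.G y - A.G x := by rw [disp, hy]
  rw [← h1, A.disp_eq h hd (ham_unit hp), norm2_smul hd]
  have := A.norm2_dG h hp
  simp only
  rw [this, mul_one]

theorem injective_G (h : NoCrossing M) : Function.Injective A.G := fun x y hxy => by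
  by_contra hne
  have h1 := A.norm2_G_sub h x y
  rw [hxy, sub_self] at h1
  have h2 := mdist_pos M hne
  simp [norm2] at h1
  linarith

theorem surjective_G (h : NoCrossing M) : Function.Surjective A.G := fun Y => by
  have hunit : ∀ p : V, p ≠ 0 → bf M 0 ((√(bf M 0 p p))⁻¹ • p) ((√(bf M 0 p p))⁻¹ • p) = 1 := fun p hp => by
    have hb := bf_pos M 0 hp
    have e : ∀ (r : ℝ) (p : V), bf M 0 (r • p) (r • p) = r ^ 2 * bf M 0 p p := fun r p => by
      simp [bf]; ring
    rw [e, inv_pow, Real.sq_sqrt hb.le, inv_mul_cancel₀ hb.ne']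
  set L : V →L[ℝ] V := (A.dG 0).comp (sharpL M 0) with hL
  have hLs : ∀ p, L p = A.dG 0 (sharp M 0 p) := fun p => rfl
  have hinj : Function.Injective L := by
    refine (injective_iff_map_eq_zero L).2 fun p hp => ?_
    by_contra hne
    have h1 := A.norm2_dG h (hunit p hne)
    rw [← hLs, map_smul, hp, smul_zero] at h1
    simp [norm2] at h1
  obtain ⟨p, hp⟩ := (LinearMap.injective_iff_surjective (f := (L : V →ₗ[ℝ] V))).1 hinj (Y - A.G 0)
  have hp' : L p = Y - A.G 0 := hp
  by_cases hp0 : p = 0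
  · refine ⟨0, ?_⟩
    rw [hp0, map_zero] at hp'
    exact (sub_eq_zero.1 hp'.symm).symm
  · have hr := Real.sqrt_pos.2 (bf_pos M 0 hp0)
    have h1 := A.disp_eq h hr.le (ham_unit (hunit p hp0))
    simp only [← hLs, map_smul, smul_smul, mul_inv_cancel₀ hr.ne', one_smul, hp'] at h1
    exact ⟨_, sub_left_injective h1⟩

end Frame

theorem isFlat_of_noCrossing (h : NoCrossing M) : IsFlat M := by
  obtain ⟨A⟩ := (inferInstance : Nonempty (Frame M))
  refine ⟨Equiv.ofBijective A.G ⟨A.injective_G h, A.surjective_G h⟩, fun x y => ?_⟩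
  rw [mdist_comm]
  exact (A.norm2_G_sub h y x).symm

end FlatTorus

/-- Let `g` be a Riemannian metric on `T²` such that no geodesic `c : ℝ → ℝ²` on the
universal covering intersects any of its translates `τ c` (`τ` a nontrivial translation
element) transversally.  Then `g` is flat. -/
theorem stmt19 (M : TorusMetric)
    (h : ∀ c, M.IsGeodesic c → ∀ k : ℤ × ℤ, k ≠ 0 →
      transInter c (transl k c) Set.univ Set.univ = ∅) :
    IsFlat M :=
  FlatTorus.isFlat_of_noCrossing h
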